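/- Let A and B be derived equivalent finite dimensional algebras over a field. Then the trivial extension algebras satisfy ed(A ⋉ D(A)) = ed(B ⋉ D(B)). -/

import Mathlib

universe u

open CategoryTheory

namespace Paper

variable (A : Type u) [Ring A]

/-- `X` belongs to `add 𝒮`: it is a direct summand of a finite direct sum of members of `𝒮`. -/
def memAdd (S : Set (ModuleCat.{u} A)) (X : ModuleCat.{u} A) : Prop :=
  ∃ (n : ℕ) (M : Fin n → ModuleCat.{u} A) (Y : ModuleCat.{u} A),
    (∀ i, M i ∈ S) ∧ Nonempty ((X × Y) ≃ₗ[A] ((i : Fin n) → M i))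

/-- `add T` for a single module `T`. -/
def addOf (T : ModuleCat.{u} A) : Set (ModuleCat.{u} A) :=
  {X | memAdd A {T} X}

/-- `0 → X → Y → Z → 0` is a short exact sequence. -/
def IsSES {X Y Z : ModuleCat.{u} A} (f : X →ₗ[A] Y) (g : Y →ₗ[A] Z) : Prop :=
  Function.Injective f ∧ Function.Surjective g ∧ LinearMap.range f = LinearMap.ker g

/-- The extension product `𝒮 • 𝒯` of two classes of modules. -/
def bullet (S T : Set (ModuleCat.{u} A)) : Set (ModuleCat.{u} A) :=
  {X | memAdd A {W | Module.Finite A W ∧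
    ∃ (T₁ T₂ : ModuleCat.{u} A) (f : T₁ →ₗ[A] W) (g : W →ₗ[A] T₂),
      T₁ ∈ S ∧ T₂ ∈ T ∧ IsSES A f g} X}

/-- `[T]ₙ`. -/
def bracket (T : ModuleCat.{u} A) : ℕ → Set (ModuleCat.{u} A)
  | 0 => {X | Subsingleton X}
  | 1 => addOf A T
  | (n+2) => bullet A (addOf A T) (bracket T (n+1))

/-- The extension dimension of `A`. -/
noncomputable def extDim : ℕ∞ :=
  sInf {d : ℕ∞ | ∃ n : ℕ, d = n ∧ ∃ T : ModuleCat.{u} A, Module.Finite A T ∧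
    ∀ X : ModuleCat.{u} A, Module.Finite A X → X ∈ bracket A T (n + 1)}

/-- There is an exact sequence `0 → M_n → ⋯ → M_0 → X → 0` with all `M_i ∈ add M`. -/
def ResLen (M : ModuleCat.{u} A) : ModuleCat.{u} A → ℕ → Prop
  | X, 0 => X ∈ addOf A M
  | X, (n+1) => ∃ (M₀ : ModuleCat.{u} A) (g : M₀ →ₗ[A] X),
      M₀ ∈ addOf A M ∧ Function.Surjective g ∧
        ResLen M (ModuleCat.of A (LinearMap.ker g)) n

/-- `M`-wrd(X) ≤ n : there is an exact sequence `0 → M_n → ⋯ → M_0 → X ⊕ Y → 0`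
with all `M_i ∈ add M`. -/
def wrdLE (M X : ModuleCat.{u} A) (n : ℕ) : Prop :=
  ∃ Y : ModuleCat.{u} A, Module.Finite A Y ∧ ResLen A M (ModuleCat.of A (X × Y)) n

/-- The weak `M`-resolution dimension of `X`. -/
noncomputable def wrdMod (M X : ModuleCat.{u} A) : ℕ∞ :=
  sInf {d : ℕ∞ | ∃ n : ℕ, d = n ∧ wrdLE A M X n}

/-- The weak `M`-resolution dimension of the algebra `A`. -/
noncomputable def wrdAlg (M : ModuleCat.{u} A) : ℕ∞ :=
  sSup {d : ℕ∞ | ∃ X : ModuleCat.{u} A, Module.Finite A X ∧ d = wrdMod A M X}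

/-- The weak resolution dimension of `A`. -/
noncomputable def wrd : ℕ∞ :=
  sInf {d : ℕ∞ | ∃ M : ModuleCat.{u} A, Module.Finite A M ∧ d = wrdAlg A M}

end Paper

namespace Paper

variable (k : Type u) [Field k] (A : Type u) [Ring A] [Algebra k A]

/-- The left `A`-action on the `k`-dual of `A`: `(a • f) x = f (x * a)`. -/
noncomputable instance dualLeft : Module A (Module.Dual k A) where
  smul a f := f.comp (LinearMap.mulRight k a)
  one_smul f := by
    ext x
    change f (x * 1) = f x
    rw [mul_one]
  mul_smul a b f := by
    ext x
    change f (x * (a * b)) = f (x * a * b)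
    rw [mul_assoc]
  smul_zero a := by ext x; rfl
  smul_add a f g := by ext x; rfl
  add_smul a b f := by
    ext x
    change f (x * (a + b)) = f (x * a) + f (x * b)
    rw [mul_add, map_add]
  zero_smul f := by
    ext x
    change f (x * 0) = 0
    rw [mul_zero, map_zero]

/-- The right `A`-action on the `k`-dual of `A`: `(f • a) x = f (a * x)`. -/
noncomputable instance dualRight : Module Aᵐᵒᵖ (Module.Dual k A) where
  smul a f := f.comp (LinearMap.mulLeft k a.unop)
  one_smul f := by
    ext x
    change f ((1 : Aᵐᵒᵖ).unop * x) = f x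
    rw [MulOpposite.unop_one, one_mul]
  mul_smul a b f := by
    ext x
    change f ((a * b).unop * x) = f (b.unop * (a.unop * x))
    rw [MulOpposite.unop_mul, mul_assoc]
  smul_zero a := by ext x; rfl
  smul_add a f g := by ext x; rfl
  add_smul a b f := by
    ext x
    change f ((a + b).unop * x) = f (a.unop * x) + f (b.unop * x)
    rw [MulOpposite.unop_add, add_mul, map_add]
  zero_smul f := by
    ext x
    change f ((0 : Aᵐᵒᵖ).unop * x) = 0
    rw [MulOpposite.unop_zero, zero_mul, map_zero]

instance dualSMulComm : SMulCommClass A Aᵐᵒᵖ (Module.Dual k A) where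
  smul_comm a b f := by
    ext x
    change f (b.unop * (x * a)) = f (b.unop * x * a)
    rw [mul_assoc]

/-- The trivial extension `A ⋉ D(A)`. -/
noncomputable abbrev TrivExt : Type u := TrivSqZeroExt A (Module.Dual k A)

noncomputable example : Ring (TrivExt k A) := inferInstance

end Paper

namespace DerEq

open CategoryTheory Limits Pretriangulated Triangulated

universe v w

section Triang

variable {C : Type w} [Category.{v} C] [Preadditive C] [HasShift C ℤ]

/-- The degree `n` graded piece of the morphisms from `P` to `X`. -/
abbrev coh (P X : C) (n : ℤ) : Type v := P ⟶ X⟦n⟧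

/-- All morphisms `P ⟶ X⟦n⟧` are zero. -/
abbrev Van (P X : C) (n : ℤ) : Prop := Subsingleton (coh P X n)

/-- The map induced on graded pieces. -/
def cohMap (P : C) {X Y : C} (f : X ⟶ Y) (n : ℤ) :
    coh P X n →ₗ[(End P)ᵐᵒᵖ] coh P Y n where
  toFun x := x ≫ f⟦n⟧'
  map_add' := by intros; simp
  map_smul' := by intro r x; exact Category.assoc _ _ _

@[simp] lemma cohMap_apply (P : C) {X Y : C} (f : X ⟶ Y) (n : ℤ) (x : coh P X n) :
    cohMap P f n x = x ≫ f⟦n⟧' := rfl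

/-- Compatibility of the graded pieces with shifts. -/
def cohShift [∀ n : ℤ, (shiftFunctor C n).Additive] (P X : C) (i j k : ℤ) (h : i + j = k) :
    coh P (X⟦i⟧) j ≃ₗ[(End P)ᵐᵒᵖ] coh P X k where
  toFun x := x ≫ (shiftFunctorAdd' C i j k h).inv.app X
  invFun x := x ≫ (shiftFunctorAdd' C i j k h).hom.app X
  left_inv x := by simp
  right_inv x := by simp
  map_add' := by intros; simp
  map_smul' := by intro r x; exact Category.assoc _ _ _

lemma cohShift_naturality [∀ n : ℤ, (shiftFunctor C n).Additive] (P : C) {X Y : C} (f : X ⟶ Y)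
    (i j k : ℤ) (h : i + j = k) (x : coh P (X⟦i⟧) j) :
    cohShift P Y i j k h (cohMap P (f⟦i⟧') j x) = cohMap P f k (cohShift P X i j k h x) := by
  have := (shiftFunctorAdd' C i j k h).inv.naturality f
  dsimp at this
  simp [cohShift, this]

/-- Isomorphic objects have isomorphic graded pieces. -/
def cohIso (P : C) {X Y : C} (e : X ≅ Y) (n : ℤ) :
    coh P X n ≃ₗ[(End P)ᵐᵒᵖ] coh P Y n :=
  { cohMap P e.hom n with
    invFun := cohMap P e.inv n
    left_inv := by intro x; simp [← Functor.map_comp]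
    right_inv := by intro x; simp [← Functor.map_comp] }

lemma cohMap_comp (P : C) {X Y Z : C} (f : X ⟶ Y) (g : Y ⟶ Z) (n : ℤ) (x : coh P X n) :
    cohMap P (f ≫ g) n x = cohMap P g n (cohMap P f n x) := by simp

lemma van_iff (P X : C) (n : ℤ) : Van P X n ↔ ∀ x : coh P X n, x = 0 :=
  ⟨fun _ _ => Subsingleton.elim _ _, fun h => ⟨fun a b => (h a).trans (h b).symm⟩⟩

lemma Van.of_iso {P X Y : C} {n : ℤ} (e : X ≅ Y) (h : Van P X n) : Van P Y n :=
  (cohIso P e n).symm.toEquiv.subsingleton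

variable [HasZeroObject C] [∀ n : ℤ, (shiftFunctor C n).Additive] [Pretriangulated C]

lemma van_shift_iff (P X : C) (i j k : ℤ) (h : i + j = k) :
    Van P (X⟦i⟧) j ↔ Van P X k :=
  (cohShift P X i j k h).toEquiv.subsingleton_congr

lemma coh_exact₂ (P : C) (T : Triangle C) (hT : T ∈ distTriang C) (n : ℤ) :
    Function.Exact (cohMap P T.mor₁ n) (cohMap P T.mor₂ n) := by
  intro y
  constructor
  · intro hy
    have : ∃ x : P ⟶ T.obj₁⟦n⟧, y = x ≫ (n.negOnePow • T.mor₁⟦n⟧') :=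
      Triangle.coyoneda_exact₂ _ (Triangle.shift_distinguished T hT n) y (by
        change y ≫ (n.negOnePow • T.mor₂⟦n⟧') = 0
        rw [cohMap_apply] at hy
        rw [Linear.comp_units_smul, hy, smul_zero])
    obtain ⟨x, hx⟩ := this
    refine ⟨n.negOnePow • x, ?_⟩
    rw [cohMap_apply, hx, Linear.units_smul_comp, Linear.comp_units_smul]
  · rintro ⟨x, rfl⟩
    simp [← Functor.map_comp, comp_distTriang_mor_zero₁₂ T hT]

/-- The connecting map. -/
def cohδ (P : C) (T : Triangle C) (n n' : ℤ) (h : n + 1 = n') :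
    coh P T.obj₃ n →ₗ[(End P)ᵐᵒᵖ] coh P T.obj₁ n' :=
  (cohShift P T.obj₁ 1 n n' (by omega)).toLinearMap ∘ₗ cohMap P T.mor₃ n

lemma coh_exact₃ (P : C) (T : Triangle C) (hT : T ∈ distTriang C) (n n' : ℤ) (h : n + 1 = n') :
    Function.Exact (cohMap P T.mor₂ n) (cohδ P T n n' h) := by
  have := coh_exact₂ P _ (rot_of_distTriang T hT) n
  intro y
  exact ((cohShift P T.obj₁ 1 n n' (by omega)).map_eq_zero_iff).trans (this y)

lemma coh_exact₁ (P : C) (T : Triangle C) (hT : T ∈ distTriang C) (n n' : ℤ) (h : n + 1 = n') :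
    Function.Exact (cohδ P T n n' h) (cohMap P T.mor₁ n') := by
  have := coh_exact₂ P _ (rot_of_distTriang _ (rot_of_distTriang T hT)) n
  intro y
  obtain ⟨y, rfl⟩ := (cohShift P T.obj₁ 1 n n' (by omega)).surjective y
  rw [← cohShift_naturality]
  have h2 := this y
  change cohMap P (-T.mor₁⟦(1 : ℤ)⟧') n y = 0 ↔ y ∈ Set.range (cohMap P T.mor₃ n) at h2
  have h3 : cohMap P (-T.mor₁⟦(1 : ℤ)⟧') n y = - cohMap P (T.mor₁⟦(1 : ℤ)⟧') n y := by simp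
  rw [h3, neg_eq_zero] at h2
  rw [LinearEquiv.map_eq_zero_iff, h2]
  constructor
  · rintro ⟨z, rfl⟩
    exact ⟨z, rfl⟩
  · rintro ⟨z, hz⟩
    exact ⟨z, (cohShift P T.obj₁ 1 n n' (by omega)).injective hz⟩

lemma van₂ (P : C) (T : Triangle C) (hT : T ∈ distTriang C) (n : ℤ)
    (h₁ : Van P T.obj₁ n) (h₃ : Van P T.obj₃ n) : Van P T.obj₂ n := by
  rw [van_iff]
  intro y
  obtain ⟨x, rfl⟩ := ((coh_exact₂ P T hT n) y).1 (Subsingleton.elim _ _)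
  rw [Subsingleton.elim x 0, map_zero]

lemma van₃ (P : C) (T : Triangle C) (hT : T ∈ distTriang C) (n n' : ℤ) (h : n + 1 = n')
    (h₁ : Van P T.obj₁ n') (h₂ : Van P T.obj₂ n) : Van P T.obj₃ n := by
  rw [van_iff]
  intro y
  obtain ⟨x, rfl⟩ := ((coh_exact₃ P T hT n n' h) y).1 (Subsingleton.elim _ _)
  rw [Subsingleton.elim x 0, map_zero]

lemma van₁ (P : C) (T : Triangle C) (hT : T ∈ distTriang C) (n n' : ℤ) (h : n + 1 = n')
    (h₂ : Van P T.obj₂ n') (h₃ : Van P T.obj₃ n) : Van P T.obj₁ n' := by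
  rw [van_iff]
  intro y
  obtain ⟨x, rfl⟩ := ((coh_exact₁ P T hT n n' h) y).1 (Subsingleton.elim _ _)
  rw [Subsingleton.elim x 0, map_zero]

lemma van_shift_eq_zero (P X : C) (i j : ℤ) (h : Van P X (i - j)) (f : P⟦j⟧ ⟶ X⟦i⟧) : f = 0 := by
  have h2 : Van P (X⟦i⟧) (-j) := (van_shift_iff P X i (-j) (i - j) (by omega)).2 h
  apply (shiftFunctor C (-j)).map_injective
  rw [← cancel_epi ((shiftFunctorCompIsoId C j (-j) (by omega)).inv.app P)]
  rw [Functor.map_zero, comp_zero]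
  exact (van_iff _ _ _).1 h2 _

/-- The extension closure of the shifts of `P` by elements of `I`. -/
inductive ExtCl (P : C) (I : Set ℤ) : C → Prop
  | zero (X : C) (h : IsZero X) : ExtCl P I X
  | of (n : ℤ) (h : n ∈ I) : ExtCl P I (P⟦n⟧)
  | ext (T : Triangle C) (hT : T ∈ distTriang C) (h₁ : ExtCl P I T.obj₁)
      (h₃ : ExtCl P I T.obj₃) : ExtCl P I T.obj₂

lemma ExtCl.of_iso {P : C} {I : Set ℤ} {X Y : C} (e : X ≅ Y) (h : ExtCl P I X) : ExtCl P I Y := by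
  have : Triangle.mk (e.hom) (0 : Y ⟶ (HasZeroObject.zero' C).zero) 0 ∈ distTriang C :=
    (Triangle.distinguished_iff_of_isZero₃ _ (isZero_zero C)).2
      (inferInstanceAs (IsIso e.hom))
  exact ExtCl.ext _ this h (ExtCl.zero _ (isZero_zero C))

lemma ExtCl.mono {P : C} {I J : Set ℤ} (hIJ : I ⊆ J) {X : C} (h : ExtCl P I X) : ExtCl P J X := by
  induction h with
  | zero X h => exact .zero X h
  | of n h => exact .of n (hIJ h)
  | ext T hT _ _ ih1 ih2 => exact .ext T hT ih1 ih2

lemma ExtCl.shift {P : C} {I : Set ℤ} {X : C} (h : ExtCl P I X) (i : ℤ) (J : Set ℤ)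
    (hJ : ∀ n ∈ I, n + i ∈ J) : ExtCl P J (X⟦i⟧) := by
  induction h with
  | zero X h => exact .zero _ (Functor.map_isZero (shiftFunctor C i) h)
  | of n h => exact .of_iso ((shiftFunctorAdd' C n i (n + i) rfl).app P) (.of _ (hJ n h))
  | ext T hT _ _ ih1 ih2 => exact .ext _ (Triangle.shift_distinguished T hT i) ih1 ih2

/-- An object right orthogonal to the relevant shifts is right orthogonal to the closure. -/
lemma ExtCl.hom_eq_zero {P : C} {I : Set ℤ} {X : C} (h : ExtCl P I X) {E : C}
    (hE : ∀ n ∈ I, Van P E (-n)) (f : X ⟶ E) : f = 0 := by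
  have hE' : ∀ n ∈ I, ∀ f : P⟦n⟧ ⟶ E, f = 0 := by
    intro n hn f
    rw [← cancel_mono ((shiftFunctorZero C ℤ).inv.app E), zero_comp]
    exact van_shift_eq_zero P E 0 n (by simpa using hE n hn) _
  induction h with
  | zero X h => exact h.eq_of_src _ _
  | of n h => exact hE' n h f
  | ext T hT _ _ ih1 ih2 =>
    obtain ⟨g, rfl⟩ := Triangle.yoneda_exact₂ T hT f (ih1 _)
    rw [ih2 g, comp_zero]

lemma ExtCl.van {P Q : C} {I : Set ℤ} {X : C} (h : ExtCl P I X) {j : ℤ}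
    (hQ : ∀ n ∈ I, Van Q P (n + j)) : Van Q X j := by
  induction h with
  | zero X h =>
    rw [van_iff]; intro x
    exact (Functor.map_isZero (shiftFunctor C j) h).eq_of_tgt _ _
  | of n h => exact (van_shift_iff Q P n j _ rfl).2 (hQ n h)
  | ext T hT _ _ ih1 ih2 => exact van₂ Q T hT j ih1 ih2

lemma ExtCl.biprod {P : C} {I : Set ℤ} {X Y : C} (h : ExtCl P I X) (h' : ExtCl P I Y) :
    ExtCl P I (X ⊞ Y) := .ext _ (binaryBiproductTriangle_distinguished X Y) h h'

end Triang

end DerEq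

namespace DerEq

open CategoryTheory Limits Pretriangulated Triangulated

universe v w

section Kill

variable {C : Type w} [Category.{v} C] [Preadditive C] [HasShift C ℤ]
  [HasZeroObject C] [∀ n : ℤ, (shiftFunctor C n).Additive] [Pretriangulated C]

lemma ExtCl.biproduct {P : C} {I : Set ℤ} {X : C} (h : ExtCl P I X) (a : ℕ) :
    ExtCl P I (⨁ fun _ : Fin a => X) := by
  induction a with
  | zero =>
    refine .zero _ ((IsZero.iff_id_eq_zero _).2 ?_)
    ext i
    exact i.elim0
  | succ a ih =>
    refine ExtCl.of_iso ?_ (h.biprod ih)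
    refine ⟨biprod.desc (biproduct.ι (fun _ : Fin (a + 1) => X) 0)
      (biproduct.desc fun i => biproduct.ι (fun _ : Fin (a + 1) => X) i.succ),
      biprod.lift (biproduct.π (fun _ : Fin (a + 1) => X) 0)
      (biproduct.lift fun i => biproduct.π (fun _ : Fin (a + 1) => X) i.succ), ?_, ?_⟩
    · ext i j <;> simp [biproduct.ι_π, Fin.succ_ne_zero, Ne.symm (Fin.succ_ne_zero _)]
    · rw [biprod.lift_desc, biproduct.lift_desc, ← biproduct.total, Fin.sum_univ_succ]

/-- A finite free module mapped to `coh P X b` is realized by a triangle. -/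
lemma exists_kill (P : C) (hP : ∀ j : ℤ, j ≠ 0 → Van P P j) (X : C) (b : ℤ) (a : ℕ)
    (g : (Fin a → (End P)ᵐᵒᵖ) →ₗ[(End P)ᵐᵒᵖ] coh P X b) :
    ∃ (V X' : C) (i : V ⟶ X) (p : X ⟶ X') (d : X' ⟶ V⟦(1 : ℤ)⟧)
      (e : (Fin a → (End P)ᵐᵒᵖ) ≃ₗ[(End P)ᵐᵒᵖ] coh P V b),
      Triangle.mk i p d ∈ distTriang C ∧ ExtCl P {-b} V ∧ (∀ j, j ≠ b → Van P V j) ∧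
      ∀ s, cohMap P i b (e s) = g s := by
  let Q : C := ⨁ fun _ : Fin a => P
  let h : Q ⟶ X⟦b⟧ := biproduct.desc fun i => g (Pi.single i 1)
  let ε := (shiftFunctorCompIsoId C (-b) b (by omega)).app Q
  let i : Q⟦-b⟧ ⟶ X := (shiftFunctor C b).preimage (ε.hom ≫ h)
  have hi : i⟦b⟧' = ε.hom ≫ h := (shiftFunctor C b).map_preimage _
  obtain ⟨X', p, d, hT⟩ := distinguished_cocone_triangle i
  let e : (Fin a → (End P)ᵐᵒᵖ) ≃ₗ[(End P)ᵐᵒᵖ] coh P (Q⟦-b⟧) b :=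
    { toFun s := (biproduct.lift fun i => (s i).unop) ≫ ε.inv
      invFun x i := MulOpposite.op (x ≫ ε.hom ≫ biproduct.π _ i)
      left_inv s := by
        funext i
        simp
      right_inv x := by
        rw [← cancel_mono ε.hom]
        simp only [Category.assoc, Iso.inv_hom_id, Category.comp_id]
        apply biproduct.hom_ext
        intro j
        simp [Q]
      map_add' s t := by
        rw [← Preadditive.add_comp]
        congr 1
        apply biproduct.hom_ext
        intro j
        simp [Q]
      map_smul' r s := by
        change _ = r.unop ≫ _
        rw [← Category.assoc]
        congr 1
        apply biproduct.hom_ext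
        intro j
        simp only [biproduct.lift_π, Category.assoc]
        rfl }
  have hV : ExtCl P {-b} (Q⟦-b⟧) := by
    have h0 : ExtCl P {0} P := .of_iso ((shiftFunctorZero C ℤ).app P) (.of 0 rfl)
    exact (h0.biproduct a).shift (-b) _ (by simp)
  refine ⟨_, X', i, p, d, e, hT, hV, fun j hj => ?_, fun s => ?_⟩
  · refine hV.van (fun n hn => hP _ ?_)
    simp only [Set.mem_singleton_iff] at hn
    omega
  · change ((biproduct.lift fun i => (s i).unop) ≫ ε.inv) ≫ i⟦b⟧' = _
    rw [hi, Category.assoc, Iso.inv_hom_id_assoc, biproduct.lift_desc]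
    conv_rhs => rw [pi_eq_sum_univ s, map_sum]
    refine Finset.sum_congr rfl fun i _ => ?_
    rw [map_smul]
    change (s i).unop ≫ _ = (s i).unop ≫ _
    congr 2
    funext j
    simp [Pi.single_apply, eq_comm]

end Kill

end DerEq

namespace DerEq

open CategoryTheory Limits Pretriangulated Triangulated

universe v w

section Approx

variable {C : Type w} [Category.{v} C] [Preadditive C] [HasShift C ℤ]
  [HasZeroObject C] [∀ n : ℤ, (shiftFunctor C n).Additive] [Pretriangulated C]

lemma noeth₂ {P : C} {T : Triangle C} (hT : T ∈ distTriang C) (n : ℤ)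
    (h₁ : IsNoetherian (End P)ᵐᵒᵖ (coh P T.obj₁ n))
    (h₃ : IsNoetherian (End P)ᵐᵒᵖ (coh P T.obj₃ n)) :
    IsNoetherian (End P)ᵐᵒᵖ (coh P T.obj₂ n) :=
  isNoetherian_of_range_eq_ker _ _ (LinearMap.exact_iff.1 (coh_exact₂ P T hT n)).symm

lemma noeth₃ {P : C} {T : Triangle C} (hT : T ∈ distTriang C) (n n' : ℤ) (h : n + 1 = n')
    (h₁ : IsNoetherian (End P)ᵐᵒᵖ (coh P T.obj₁ n'))
    (h₂ : IsNoetherian (End P)ᵐᵒᵖ (coh P T.obj₂ n)) :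
    IsNoetherian (End P)ᵐᵒᵖ (coh P T.obj₃ n) :=
  isNoetherian_of_range_eq_ker _ _ (LinearMap.exact_iff.1 (coh_exact₃ P T hT n n' h)).symm

/-- `coh P P 0` is free of rank one. -/
def cohSelf (P : C) (m n : ℤ) (h : m + n = 0) :
    (End P)ᵐᵒᵖ ≃ₗ[(End P)ᵐᵒᵖ] coh P (P⟦m⟧) n where
  toFun s := s.unop ≫ (shiftFunctorCompIsoId C m n h).inv.app P
  invFun x := MulOpposite.op (x ≫ (shiftFunctorCompIsoId C m n h).hom.app P)
  left_inv s := by simp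
  right_inv x := by simp
  map_add' s t := Preadditive.add_comp _ _ _ _ _ _
  map_smul' r s := by
    change (_ ≫ _) ≫ _ = _ ≫ _ ≫ _
    rw [Category.assoc]
    rfl

lemma ExtCl.noeth {P : C} [IsNoetherianRing (End P)ᵐᵒᵖ] (hP : ∀ j : ℤ, j ≠ 0 → Van P P j)
    {I : Set ℤ} {X : C} (h : ExtCl P I X) (j : ℤ) : IsNoetherian (End P)ᵐᵒᵖ (coh P X j) := by
  induction h with
  | zero X h =>
    have : Van P X j := (van_iff _ _ _).2 fun x =>
      (Functor.map_isZero (shiftFunctor C j) h).eq_of_tgt _ _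
    infer_instance
  | of n h =>
    by_cases hn : n + j = 0
    · exact isNoetherian_of_linearEquiv (cohSelf P n j hn)
    · have : Van P (P⟦n⟧) j := (van_shift_iff P P n j _ rfl).2 (hP _ hn)
      infer_instance
  | ext T hT _ _ ih1 ih2 => exact noeth₂ hT j ih1 ih2

lemma ExtCl.zero_mem {P : C} {I : Set ℤ} : ExtCl P I (HasZeroObject.zero' C).zero :=
  .zero _ (isZero_zero C)

lemma exists_approx_gen [IsTriangulated C] (P : C) [IsNoetherianRing (End P)ᵐᵒᵖ]
    (hP : ∀ j : ℤ, j ≠ 0 → Van P P j)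
    (a : ℤ) (n : ℕ) (X : C)
    (hf : ∀ j, IsNoetherian (End P)ᵐᵒᵖ (coh P X j)) :
    ∃ (L E : C) (i : L ⟶ X) (p : X ⟶ E) (d : E ⟶ L⟦(1 : ℤ)⟧),
      Triangle.mk i p d ∈ distTriang C ∧ ExtCl P {k | -(a + n) ≤ k ∧ k < -a} L ∧
      (∀ j, a < j → (a + n < j → Van P X j) → Van P E j) ∧
      (∀ j, j < a → Van P X j → Van P E j) ∧
      ∀ j, IsNoetherian (End P)ᵐᵒᵖ (coh P E j) := by
  induction n generalizing X with
  | zero =>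
    exact ⟨_, X, _, _, _, contractible_distinguished₁ X, .zero_mem,
      fun j hj h => h (by simpa using hj), fun j _ h => h, hf⟩
  | succ n ih =>
    obtain ⟨r, s, hs⟩ := Module.Finite.exists_fin' (End P)ᵐᵒᵖ (coh P X (a + n + 1))
    obtain ⟨V, X₁, i, p, d, e, hT, hV, hV', he⟩ := exists_kill P hP X (a + n + 1) r s
    obtain ⟨L, E, i', p', d', hT', hL, hE, hE', hE''⟩ := ih X₁ (fun j =>
      noeth₃ hT j _ rfl (hV.noeth hP _) (hf j))
    replace hE : ∀ j, a < j → (a + (n + 1 : ℕ) < j → Van P X j) → Van P E j := by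
      intro j hj h
      refine hE j hj fun hj => ?_
      rcases (show j = a + n + 1 ∨ a + n + 1 < j by omega) with rfl | hj'
      · rw [van_iff]
        intro y
        obtain ⟨x, rfl⟩ := ((coh_exact₃ P _ hT _ _ rfl) y).1
          (@Subsingleton.elim _ (hV' _ (by omega)) _ _)
        obtain ⟨x, rfl⟩ := hs x
        rw [← he]
        exact ((coh_exact₂ P _ hT _) _).2 ⟨_, rfl⟩
      · exact van₃ P _ hT j (j + 1) rfl (hV' _ (by omega)) (h (by push_cast; omega))
    obtain ⟨L', i'', d'', hT''⟩ := distinguished_cocone_triangle₁ (p ≫ p')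
    have o := someOctahedron' rfl hT hT' hT''
    refine ⟨L', E, i'', p ≫ p', d'', hT'', ?_, hE, ?_, hE''⟩
    · refine ExtCl.ext _ o.mem (hV.mono ?_) (hL.mono ?_)
      · intro k hk
        simp only [Set.mem_singleton_iff] at hk
        simp only [Set.mem_ofPred_eq]
        push_cast
        omega
      · intro k hk
        simp only [Set.mem_ofPred_eq] at hk ⊢
        push_cast
        omega
    · intro j hj hX
      exact hE' j hj (van₃ P _ hT j (j + 1) rfl (hV' _ (by omega)) hX)

lemma exists_approx [IsTriangulated C] (P : C) [IsNoetherianRing (End P)ᵐᵒᵖ]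
    (hP : ∀ j : ℤ, j ≠ 0 → Van P P j)
    (a : ℤ) (n : ℕ) (X : C) (hv : ∀ j, a + n < j → Van P X j)
    (hf : ∀ j, IsNoetherian (End P)ᵐᵒᵖ (coh P X j)) :
    ∃ (L E : C) (i : L ⟶ X) (p : X ⟶ E) (d : E ⟶ L⟦(1 : ℤ)⟧),
      Triangle.mk i p d ∈ distTriang C ∧ ExtCl P {k | -(a + n) ≤ k ∧ k < -a} L ∧
      (∀ j, a < j → Van P E j) ∧ (∀ j, j < a → Van P X j → Van P E j) ∧
      ∀ j, IsNoetherian (End P)ᵐᵒᵖ (coh P E j) := by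
  obtain ⟨L, E, i, p, d, hT, hL, hE, h⟩ := exists_approx_gen P hP a n X hf
  exact ⟨L, E, i, p, d, hT, hL, fun j hj => hE j hj (hv j), h⟩

/-- A morphism from the extension closure sees only the top layer. -/
lemma exists_top (P : C) (hP : ∀ j : ℤ, j ≠ 0 → Van P P j) (m : ℤ) {L E : C}
    (hL : ExtCl P {n | n ≤ m} L) (hE : ∀ j, -m < j → Van P E j) (f : L ⟶ E) :
    ∃ (V : C) (u : L ⟶ V) (v : V ⟶ E), f = u ≫ v ∧ ExtCl P {m} V ∧
      Module.Projective (End P)ᵐᵒᵖ (coh P V (-m)) ∧ Module.Finite (End P)ᵐᵒᵖ (coh P V (-m)) := by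
  have triv : ∀ (L : C) (f : L ⟶ E), f = 0 → 
      ∃ (V : C) (u : L ⟶ V) (v : V ⟶ E), f = u ≫ v ∧ ExtCl P {m} V ∧
      Module.Projective (End P)ᵐᵒᵖ (coh P V (-m)) ∧
      Module.Finite (End P)ᵐᵒᵖ (coh P V (-m)) := by
    intro L f hf
    have : Van P (HasZeroObject.zero' C).zero (-m) := (van_iff _ _ _).2 fun x =>
      (Functor.map_isZero (shiftFunctor C (-m)) (isZero_zero C)).eq_of_tgt _ _
    exact ⟨(HasZeroObject.zero' C).zero, 0, 0, by simp [hf], .zero_mem, inferInstance,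
      inferInstance⟩
  induction hL with
  | zero X h => exact triv _ f (h.eq_of_src _ _)
  | of n hn =>
    rcases (show n ≤ m from hn).lt_or_eq with h | rfl
    · refine triv _ f ?_
      refine ExtCl.hom_eq_zero (P := P) (I := {n}) (.of n rfl) ?_ f
      intro n' hn'
      simp only [Set.mem_singleton_iff] at hn'
      exact hE _ (by omega)
    · exact ⟨_, 𝟙 _, f, by simp, .of n rfl,
        Module.Projective.of_equiv (cohSelf P n (-n) (by omega)),
        Module.Finite.equiv (cohSelf P n (-n) (by omega))⟩
  | ext T hT h₁ h₃ ih1 ih3 =>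
    obtain ⟨V₁, u₁, v₁, e₁, hV₁, p₁, q₁⟩ := ih1 (T.mor₁ ≫ f)
    obtain ⟨u, hu⟩ : ∃ u : T.obj₂ ⟶ V₁, u₁ = T.mor₁ ≫ u := by
      refine Triangle.yoneda_exact₂ _ (inv_rot_of_distTriang T hT) u₁ ?_
      refine (h₃.shift (-1) {n | n < m} ?_).hom_eq_zero ?_ _
      · intro n (hn : n ≤ m)
        change n + -1 < m
        omega
      · intro n hn
        refine hV₁.van fun n' hn' => hP _ ?_
        simp only [Set.mem_ofPred_eq, Set.mem_singleton_iff] at hn hn'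
        omega
    obtain ⟨g, hg⟩ := Triangle.yoneda_exact₂ T hT (f - u ≫ v₁) (by
      rw [Preadditive.comp_sub, e₁, hu, Category.assoc, sub_self])
    obtain ⟨V₃, u₃, v₃, e₃, hV₃, p₃, q₃⟩ := ih3 g
    let ε : coh P (V₁ ⊞ V₃) (-m) ≃ₗ[(End P)ᵐᵒᵖ] coh P V₁ (-m) × coh P V₃ (-m) :=
      { (cohMap P biprod.fst (-m)).prod (cohMap P biprod.snd (-m)) with
        invFun := fun x => cohMap P biprod.inl (-m) x.1 + cohMap P biprod.inr (-m) x.2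
        left_inv := by
          intro x
          change (x ≫ biprod.fst⟦-m⟧') ≫ biprod.inl⟦-m⟧' +
            (x ≫ biprod.snd⟦-m⟧') ≫ biprod.inr⟦-m⟧' = x
          rw [Category.assoc, Category.assoc, ← Preadditive.comp_add, ← Functor.map_comp,
            ← Functor.map_comp, ← Functor.map_add, biprod.total, CategoryTheory.Functor.map_id,
            Category.comp_id]
        right_inv := by
          rintro ⟨x, y⟩
          simp [← Functor.map_comp] }
    refine ⟨V₁ ⊞ V₃, biprod.lift u (T.mor₂ ≫ u₃), biprod.desc v₁ v₃, ?_, hV₁.biprod hV₃,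
      Module.Projective.of_equiv ε.symm, Module.Finite.equiv ε.symm⟩
    rw [biprod.lift_desc, Category.assoc, ← e₃, ← hg]
    abel

/-- If the projection `p : X ⟶ E` of an approximation factors through finitely many objects, then
`E` is a retract of their approximations up to a sum of copies of `P⟦m⟧`. -/
lemma exists_retract (P : C) (hP : ∀ j : ℤ, j ≠ 0 → Van P P j) (m : ℤ) {L X E : C}
    {i : L ⟶ X} {p : X ⟶ E} {d : E ⟶ L⟦(1 : ℤ)⟧} (hT : Triangle.mk i p d ∈ distTriang C)
    (hL : ExtCl P {n | n < m} L) (hE : ∀ j, -m < j → Van P E j) (r : ℕ) {L' X' E' : Fin r → C}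
    {i' : ∀ t, L' t ⟶ X' t} {p' : ∀ t, X' t ⟶ E' t} {d' : ∀ t, E' t ⟶ (L' t)⟦(1 : ℤ)⟧}
    (hT' : ∀ t, Triangle.mk (i' t) (p' t) (d' t) ∈ distTriang C)
    (hL' : ∀ t, ExtCl P {n | n < m} (L' t)) (hE' : ∀ t j, -m < j → Van P (E' t) j)
    (f : ∀ t, X ⟶ X' t) (g : ∀ t, X' t ⟶ E) (hp : p = ∑ t, f t ≫ g t) :
    ∃ (a : ℕ) (s : coh P E (-m) →ₗ[(End P)ᵐᵒᵖ]
        (∀ t, coh P (E' t) (-m)) × (Fin a → (End P)ᵐᵒᵖ))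
      (q : ((∀ t, coh P (E' t) (-m)) × (Fin a → (End P)ᵐᵒᵖ)) →ₗ[(End P)ᵐᵒᵖ] coh P E (-m)),
      q ∘ₗ s = LinearMap.id := by
  have h1 : ∀ t, ∃ h : E' t ⟶ E, g t = p' t ≫ h := fun t =>
    Triangle.yoneda_exact₂ _ (hT' t) (g t)
      ((hL' t).hom_eq_zero (fun n hn => hE _ (by simp only [Set.mem_ofPred_eq] at hn; omega)) _)
  have h2 : ∀ t, ∃ h : E ⟶ E' t, f t ≫ p' t = p ≫ h := fun t =>
    Triangle.yoneda_exact₂ _ hT (f t ≫ p' t)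
      (hL.hom_eq_zero (fun n hn => hE' t _ (by simp only [Set.mem_ofPred_eq] at hn; omega)) _)
  choose h hh using h1
  choose k hk using h2
  obtain ⟨y, hy⟩ : ∃ y : L⟦(1 : ℤ)⟧ ⟶ E, 𝟙 E - ∑ t, k t ≫ h t = d ≫ y :=
    Triangle.yoneda_exact₂ _ (rot_of_distTriang _ hT) (𝟙 E - ∑ t, k t ≫ h t) (by
      change p ≫ (𝟙 E - ∑ t, k t ≫ h t) = 0
      rw [Preadditive.comp_sub, Category.comp_id, Preadditive.comp_sum, sub_eq_zero]
      conv_lhs => rw [hp]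
      refine Finset.sum_congr rfl fun t _ => ?_
      rw [hh, ← Category.assoc, hk, Category.assoc])
  obtain ⟨V, u, v, rfl, -, hV, hV'⟩ := exists_top P hP m
    (hL.shift 1 {n | n ≤ m} (fun n hn => by
      simp only [Set.mem_ofPred_eq] at hn ⊢; omega)) hE y
  obtain ⟨a, π, hπ⟩ := Module.Finite.exists_fin' (End P)ᵐᵒᵖ (coh P V (-m))
  obtain ⟨σ, hσ⟩ := Module.projective_lifting_property π LinearMap.id hπ
  refine ⟨a, LinearMap.prod (LinearMap.pi fun t => cohMap P (k t) (-m))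
      (σ ∘ₗ cohMap P (d ≫ u) (-m)),
    LinearMap.coprod (LinearMap.lsum _ _ ℕ fun t => cohMap P (h t) (-m))
      (cohMap P v (-m) ∘ₗ π), ?_⟩
  ext x
  have hσ' := fun z => LinearMap.congr_fun hσ z
  simp only [LinearMap.comp_apply, LinearMap.id_apply] at hσ'
  simp only [LinearMap.comp_apply, LinearMap.coprod_apply, LinearMap.prod_apply,
    LinearMap.lsum_apply, LinearMap.sum_apply, LinearMap.proj_apply, LinearMap.pi_apply,
    LinearMap.id_apply, hσ']
  have h3 : ∑ t, k t ≫ h t + d ≫ u ≫ v = 𝟙 E := by rw [← hy]; abel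
  have h4 : x ≫ (∑ t, k t ≫ h t + d ≫ u ≫ v)⟦-m⟧' = x := by
    rw [h3, CategoryTheory.Functor.map_id, Category.comp_id]
  have h5 : ∀ z, π (σ z) ≫ v⟦-m⟧' = z ≫ v⟦-m⟧' := fun z => by rw [hσ']
  conv_rhs => rw [← h4]
  simp [Functor.map_sum, Preadditive.comp_sum]
  exact (h5 _).trans (by simp)

/-- The horseshoe lemma for approximations. -/
lemma exists_horseshoe [IsTriangulated C] (P : C) (m : ℤ) {X₁ W X₂ : C}
    {a : X₁ ⟶ W} {f : W ⟶ X₂} {δ : X₂ ⟶ X₁⟦(1 : ℤ)⟧} (hT : Triangle.mk a f δ ∈ distTriang C)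
    {L₁ E₁ L₂ E₂ : C}
    {i₁ : L₁ ⟶ X₁} {p₁ : X₁ ⟶ E₁} {d₁ : E₁ ⟶ L₁⟦(1 : ℤ)⟧}
    (hT₁ : Triangle.mk i₁ p₁ d₁ ∈ distTriang C)
    {i₂ : L₂ ⟶ X₂} {p₂ : X₂ ⟶ E₂} {d₂ : E₂ ⟶ L₂⟦(1 : ℤ)⟧}
    (hT₂ : Triangle.mk i₂ p₂ d₂ ∈ distTriang C)
    (hL₁ : ExtCl P {n | n < m} L₁) (hL₂ : ExtCl P {n | n < m} L₂)
    (hE₁ : ∀ j, -m < j → Van P E₁ j) :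
    ∃ (L E : C) (i : L ⟶ W) (p : W ⟶ E) (d : E ⟶ L⟦(1 : ℤ)⟧) (b : E₁ ⟶ E) (c : E ⟶ E₂)
      (e : E₂ ⟶ E₁⟦(1 : ℤ)⟧), Triangle.mk i p d ∈ distTriang C ∧
      Triangle.mk b c e ∈ distTriang C ∧ ExtCl P {n | n < m} L := by
  obtain ⟨F, jF, dF, hF⟩ := distinguished_cocone_triangle₁ (f ≫ p₂)
  have o := someOctahedron' rfl hT hT₂ hF
  obtain ⟨q, hq⟩ : ∃ q : F ⟶ E₁, p₁ = o.m₁ ≫ q :=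
    Triangle.yoneda_exact₂ _ (inv_rot_of_distTriang _ o.mem) p₁
      ((hL₂.shift (-1) {n | n < m} (fun n hn => by
        simp only [Set.mem_ofPred_eq] at hn ⊢; omega)).hom_eq_zero
        (fun n hn => hE₁ _ (by simp only [Set.mem_ofPred_eq] at hn; omega)) _)
  obtain ⟨L, jL, dL, hL⟩ := distinguished_cocone_triangle₁ q
  have o2 := someOctahedron' hq.symm (inv_rot_of_distTriang _ o.mem) hL hT₁
  obtain ⟨E, p, d, hE⟩ := distinguished_cocone_triangle (jL ≫ jF)
  have o3 := someOctahedron rfl hL hF hE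
  refine ⟨L, E, _, p, d, _, _, _, hE, o3.mem, ?_⟩
  refine ExtCl.ext _ (rot_of_distTriang _ o2.mem) hL₁ ?_
  exact ExtCl.of_iso ((shiftFunctorCompIsoId C (-1 : ℤ) 1 (by omega)).symm.app L₂) hL₂

end Approx

end DerEq

namespace DerEq

open Paper CategoryTheory

universe v

section Bracket

variable {S : Type v} [Ring S]

lemma sum_map_single {ι : Type*} [Fintype ι] [DecidableEq ι] {M : ι → Type*}
    [∀ i, AddCommGroup (M i)] [∀ i, Module S (M i)] {X : Type*} [AddCommGroup X] [Module S X]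
    (q : (∀ i, M i) →ₗ[S] X) (y : ∀ i, M i) : ∑ i, q (Pi.single i (y i)) = q y := by
  rw [← map_sum, Finset.univ_sum_single]

lemma memAdd_of_sum {𝒮 : Set (ModuleCat.{v} S)} {X : ModuleCat.{v} S} {ι : Type*} [Fintype ι]
    (M : ι → ModuleCat.{v} S) (hM : ∀ i, M i ∈ 𝒮) (s : ∀ i, X →ₗ[S] M i) (q : ∀ i, M i →ₗ[S] X)
    (h : ∀ x, ∑ i, q i (s i x) = x) : memAdd S 𝒮 X := by
  classical
  let ε := Fintype.equivFin ι
  let σ : X →ₗ[S] ∀ j : Fin (Fintype.card ι), M (ε.symm j) := LinearMap.pi fun j => s _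
  let π : (∀ j : Fin (Fintype.card ι), M (ε.symm j)) →ₗ[S] X :=
    LinearMap.lsum _ _ ℕ fun j => q _
  have hπ : ∀ x, π (σ x) = x := by
    intro x
    conv_rhs => rw [← h x]
    simp only [π, σ, LinearMap.lsum_apply, LinearMap.sum_apply, LinearMap.comp_apply,
      LinearMap.proj_apply, LinearMap.pi_apply]
    exact ε.symm.sum_comp (fun i => q i (s i x))
  refine ⟨Fintype.card ι, fun j => M (ε.symm j), ModuleCat.of S (LinearMap.ker π), fun j => hM _,
    ⟨{ σ.coprod (Submodule.subtype (LinearMap.ker π)) with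
        invFun := fun z => (π z, ⟨z - σ (π z), by simp [hπ]⟩)
        left_inv := ?_
        right_inv := ?_ }⟩⟩
  · rintro ⟨x, y⟩
    have hy : π y.1 = 0 := y.2
    refine Prod.ext ?_ (Subtype.ext ?_)
    · simp [hπ, hy]
    · simp [hπ, hy]
  · intro z
    simp

lemma memAdd_of_subsingleton (𝒮 : Set (ModuleCat.{v} S)) {X : ModuleCat.{v} S} [Subsingleton X] :
    memAdd S 𝒮 X :=
  memAdd_of_sum (fun i : Empty => i.elim) (fun i => i.elim) (fun i => i.elim) (fun i => i.elim)
    (fun _ => Subsingleton.elim _ _)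

/-- The summands of an element of `memAdd`. -/
lemma memAdd_sum {𝒮 : Set (ModuleCat.{v} S)} {X : ModuleCat.{v} S} (h : memAdd S 𝒮 X) :
    ∃ (r : ℕ) (M : Fin r → ModuleCat.{v} S) (s : ∀ i, X →ₗ[S] M i) (q : ∀ i, M i →ₗ[S] X),
      (∀ i, M i ∈ 𝒮) ∧ ∀ x, ∑ i, q i (s i x) = x := by
  obtain ⟨r, M, Y, hM, ⟨e⟩⟩ := h
  refine ⟨r, M, fun i => LinearMap.proj i ∘ₗ e.toLinearMap ∘ₗ LinearMap.inl S X Y,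
    fun i => LinearMap.fst S X Y ∘ₗ e.symm.toLinearMap ∘ₗ LinearMap.single S (fun i => M i) i, hM, fun x => ?_⟩
  refine (sum_map_single (LinearMap.fst S X Y ∘ₗ e.symm.toLinearMap) (e (x, 0))).trans ?_
  simp

lemma bracket_of_subsingleton (N : ModuleCat.{v} S) (n : ℕ) {X : ModuleCat.{v} S}
    [Subsingleton X] : X ∈ bracket S N n := by
  match n with
  | 0 => exact ‹_›
  | 1 => exact memAdd_of_subsingleton _
  | n + 2 => exact memAdd_of_subsingleton _

lemma free_mem_addOf (K : ModuleCat.{v} S) (a : ℕ) :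
    ModuleCat.of S (Fin a → S) ∈ addOf S (ModuleCat.of S (K × S)) :=
  memAdd_of_sum (fun _ : Fin a => ModuleCat.of S (K × S)) (fun _ => rfl)
    (fun i => LinearMap.inr S K S ∘ₗ LinearMap.proj i)
    (fun i => LinearMap.single S _ i ∘ₗ LinearMap.snd S K S) fun x => by
      simp only [LinearMap.comp_apply, LinearMap.proj_apply, LinearMap.inr_apply,
        LinearMap.snd_apply, LinearMap.coe_single]
      exact Finset.univ_sum_single x

lemma bracket_one_of_retract (K : ModuleCat.{v} S) {X : ModuleCat.{v} S} {r a : ℕ}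
    (s : X →ₗ[S] (Fin r → K) × (Fin a → S)) (q : ((Fin r → K) × (Fin a → S)) →ₗ[S] X)
    (h : q ∘ₗ s = LinearMap.id) : X ∈ bracket S (ModuleCat.of S (K × S)) 1 := by
  classical
  refine memAdd_of_sum (fun _ : Fin r ⊕ Fin a => ModuleCat.of S (K × S)) (fun _ => rfl)
    (fun i => i.elim
      (fun t => LinearMap.inl S K S ∘ₗ LinearMap.proj t ∘ₗ LinearMap.fst S _ _ ∘ₗ s)
      (fun t => LinearMap.inr S K S ∘ₗ LinearMap.proj t ∘ₗ LinearMap.snd S _ _ ∘ₗ s))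
    (fun i => i.elim
      (fun t => q ∘ₗ LinearMap.inl S _ _ ∘ₗ LinearMap.single S (fun _ => K) t ∘ₗ LinearMap.fst S K S)
      (fun t => q ∘ₗ LinearMap.inr S _ _ ∘ₗ LinearMap.single S (fun _ => S) t ∘ₗ LinearMap.snd S K S))
    fun x => ?_
  rw [Fintype.sum_sum_type]
  refine (congr_arg₂ (· + ·) (sum_map_single (q ∘ₗ LinearMap.inl S _ _) (s x).1)
    (sum_map_single (q ∘ₗ LinearMap.inr S _ _) (s x).2)).trans ?_
  change q _ + q _ = _
  rw [← map_add]
  conv_rhs => rw [← LinearMap.id_apply (R := S) x, ← h]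
  simp

lemma bracket_succ_of_retract (K : ModuleCat.{v} S) (n : ℕ) {X : ModuleCat.{v} S} {r a : ℕ}
    (W : Fin r → ModuleCat.{v} S)
    (hW : ∀ t, W t ∈ {W : ModuleCat.{v} S | Module.Finite S W ∧
      ∃ (T₁ T₂ : ModuleCat.{v} S) (f : T₁ →ₗ[S] W) (g : W →ₗ[S] T₂),
      T₁ ∈ addOf S (ModuleCat.of S (K × S)) ∧
      T₂ ∈ bracket S (ModuleCat.of S (K × S)) (n + 1) ∧ IsSES S f g})
    (s : X →ₗ[S] (∀ t, W t) × (Fin a → S)) (q : ((∀ t, W t) × (Fin a → S)) →ₗ[S] X)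
    (h : q ∘ₗ s = LinearMap.id) : X ∈ bracket S (ModuleCat.of S (K × S)) (n + 2) := by
  classical
  refine memAdd_of_sum (ι := Option (Fin r)) (fun i => i.elim (ModuleCat.of S (Fin a → S)) W) ?_
    (fun i => match i with
      | none => LinearMap.snd S _ _ ∘ₗ s
      | some t => LinearMap.proj t ∘ₗ LinearMap.fst S _ _ ∘ₗ s)
    (fun i => match i with
      | none => q ∘ₗ LinearMap.inr S _ _
      | some t => q ∘ₗ LinearMap.inl S _ _ ∘ₗ LinearMap.single S (fun t => W t) t)
    fun x => ?_
  · rintro (_ | t)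
    · refine ⟨inferInstanceAs (Module.Finite S (Fin a → S)), ModuleCat.of S (Fin a → S),
        ModuleCat.of S PUnit, LinearMap.id, 0, free_mem_addOf K a, bracket_of_subsingleton _ _,
        Function.injective_id, fun y => ⟨0, Subsingleton.elim _ _⟩, ?_⟩
      exact LinearMap.range_id.trans LinearMap.ker_zero.symm
    · exact hW t
  · rw [Fintype.sum_option]
    refine (congr_arg₂ (· + ·) rfl
      (sum_map_single (q ∘ₗ LinearMap.inl S _ _) (s x).1)).trans ?_
    change q (0, (s x).2) + q _ = _
    rw [← map_add]
    conv_rhs => rw [← LinearMap.id_apply (R := S) x, ← h]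
    simp

end Bracket

section Transfer

variable {S : Type v} [Ring S] {S' : Type u} [Ring S']

/-- `X` and `X'` correspond to each other along the ring isomorphism `e`. -/
def Corr (e : S ≃+* S') (X : ModuleCat.{v} S) (X' : ModuleCat.{u} S') : Prop :=
  ∃ φ : X ≃+ X', ∀ (s : S) x, φ (s • x) = e s • φ x

lemma Corr.symm {e : S ≃+* S'} {X : ModuleCat.{v} S} {X' : ModuleCat.{u} S'} (h : Corr e X X') :
    Corr e.symm X' X := by
  obtain ⟨φ, hφ⟩ := h
  refine ⟨φ.symm, fun s x => φ.injective ?_⟩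
  simp [hφ]

lemma exists_corr (e : S ≃+* S') (X : ModuleCat.{v} S) [Module.Finite S X] :
    ∃ X' : ModuleCat.{u} S', Corr e X X' := by
  obtain ⟨n, f, hf⟩ := Module.Finite.exists_fin' S X
  have : Small.{u} S := ⟨_, ⟨e.toEquiv⟩⟩
  have : Small.{u} X := small_of_surjective hf
  let _ : Module S' (Shrink.{u} X) := Module.compHom _ e.symm.toRingHom
  refine ⟨ModuleCat.of S' (Shrink.{u} X), (Shrink.addEquiv (α := X)).symm, fun s x => ?_⟩
  change (Shrink.addEquiv (α := X)).symm (s • x) = e.symm (e s) • (Shrink.addEquiv (α := X)).symm x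
  rw [RingEquiv.symm_apply_apply]
  exact (Shrink.linearEquiv S X).symm.map_smul s x

/-- Transport of a linear map. -/
def transMap (e : S ≃+* S') {X Y : ModuleCat.{v} S} {X' Y' : ModuleCat.{u} S'}
    (φ : X ≃+ X') (hφ : ∀ (s : S) x, φ (s • x) = e s • φ x)
    (ψ : Y ≃+ Y') (hψ : ∀ (s : S) x, ψ (s • x) = e s • ψ x) (f : X →ₗ[S] Y) : X' →ₗ[S'] Y' where
  toFun x := ψ (f (φ.symm x))
  map_add' := by simp
  map_smul' r x := by
    have : φ.symm (r • x) = e.symm r • φ.symm x := φ.injective (by simp [hφ])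
    simp [this, hψ]

lemma Corr.finite {e : S ≃+* S'} {X : ModuleCat.{v} S} {X' : ModuleCat.{u} S'} (h : Corr e X X')
    [hf : Module.Finite S X] : Module.Finite S' X' := by
  obtain ⟨φ, hφ⟩ := h
  obtain ⟨s, hs⟩ := hf.fg_top
  classical
  refine ⟨⟨s.image φ, ?_⟩⟩
  rw [eq_top_iff]
  rintro x -
  obtain ⟨x, rfl⟩ := φ.surjective x
  have hx : x ∈ Submodule.span S (s : Set X) := hs ▸ Submodule.mem_top
  induction hx using Submodule.span_induction with
  | mem x hx => exact Submodule.subset_span (by simpa using hx)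
  | zero => simp
  | add x y _ _ h1 h2 => rw [map_add]; exact add_mem h1 h2
  | smul r x _ h => rw [hφ]; exact Submodule.smul_mem _ _ h

lemma memAdd_transfer (e : S ≃+* S') {𝒮 : Set (ModuleCat.{v} S)} {𝒮' : Set (ModuleCat.{u} S')}
    (h𝒮 : ∀ M ∈ 𝒮, ∃ M' ∈ 𝒮', Corr e M M') {X : ModuleCat.{v} S} {X' : ModuleCat.{u} S'}
    (hX : Corr e X X') (h : memAdd S 𝒮 X) : memAdd S' 𝒮' X' := by
  obtain ⟨r, M, s, q, hM, hs⟩ := memAdd_sum h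
  choose M' hM' φ hφ using fun i => h𝒮 (M i) (hM i)
  obtain ⟨ψ, hψ⟩ := hX
  refine memAdd_of_sum M' hM' (fun i => transMap e ψ hψ (φ i) (hφ i) (s i))
    (fun i => transMap e (φ i) (hφ i) ψ hψ (q i)) fun x => ?_
  apply ψ.symm.injective
  conv_rhs => rw [← hs (ψ.symm x)]
  simp only [transMap, LinearMap.coe_mk, AddHom.coe_mk, AddEquiv.symm_apply_apply, ← map_sum]

lemma memAdd_finite {𝒮 : Set (ModuleCat.{v} S)} (h𝒮 : ∀ M ∈ 𝒮, Module.Finite S M)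
    {X : ModuleCat.{v} S} (h : memAdd S 𝒮 X) : Module.Finite S X := by
  obtain ⟨n, M, Y, hM, ⟨f⟩⟩ := h
  have := fun i => h𝒮 _ (hM i)
  exact Module.Finite.of_surjective (LinearMap.fst S X Y ∘ₗ f.symm.toLinearMap)
    (Prod.fst_surjective.comp f.symm.surjective)

lemma bracket_transfer (e : S ≃+* S') {T : ModuleCat.{v} S} {T' : ModuleCat.{u} S'}
    [Module.Finite S T] (hT : Corr e T T') (n : ℕ) {X : ModuleCat.{v} S} {X' : ModuleCat.{u} S'}
    (hX : Corr e X X') (h : X ∈ bracket S T n) : X' ∈ bracket S' T' n := by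
  have h1 : ∀ {X : ModuleCat.{v} S} {X' : ModuleCat.{u} S'}, Corr e X X' → X ∈ addOf S T →
      X' ∈ addOf S' T' := fun hX h => memAdd_transfer e (by
        rintro M rfl
        exact ⟨T', rfl, hT⟩) hX h
  induction n generalizing X X' with
  | zero =>
    obtain ⟨φ, -⟩ := hX
    have : Subsingleton X := h
    exact φ.symm.toEquiv.subsingleton
  | succ n ih =>
    cases n with
    | zero => exact h1 hX h
    | succ n =>
      refine memAdd_transfer e ?_ hX h
      rintro W ⟨hW, T₁, T₂, f, g, hT₁, hT₂, hf, hg, hfg⟩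
      have : Module.Finite S T₁ := memAdd_finite (by rintro M rfl; infer_instance) hT₁
      have : Module.Finite S T₂ := Module.Finite.of_surjective g hg
      obtain ⟨W', hWW'⟩ := exists_corr e W
      obtain ⟨T₁', hTT₁⟩ := exists_corr e T₁
      obtain ⟨T₂', hTT₂⟩ := exists_corr e T₂
      refine ⟨W', ⟨hWW'.finite, T₁', T₂', ?_⟩, hWW'⟩
      have a1 := h1 hTT₁ hT₁
      have a2 := ih hTT₂ hT₂
      obtain ⟨φ, hφ⟩ := hWW'
      obtain ⟨φ₁, hφ₁⟩ := hTT₁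
      obtain ⟨φ₂, hφ₂⟩ := hTT₂
      refine ⟨transMap e φ₁ hφ₁ φ hφ f, transMap e φ hφ φ₂ hφ₂ g, a1, a2, ?_, ?_, ?_⟩
      · exact φ.injective.comp (hf.comp φ₁.symm.injective)
      · exact φ₂.surjective.comp (hg.comp φ.symm.surjective)
      · ext x
        obtain ⟨x, rfl⟩ := φ.surjective x
        have := SetLike.ext_iff.1 hfg x
        simp only [LinearMap.mem_range, LinearMap.mem_ker] at this
        simp only [LinearMap.mem_range, LinearMap.mem_ker, transMap, LinearMap.coe_mk,
          AddHom.coe_mk, EmbeddingLike.apply_eq_iff_eq, AddEquiv.symm_apply_apply,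
          EmbeddingLike.map_eq_zero_iff, ← this]
        exact (φ₁.symm.surjective.exists (p := fun y => f y = x)).symm

/-- A comparison criterion for extension dimensions. -/
lemma extDim_le_of (h : ∀ m (T : ModuleCat.{v} S), Module.Finite S T →
    (∀ X : ModuleCat.{v} S, Module.Finite S X → X ∈ bracket S T (m + 1)) →
    ∃ T' : ModuleCat.{u} S', Module.Finite S' T' ∧
      ∀ X : ModuleCat.{u} S', Module.Finite S' X → X ∈ bracket S' T' (m + 1)) :
    extDim S' ≤ extDim S := by
  refine le_sInf ?_
  rintro _ ⟨m, rfl, T, hT, hX⟩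
  obtain ⟨T', h1, h2⟩ := h m T hT hX
  exact sInf_le ⟨m, rfl, T', h1, h2⟩

lemma extDim_le_of_ringEquiv (e : S ≃+* S') : extDim S' ≤ extDim S :=
  extDim_le_of fun m T hT hX => by
    obtain ⟨T', hT'⟩ := exists_corr e T
    refine ⟨T', hT'.finite, fun X' hX' => ?_⟩
    obtain ⟨X, hXX⟩ := exists_corr e.symm X'
    have := hXX.finite
    exact bracket_transfer e hT' _ hXX.symm (hX X this)

end Transfer

end DerEq

namespace DerEq

open Paper CategoryTheory Limits Pretriangulated Triangulated

universe v w

section Transport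

variable {C : Type w} [Category.{v} C] [Preadditive C] [HasShift C ℤ]
  [HasZeroObject C] [∀ n : ℤ, (shiftFunctor C n).Additive] [Pretriangulated C] [IsTriangulated C]
  {Λ : Type u} [Ring Λ]

/-- If the map to an approximation factors through the image of a member of `[T]_{n+1}`, its
lowest cohomology belongs to `[K ⊕ S]_{n+1}`, with `K` the cohomology of an approximation of `T`. -/
lemma bracket_of_approx (P : C) [IsNoetherianRing (End P)ᵐᵒᵖ] (hP : ∀ j : ℤ, j ≠ 0 → Van P P j)
    (G : ModuleCat.{u} Λ ⥤ C) [G.Additive]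
    (hG : ∀ {X Y Z : ModuleCat.{u} Λ} (f : X →ₗ[Λ] Y) (g : Y →ₗ[Λ] Z), IsSES Λ f g →
      ∃ h, Triangle.mk (G.map (ModuleCat.ofHom f)) (G.map (ModuleCat.ofHom g)) h ∈ distTriang C)
    (hpos : ∀ (X : ModuleCat.{u} Λ) j, 0 < j → Van P (G.obj X) j)
    (m : ℕ) (hneg : ∀ (X : ModuleCat.{u} Λ) j, j < -(m : ℤ) → Van P (G.obj X) j)
    (hfin : ∀ X : ModuleCat.{u} Λ, Module.Finite Λ X → ∀ j, IsNoetherian (End P)ᵐᵒᵖ (coh P (G.obj X) j))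
    [IsNoetherianRing Λ]
    (T : ModuleCat.{u} Λ) {LT ET : C} {iT : LT ⟶ G.obj T} {pT : G.obj T ⟶ ET}
    {dT : ET ⟶ LT⟦(1 : ℤ)⟧} (hT : Triangle.mk iT pT dT ∈ distTriang C)
    (hLT : ExtCl P {n | n < (m : ℤ)} LT) (hET : ∀ j, -(m : ℤ) < j → Van P ET j)
    (hTf : Module.Finite Λ T)
    (n : ℕ) (X : ModuleCat.{u} Λ) (hX : X ∈ bracket Λ T (n + 1)) (hXf : Module.Finite Λ X)
    {L Z E : C} {i : L ⟶ Z} {p : Z ⟶ E} {d : E ⟶ L⟦(1 : ℤ)⟧}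
    (hE : Triangle.mk i p d ∈ distTriang C)
    (hL : ExtCl P {n | n < (m : ℤ)} L) (hEv : ∀ j, -(m : ℤ) < j → Van P E j)
    (f : Z ⟶ G.obj X) (g : G.obj X ⟶ E) (hp : p = f ≫ g) :
    ModuleCat.of (End P)ᵐᵒᵖ (coh P E (-(m : ℤ))) ∈
      bracket (End P)ᵐᵒᵖ (ModuleCat.of _ ((coh P ET (-(m : ℤ))) × (End P)ᵐᵒᵖ)) (n + 1) := by
  have key : ∀ {r : ℕ} {X : ModuleCat.{u} Λ} (M : Fin r → ModuleCat.{u} Λ)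
      (s : ∀ i, X →ₗ[Λ] M i) (q : ∀ i, M i →ₗ[Λ] X), (∀ x, ∑ i, q i (s i x) = x) →
      𝟙 (G.obj X) = ∑ i, G.map (ModuleCat.ofHom (s i)) ≫ G.map (ModuleCat.ofHom (q i)) := by
    intro r X M s q h
    have : 𝟙 X = ∑ i, ModuleCat.ofHom (s i) ≫ ModuleCat.ofHom (q i) := by
      ext x
      simp [ModuleCat.hom_sum, h]
    rw [← CategoryTheory.Functor.map_id, this, G.map_sum]
    simp
  induction n generalizing X L Z E with
  | zero =>
    obtain ⟨r, M, s, q, hM, hsq⟩ := memAdd_sum hX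
    obtain rfl : M = fun _ => T := funext hM
    obtain ⟨a, s', q', h'⟩ := exists_retract P hP m hE hL hEv r (fun _ => hT) (fun _ => hLT)
      (fun _ => hET) (fun t => f ≫ G.map (ModuleCat.ofHom (s t)))
      (fun t => G.map (ModuleCat.ofHom (q t)) ≫ g) (by
        have := congr_arg (fun z => f ≫ z ≫ g) (key _ s q hsq)
        simp only [Category.id_comp, Preadditive.sum_comp, Preadditive.comp_sum] at this
        rw [hp, this]
        simp)
    exact bracket_one_of_retract (ModuleCat.of _ (coh P ET (-(m : ℤ)))) s' q' h'
  | succ n ih =>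
    obtain ⟨r, M, s, q, hM, hsq⟩ := memAdd_sum hX
    have h1 : ∀ t, ∃ (L E : C) (i : L ⟶ G.obj (M t)) (p : G.obj (M t) ⟶ E) (d : E ⟶ L⟦(1 : ℤ)⟧),
        Triangle.mk i p d ∈ distTriang C ∧ ExtCl P {n | n < (m : ℤ)} L ∧
        (∀ j, -(m : ℤ) < j → Van P E j) ∧ ModuleCat.of (End P)ᵐᵒᵖ (coh P E (-(m : ℤ))) ∈
        {W : ModuleCat.{v} (End P)ᵐᵒᵖ | Module.Finite (End P)ᵐᵒᵖ W ∧
        ∃ (T₁ T₂ : ModuleCat.{v} (End P)ᵐᵒᵖ) (f : T₁ →ₗ[(End P)ᵐᵒᵖ] W) (g : W →ₗ[(End P)ᵐᵒᵖ] T₂),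
        T₁ ∈ addOf (End P)ᵐᵒᵖ (ModuleCat.of (End P)ᵐᵒᵖ ((coh P ET (-(m : ℤ))) × (End P)ᵐᵒᵖ)) ∧
        T₂ ∈ bracket (End P)ᵐᵒᵖ
          (ModuleCat.of (End P)ᵐᵒᵖ ((coh P ET (-(m : ℤ))) × (End P)ᵐᵒᵖ)) (n + 1) ∧
        IsSES (End P)ᵐᵒᵖ f g} := by
      intro t
      obtain ⟨hf, T₁, T₂, a, b, hT₁, hT₂, hab⟩ := hM t
      have hf₁ : Module.Finite Λ T₁ := Module.Finite.of_injective a hab.1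
      have hf₂ : Module.Finite Λ T₂ := Module.Finite.of_surjective b hab.2.1
      obtain ⟨δ, hδ⟩ := hG a b hab
      obtain ⟨L₁, E₁, i₁, p₁, d₁, ht₁, hL₁, hE₁, hE₁', hn₁⟩ := exists_approx P hP (-(m : ℤ)) m
        (G.obj T₁) (by simpa using hpos T₁) (hfin T₁ hf₁)
      obtain ⟨L₂, E₂, i₂, p₂, d₂, ht₂, hL₂, hE₂, hE₂', hn₂⟩ := exists_approx P hP (-(m : ℤ)) m
        (G.obj T₂) (by simpa using hpos T₂) (hfin T₂ hf₂)
      replace hL₁ := hL₁.mono (J := {n | n < (m : ℤ)}) (by intro x; simp)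
      replace hL₂ := hL₂.mono (J := {n | n < (m : ℤ)}) (by intro x; simp)
      obtain ⟨L, E, i, p, d, b', c, e, hE, hE', hL⟩ := exists_horseshoe P m hδ ht₁ ht₂ hL₁ hL₂ hE₁
      refine ⟨L, E, i, p, d, hE, hL, fun j hj => van₂ P _ hE' j (hE₁ j hj) (hE₂ j hj), ?_, ?_⟩
      · have := noeth₂ hE' (-(m : ℤ)) (hn₁ _) (hn₂ _)
        change Module.Finite (End P)ᵐᵒᵖ (coh P E (-(m : ℤ)))
        have : IsNoetherian (End P)ᵐᵒᵖ (coh P E (-(m : ℤ))) := this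
        infer_instance
      · refine ⟨ModuleCat.of _ (coh P E₁ (-(m : ℤ))), ModuleCat.of _ (coh P E₂ (-(m : ℤ))),
          cohMap P b' _, cohMap P c _, ?_, ?_, ?_, ?_, ?_⟩
        · obtain ⟨r, M, s, q, hM, hsq⟩ := memAdd_sum hT₁
          obtain rfl : M = fun _ => T := funext hM
          obtain ⟨a, s', q', h'⟩ := exists_retract P hP m ht₁ hL₁ hE₁ r (fun _ => hT)
            (fun _ => hLT) (fun _ => hET) (fun t => G.map (ModuleCat.ofHom (s t)))
            (fun t => G.map (ModuleCat.ofHom (q t)) ≫ p₁) (by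
              have := congr_arg (fun z => z ≫ p₁) (key _ s q hsq)
              simp only [Category.id_comp, Preadditive.sum_comp] at this
              refine this.trans ?_
              simp)
          exact bracket_one_of_retract (ModuleCat.of _ (coh P ET (-(m : ℤ)))) s' q' h'
        · exact ih T₂ hT₂ hf₂ ht₂ hL₂ hE₂ (𝟙 _) p₂ (by simp)
        · have := (coh_exact₁ P _ hE' (-(m : ℤ) - 1) (-(m : ℤ)) (by omega))
          have hs : Subsingleton (coh P E₂ (-(m : ℤ) - 1)) :=
            hE₂' _ (by omega) (hneg T₂ _ (by omega))
          refine (injective_iff_map_eq_zero _).2 fun x hx => ?_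
          obtain ⟨y, hy⟩ := (this x).1 hx
          rw [← hy]
          obtain rfl : y = 0 := hs.elim _ _
          exact map_zero _
        · have := (coh_exact₃ P _ hE' (-(m : ℤ)) (-(m : ℤ) + 1) (by omega))
          have hs : Subsingleton (coh P E₁ (-(m : ℤ) + 1)) := hE₁ _ (by omega)
          intro x
          exact (this x).1 (hs.elim _ _)
        · exact (coh_exact₂ P _ hE' (-(m : ℤ))).linearMap_ker_eq.symm
    choose L' E' i' p' d' ht' hL' hE' hW' using h1
    obtain ⟨a, s', q', h'⟩ := exists_retract P hP m hE hL hEv r ht' hL' hE'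
      (fun t => f ≫ G.map (ModuleCat.ofHom (s t)))
      (fun t => G.map (ModuleCat.ofHom (q t)) ≫ g) (by
        have := congr_arg (fun z => f ≫ z ≫ g) (key _ s q hsq)
        simp only [Category.id_comp, Preadditive.sum_comp, Preadditive.comp_sum] at this
        rw [hp, this]
        simp)
    exact bracket_succ_of_retract (ModuleCat.of _ (coh P ET (-(m : ℤ)))) n
      (fun t => ModuleCat.of _ (coh P (E' t) (-(m : ℤ)))) hW' s' q' h'

end Transport

end DerEq

namespace DerEq

open Paper CategoryTheory Limits Pretriangulated Triangulated

universe v w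

section Dense

variable {C : Type w} [Category.{v} C] [Preadditive C] [HasShift C ℤ]
  [HasZeroObject C] [∀ n : ℤ, (shiftFunctor C n).Additive] [Pretriangulated C]

/-- A module over the endomorphism ring with enough cosyzygies is realized as lowest cohomology
of an object generated by `P`. -/
lemma exists_cosyzygy (P : C) [IsNoetherianRing (End P)ᵐᵒᵖ] (hP : ∀ j : ℤ, j ≠ 0 → Van P P j)
    (hemb : ∀ Y : ModuleCat.{v} (End P)ᵐᵒᵖ, Module.Finite (End P)ᵐᵒᵖ Y →
      ∃ (r : ℕ) (f : Y →ₗ[(End P)ᵐᵒᵖ] (Fin r → (End P)ᵐᵒᵖ)), Function.Injective f)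
    (m : ℕ) (Y : ModuleCat.{v} (End P)ᵐᵒᵖ) (hY : Module.Finite (End P)ᵐᵒᵖ Y) :
    ∃ W : C, ExtCl P {k | 0 ≤ k ∧ k ≤ (m : ℤ)} W ∧ (∀ j, j ≠ 0 → j ≠ -(m : ℤ) → Van P W j) ∧
      ∃ ι : Y →ₗ[(End P)ᵐᵒᵖ] coh P W (-(m : ℤ)), Function.Injective ι ∧
        (1 ≤ m → Function.Surjective ι) := by
  induction m generalizing Y with
  | zero =>
    obtain ⟨r, f, hf⟩ := hemb Y hY
    obtain ⟨V, X', i, p, d, e, hT, hV, hV', he⟩ := exists_kill P hP P 0 r 0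
    refine ⟨V, hV.mono ?_, fun j hj _ => hV' j hj, e.toLinearMap ∘ₗ f,
      e.injective.comp hf, fun h => absurd h (by omega)⟩
    intro k hk
    simp only [Set.mem_singleton_iff] at hk
    simp [hk]
  | succ m ih =>
    obtain ⟨r, f, hf⟩ := hemb Y hY
    obtain ⟨W, hW, hW', ι, hι, hι'⟩ := ih (ModuleCat.of _ ((Fin r → (End P)ᵐᵒᵖ) ⧸ LinearMap.range f))
      (inferInstanceAs (Module.Finite _ ((Fin r → (End P)ᵐᵒᵖ) ⧸ LinearMap.range f)))
    obtain ⟨V, X', i, p, d, e, hT, hV, hV', he⟩ := exists_kill P hP W (-(m : ℤ)) r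
      (ι ∘ₗ (LinearMap.range f).mkQ)
    obtain ⟨δ, hδ⟩ : ∃ δ : coh P X' (-((m + 1 : ℕ) : ℤ)) →ₗ[(End P)ᵐᵒᵖ] coh P V (-(m : ℤ)),
        δ = cohδ P (Triangle.mk i p d) (-((m + 1 : ℕ) : ℤ)) (-(m : ℤ)) (by push_cast; omega) :=
      ⟨_, rfl⟩
    have hinj : Function.Injective δ := by
      have := coh_exact₃ P _ hT (-((m + 1 : ℕ) : ℤ)) (-(m : ℤ)) (by push_cast; omega)
      have hs : Subsingleton (coh P W (-((m + 1 : ℕ) : ℤ))) := hW' _ (by omega) (by omega)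
      refine (injective_iff_map_eq_zero _).2 fun x hx => ?_
      obtain ⟨y, hy⟩ := (this x).1 (hδ ▸ hx)
      rw [← hy]
      obtain rfl : y = 0 := hs.elim _ _
      exact map_zero _
    have hrange : LinearMap.range (e.toLinearMap ∘ₗ f) = LinearMap.range δ := by
      ext y
      have h1 := coh_exact₁ P _ hT (-((m + 1 : ℕ) : ℤ)) (-(m : ℤ)) (by push_cast; omega) y
      obtain ⟨s, rfl⟩ := e.surjective y
      change cohMap P i _ (e s) = 0 ↔ _ at h1
      rw [he, LinearMap.comp_apply, hι.eq_iff' (map_zero _), Submodule.mkQ_apply,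
        Submodule.Quotient.mk_eq_zero] at h1
      subst hδ
      refine Iff.trans ?_ h1
      simp
    let ε : Y ≃ₗ[(End P)ᵐᵒᵖ] coh P X' (-((m + 1 : ℕ) : ℤ)) :=
      (LinearEquiv.ofInjective (e.toLinearMap ∘ₗ f) (e.injective.comp hf)).trans
        ((LinearEquiv.ofEq _ _ hrange).trans (LinearEquiv.ofInjective δ hinj).symm)
    refine ⟨X', ExtCl.ext _ (rot_of_distTriang _ hT) (hW.mono ?_) (hV.shift 1 _ ?_),
      fun j h0 hj => ?_, ε.toLinearMap, ε.injective, fun _ => ε.surjective⟩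
    · intro k hk
      simp only [Set.mem_ofPred_eq] at hk ⊢
      push_cast
      omega
    · intro k hk
      simp only [Set.mem_ofPred_eq, Set.mem_singleton_iff] at hk ⊢
      push_cast
      omega
    · by_cases h : j = -(m : ℤ)
      · subst h
        rw [van_iff]
        intro y
        obtain ⟨x, rfl⟩ := ((coh_exact₃ P _ hT (-(m : ℤ)) _ rfl) y).1
          (@Subsingleton.elim _ (hV' _ (by omega)) _ _)
        obtain ⟨x, rfl⟩ := hι' (by omega) x
        obtain ⟨x, rfl⟩ := Submodule.mkQ_surjective _ x
        have h2 := he x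
        rw [LinearMap.comp_apply] at h2
        rw [← h2]
        exact ((coh_exact₂ P _ hT _) _).2 ⟨_, rfl⟩
      · exact van₃ P _ hT j (j + 1) rfl (hV' _ (by push_cast at hj; omega)) (hW' _ h0 h)

end Dense

end DerEq

namespace DerEq

open Paper CategoryTheory Limits Pretriangulated Triangulated

universe v w

lemma bracket_of_linearEquiv {S : Type v} [Ring S] {T : ModuleCat.{v} S} {X Y : ModuleCat.{v} S}
    (e : X ≃ₗ[S] Y) (n : ℕ) (h : X ∈ bracket S T (n + 1)) : Y ∈ bracket S T (n + 1) := by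
  have key : ∀ 𝒮, memAdd S 𝒮 X → memAdd S 𝒮 Y := by
    rintro 𝒮 ⟨r, M, Z, hM, ⟨f⟩⟩
    exact ⟨r, M, Z, hM, ⟨(LinearEquiv.prodCongr e.symm (LinearEquiv.refl S Z)).trans f⟩⟩
  cases n with
  | zero => exact key _ h
  | succ n => exact key _ h

section Main

variable {C : Type w} [Category.{v} C] [Preadditive C] [HasShift C ℤ]
  [HasZeroObject C] [∀ n : ℤ, (shiftFunctor C n).Additive] [Pretriangulated C]

lemma ExtCl.noeth_of {P Q : C} {I : Set ℤ} {X : C} (h : ExtCl P I X)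
    (hP : ∀ j, IsNoetherian (End Q)ᵐᵒᵖ (coh Q P j)) (j : ℤ) :
    IsNoetherian (End Q)ᵐᵒᵖ (coh Q X j) := by
  induction h generalizing j with
  | zero X hX =>
    have : Subsingleton (coh Q X j) :=
      ⟨fun a b => (((shiftFunctor C j).map_isZero hX).eq_of_tgt a b)⟩
    infer_instance
  | of n hn =>
    have := hP (n + j)
    exact isNoetherian_of_linearEquiv (cohShift Q P n j _ rfl).symm
  | ext T hT _ _ ih1 ih2 => exact noeth₂ hT j (ih1 j) (ih2 j)

variable [IsTriangulated C] {Λ : Type u} [Ring Λ]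

lemma coh_bijective_of_van (P : C) {T : Triangle C} (hT : T ∈ distTriang C) (n : ℤ)
    (h : Van P T.obj₁ n) (h' : Van P T.obj₁ (n + 1)) :
    Function.Bijective (cohMap P T.mor₂ n) := by
  constructor
  · refine (injective_iff_map_eq_zero _).2 fun x hx => ?_
    obtain ⟨y, rfl⟩ := (coh_exact₂ P T hT n x).1 hx
    rw [Subsingleton.elim y 0, map_zero]
  · intro x
    exact (coh_exact₃ P T hT n _ rfl x).1 (Subsingleton.elim _ _)

/-- The extension dimension of the endomorphism ring of a suitable "tilting" object. -/
theorem extDim_end_le (P A₀ : C) (w : ℕ) [IsNoetherianRing (End P)ᵐᵒᵖ]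
    [IsNoetherianRing (End A₀)ᵐᵒᵖ] [IsNoetherianRing Λ]
    (hP : ∀ j : ℤ, j ≠ 0 → Van P P j) (hA : ∀ j : ℤ, j ≠ 0 → Van A₀ A₀ j)
    (hemb : ∀ Y : ModuleCat.{v} (End P)ᵐᵒᵖ, Module.Finite (End P)ᵐᵒᵖ Y →
      ∃ (r : ℕ) (f : Y →ₗ[(End P)ᵐᵒᵖ] (Fin r → (End P)ᵐᵒᵖ)), Function.Injective f)
    (hAP : ∀ (X : C) (i : ℤ), (∀ j, i - w ≤ j → j ≤ i + w → Van A₀ X j) → Van P X i)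
    (hPA : ∀ (X : C) (i : ℤ), (∀ j, i - w ≤ j → j ≤ i + w → Van P X j) → Van A₀ X i)
    (hnP : ∀ j, IsNoetherian (End A₀)ᵐᵒᵖ (coh A₀ P j))
    (htr : ∀ (X : C) (n : ℤ), ∃ (F Z : C) (i : F ⟶ X) (p : X ⟶ Z) (d : Z ⟶ F⟦(1 : ℤ)⟧),
      Triangle.mk i p d ∈ distTriang C ∧ (∀ j, n < j → Van A₀ F j) ∧ (∀ j, j ≤ n → Van A₀ Z j))
    (G : ModuleCat.{u} Λ ⥤ C) [G.Additive]
    (hG : ∀ {X Y Z : ModuleCat.{u} Λ} (f : X →ₗ[Λ] Y) (g : Y →ₗ[Λ] Z), IsSES Λ f g →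
      ∃ h, Triangle.mk (G.map (ModuleCat.ofHom f)) (G.map (ModuleCat.ofHom g)) h ∈ distTriang C)
    (hGv : ∀ (X : ModuleCat.{u} Λ) (j : ℤ), j ≠ -w → Van A₀ (G.obj X) j)
    (hfin : ∀ X : ModuleCat.{u} Λ, Module.Finite Λ X →
      ∀ j, IsNoetherian (End P)ᵐᵒᵖ (coh P (G.obj X) j))
    (hheart : ∀ E : C, (∀ j : ℤ, j ≠ -w → Van A₀ E j) →
      (∀ j, IsNoetherian (End A₀)ᵐᵒᵖ (coh A₀ E j)) →
      ∃ X : ModuleCat.{u} Λ, Module.Finite Λ X ∧ Nonempty (E ≅ G.obj X)) :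
    extDim (End P)ᵐᵒᵖ ≤ extDim Λ := by
  refine extDim_le_of fun n T hT hTX => ?_
  obtain ⟨M, hM⟩ : ∃ M : ℕ, M = 4 * w + 10 := ⟨_, rfl⟩
  obtain ⟨m, hm⟩ : ∃ m : ℕ, m = M + 1 := ⟨_, rfl⟩
  obtain ⟨N, hN⟩ : ∃ N : ℕ, N = M + (8 * w + 20) := ⟨_, rfl⟩
  have hpos : ∀ (X : ModuleCat.{u} Λ) (j : ℤ), 0 < j → Van P (G.obj X) j := fun X j hj =>
    hAP _ _ fun i hi hi' => hGv X i (by omega)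
  have hneg : ∀ (X : ModuleCat.{u} Λ) (j : ℤ), j < -(m : ℤ) → Van P (G.obj X) j := fun X j hj =>
    hAP _ _ fun i hi hi' => hGv X i (by omega)
  obtain ⟨LT, ET, iT, pT, dT, hTt, hLT, hET, -, hTn⟩ := exists_approx P hP (-(m : ℤ)) m
    (G.obj T) (by simpa using hpos T) (hfin T hT)
  refine ⟨ModuleCat.of _ ((coh P ET (-(m : ℤ))) × (End P)ᵐᵒᵖ), ?_, fun Y hY => ?_⟩
  · have := hTn (-(m : ℤ))
    exact inferInstanceAs (Module.Finite _ ((coh P ET (-(m : ℤ))) × (End P)ᵐᵒᵖ))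
  obtain ⟨W, hW, hWv, ι, hι, hι'⟩ := exists_cosyzygy P hP hemb M Y hY
  obtain ⟨L, WN, i, p, d, ht, hL, hWN, hWN', -⟩ := exists_approx_gen P hP (-(N : ℤ)) (N - M) W
    (hW.noeth hP)
  have hLv : ∀ j : ℤ, -(M : ℤ) < j → Van P L j := fun j hj => hL.van fun n hn => hP _ (by
    simp only [Set.mem_ofPred_eq] at hn; omega)
  have hWNv : ∀ j : ℤ, j ≠ 0 → j ≠ -N → Van P WN j := by
    intro j h0 hj
    rcases lt_or_gt_of_ne hj with hj | hj
    · exact hWN' j hj (hWv j h0 (by omega))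
    · exact hWN j hj fun h => hWv j h0 (by omega)
  have hWNa : ∀ j : ℤ, (w < j ∨ j < -w) → (w < j + N ∨ j + N < -w) → Van A₀ WN j := fun j h h' =>
    hPA _ _ fun i hi hi' => hWNv i (by omega) (by omega)
  obtain ⟨F, Z, f, q, d', ht', hF, hZ⟩ := htr WN (-(w : ℤ) - 1)
  have hFa : ∀ j : ℤ, (w < j + N ∨ j + N < -w) → Van A₀ F j := by
    intro j hj
    by_cases h : -(w : ℤ) - 1 < j
    · exact hF j h
    · exact van₁ A₀ _ ht' (j - 1) j (by omega) (hWNa j (by omega) hj) (hZ _ (by omega))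
  have hZa : ∀ j : ℤ, (w < j ∨ j < -w) → Van A₀ Z j := by
    intro j hj
    by_cases h : j ≤ -(w : ℤ) - 1
    · exact hZ j h
    · exact van₃ A₀ _ ht' j (j + 1) rfl (hF _ (by omega)) (hWNa j hj (by omega))
  have hFp : ∀ j : ℤ, (2 * w < j + N ∨ j + N < -2 * w) → Van P F j := fun j h =>
    hAP _ _ fun i hi hi' => hFa i (by omega)
  have hZp : ∀ j : ℤ, j ≠ 0 → Van P Z j := by
    intro j hj
    by_cases h : 2 * (w : ℤ) < j ∨ j < -2 * w
    · exact hAP _ _ fun i hi hi' => hZa i (by omega)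
    · exact van₃ P _ ht' j (j + 1) rfl (hFp _ (by omega)) (hWNv j hj (by omega))
  obtain ⟨E, r, d'', hE⟩ := distinguished_cocone_triangle (p ≫ q)
  have hbij : Function.Bijective (cohMap P (p ≫ q) 0) := by
    have h1 := coh_bijective_of_van P ht 0 (hLv _ (by omega)) (hLv _ (by omega))
    have h2 := coh_bijective_of_van P ht' 0 (hFp _ (by omega)) (hFp _ (by omega))
    have h3 : ⇑(cohMap P (p ≫ q) 0) = cohMap P q 0 ∘ cohMap P p 0 := by
      funext x
      exact cohMap_comp P p q 0 x
    rw [h3]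
    exact h2.comp h1
  have hEv : ∀ j : ℤ, j ≠ -m → Van P E j := by
    intro j hj
    rw [van_iff]
    intro y
    rcases eq_or_ne j 0 with rfl | h0
    · obtain ⟨z, rfl⟩ := (coh_exact₃ P _ hE 0 1 rfl y).1
        (@Subsingleton.elim _ (hWv 1 (by omega) (by omega)) _ _)
      obtain ⟨x, rfl⟩ := hbij.2 z
      exact (coh_exact₂ P _ hE 0 _).2 ⟨_, rfl⟩
    · have hz : Subsingleton (coh P Z j) := hZp j h0
      suffices h : cohδ P (Triangle.mk (p ≫ q) r d'') j (j + 1) rfl y = 0 by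
        obtain ⟨z, rfl⟩ := (coh_exact₃ P _ hE j _ rfl y).1 h
        exact (congr_arg _ (hz.elim z 0)).trans (map_zero _)
      by_cases h1 : j + 1 = 0
      · obtain rfl : j = -1 := by omega
        refine hbij.1 (((coh_exact₁ P _ hE (-1) 0 rfl _).2 ⟨y, rfl⟩).trans (map_zero _).symm)
      · exact @Subsingleton.elim _ (hWv (j + 1) h1 (by omega)) _ _
  have eY : Nonempty (coh P E (-(m : ℤ)) ≃ₗ[(End P)ᵐᵒᵖ] Y) := by
    obtain ⟨δ, hδ⟩ : ∃ δ : coh P E (-(m : ℤ)) →ₗ[(End P)ᵐᵒᵖ] coh P W (-(M : ℤ)),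
        δ = cohδ P (Triangle.mk (p ≫ q) r d'') (-(m : ℤ)) (-(M : ℤ)) (by omega) := ⟨_, rfl⟩
    have hδb : Function.Bijective δ := by
      subst hδ
      constructor
      · refine (injective_iff_map_eq_zero _).2 fun x hx => ?_
        obtain ⟨y, rfl⟩ := (coh_exact₃ P _ hE (-(m : ℤ)) (-(M : ℤ)) (by omega) x).1 hx
        have hs : Subsingleton (coh P Z (-(m : ℤ))) := hZp _ (by omega)
        exact (congr_arg _ (hs.elim y 0)).trans (map_zero _)
      · intro x
        exact (coh_exact₁ P _ hE (-(m : ℤ)) (-(M : ℤ)) (by omega) x).1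
          (@Subsingleton.elim _ (hZp _ (by omega)) _ _)
    exact ⟨(LinearEquiv.ofBijective δ hδb).trans
      (LinearEquiv.ofBijective ι ⟨hι, hι' (by omega)⟩).symm⟩
  have hEa : ∀ j : ℤ, -w < j → Van A₀ E j := fun j hj =>
    hPA _ _ fun i hi hi' => hEv i (by omega)
  have hZn : ∀ j, IsNoetherian (End A₀)ᵐᵒᵖ (coh A₀ Z j) := by
    intro j
    by_cases h : j ≤ -(w : ℤ) - 1
    · have : Subsingleton (coh A₀ Z j) := hZ j h
      infer_instance
    · have : Subsingleton (coh A₀ F (j + 1)) := hF _ (by omega)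
      have hFn : IsNoetherian (End A₀)ᵐᵒᵖ (coh A₀ F (j + 1)) := inferInstance
      refine noeth₃ ht' j _ rfl hFn
        (noeth₃ ht j _ rfl (hL.noeth_of hnP _) (hW.noeth_of hnP _))
  obtain ⟨V, E', i', p', e', ht'', hV, hE', hE'', hE'n⟩ := exists_approx A₀ hA (-(w : ℤ)) (2 * w) Z
    (fun j hj => hZa j (by push_cast at hj; omega)) hZn
  obtain ⟨X, hX, ⟨ε⟩⟩ := hheart E' (fun j hj => by
    rcases lt_or_gt_of_ne hj with h | h
    · exact hE'' j h (hZa j (by omega))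
    · exact hE' j h) hE'n
  obtain ⟨g, hg⟩ : ∃ g : E' ⟶ E, r = p' ≫ g :=
    Triangle.yoneda_exact₂ _ ht'' r
      (hV.hom_eq_zero (fun n hn => hEa _ (by simp only [Set.mem_ofPred_eq] at hn; omega)) _)
  obtain ⟨eY⟩ := eY
  exact bracket_of_linearEquiv eY n (bracket_of_approx P hP G hG hpos m hneg hfin T hTt
    (hLT.mono (by intro x; simp)) hET hT n X (hTX X hX) hX hE
    (hW.mono (by intro k hk; simp only [Set.mem_ofPred_eq] at hk ⊢; omega))
    (fun j hj => hEv j (by omega)) (p' ≫ ε.hom) (ε.inv ≫ g) (by simp [hg]))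

end Main

end DerEq

namespace DerEq

open CategoryTheory Limits Pretriangulated Triangulated DerivedCategory

universe v w w'

section Der

variable {𝒜 : Type u} [Category.{v} 𝒜] [Abelian 𝒜] [HasDerivedCategory.{w} 𝒜]

lemma Q_map_surjective {K L : CochainComplex 𝒜 ℤ} [K.IsKProjective]
    (f : Q.obj K ⟶ Q.obj L) : ∃ g : K ⟶ L, Q.map g = f := by
  obtain ⟨g, hg⟩ := (CochainComplex.IsKProjective.Qh_map_bijective K
    ((HomotopyCategory.quotient _ _).obj L)).2
      ((quotientCompQhIso 𝒜).hom.app K ≫ f ≫ (quotientCompQhIso 𝒜).inv.app L)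
  obtain ⟨g, rfl⟩ := (HomotopyCategory.quotient _ _).map_surjective g
  refine ⟨g, ?_⟩
  have h := (quotientCompQhIso 𝒜).hom.naturality g
  dsimp at h
  rw [hg] at h
  simp only [Category.assoc] at h
  rw [← cancel_epi ((quotientCompQhIso 𝒜).hom.app K), ← h]
  have : (quotientCompQhIso 𝒜).inv.app L ≫ (quotientCompQhIso 𝒜).hom.app L = 𝟙 _ :=
    Iso.inv_hom_id_app _ _
  rw [this]
  rw [Category.comp_id]

lemma Q_map_eq_zero_iff {K L : CochainComplex 𝒜 ℤ} [K.IsKProjective] (f : K ⟶ L) :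
    Q.map f = 0 ↔ Nonempty (Homotopy f 0) := by
  constructor
  · intro h
    rw [← HomotopyCategory.quotient_map_eq_zero_iff]
    apply (CochainComplex.IsKProjective.Qh_map_bijective K
      ((HomotopyCategory.quotient _ _).obj L)).1
    have h' := (quotientCompQhIso 𝒜).hom.naturality f
    dsimp at h'
    rw [h, comp_zero] at h'
    rw [Functor.map_zero, ← cancel_mono ((quotientCompQhIso 𝒜).hom.app L), zero_comp]
    exact h'
  · rintro ⟨h⟩
    rw [Q_map_eq_of_homotopy _ h, Functor.map_zero]

lemma van_Q_iff {K L : CochainComplex 𝒜 ℤ} [K.IsKProjective] (n : ℤ) :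
    Van (Q.obj K) (Q.obj L) n ↔ ∀ f : K ⟶ L⟦n⟧, Nonempty (Homotopy f 0) := by
  let e : (Q.obj K ⟶ Q.obj (L⟦n⟧)) ≃ coh (Q.obj K) (Q.obj L) n :=
    Iso.homCongr (Iso.refl _) ((Q.commShiftIso n).app L)
  refine e.subsingleton_congr.symm.trans ?_
  constructor
  · intro h f
    exact (Q_map_eq_zero_iff f).1 (Subsingleton.elim _ _)
  · intro h
    refine ⟨fun f g => ?_⟩
    obtain ⟨f, rfl⟩ := Q_map_surjective f
    obtain ⟨g, rfl⟩ := Q_map_surjective g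
    rw [(Q_map_eq_zero_iff f).2 (h f), (Q_map_eq_zero_iff g).2 (h g)]

lemma exists_iso_Q (X : DerivedCategory 𝒜) : ∃ K : CochainComplex 𝒜 ℤ, Nonempty (X ≅ Q.obj K) :=
  ⟨_, ⟨(Q.objObjPreimageIso X).symm⟩⟩

end Der

section Mod

variable (R : Type u) [Ring R] [HasDerivedCategory.{w} (ModuleCat.{u} R)]

/-- The regular module, as an object of the derived category. -/
noncomputable abbrev reg : DerivedCategory (ModuleCat.{u} R) :=
  (singleFunctor (ModuleCat.{u} R) 0).obj (ModuleCat.of R R)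

variable {R}

instance (M : ModuleCat.{u} R) [Projective M] :
    ((CochainComplex.singleFunctor (ModuleCat.{u} R) 0).obj M).IsKProjective := by
  have : ∀ n, Projective (((CochainComplex.singleFunctor (ModuleCat.{u} R) 0).obj M).X n) := by
    intro n
    by_cases hn : n = 0
    · subst hn
      exact Projective.of_iso (HomologicalComplex.singleObjXSelf (.up ℤ) 0 M).symm ‹_›
    · exact (HomologicalComplex.isZero_single_obj_X (.up ℤ) 0 M n hn).projective
  exact CochainComplex.isKProjective_of_projective _ 0

/-- Vanishing of all cocycles up to boundaries. -/
lemma homotopy_iff_cocycle {𝒜 : Type u} [Category.{v} 𝒜] [Abelian 𝒜] (K L : CochainComplex 𝒜 ℤ)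
    (n : ℤ) : (∀ f : K ⟶ L⟦n⟧, Nonempty (Homotopy f 0)) ↔
      ∀ z : CochainComplex.HomComplex.Cocycle K L n,
        z ∈ CochainComplex.HomComplex.coboundaries K L n := by
  constructor
  · intro h z
    rw [← CochainComplex.HomComplex.CohomologyClass.toHom_mk_eq_zero_iff,
      CochainComplex.HomComplex.CohomologyClass.toHom_mk,
      HomotopyCategory.quotient_map_eq_zero_iff]
    exact h _
  · intro h f
    have := h (CochainComplex.HomComplex.Cocycle.equivHomShift f)
    rw [← CochainComplex.HomComplex.CohomologyClass.toHom_mk_eq_zero_iff,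
      CochainComplex.HomComplex.CohomologyClass.toHom_mk,
      HomotopyCategory.quotient_map_eq_zero_iff, AddEquiv.symm_apply_apply] at this
    exact this

lemma cocycle_from_reg_iff (L : CochainComplex (ModuleCat.{u} R) ℤ) (n : ℤ) :
    (∀ z : CochainComplex.HomComplex.Cocycle
      ((CochainComplex.singleFunctor (ModuleCat.{u} R) 0).obj (ModuleCat.of R R)) L n,
        z ∈ CochainComplex.HomComplex.coboundaries _ L n) ↔ L.ExactAt n := by
  rw [L.exactAt_iff' (n - 1) n (n + 1) (by simp) (by simp), ShortComplex.moduleCat_exact_iff]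
  constructor
  · intro h x hx
    have := h (CochainComplex.HomComplex.Cocycle.fromSingleMk
      (ModuleCat.ofHom (LinearMap.toSpanSingleton R (L.X n) x)) (zero_add n) (n + 1) rfl (by
        ext
        exact (congrArg (L.d n (n + 1)).hom (one_smul R x)).trans hx))
    rw [CochainComplex.HomComplex.Cocycle.fromSingleMk_mem_coboundaries_iff _ _ _ _ _
      (n - 1) (by omega)] at this
    obtain ⟨g, hg⟩ := this
    refine ⟨g.hom 1, ?_⟩
    have := congrArg (fun t => t.hom (1 : R)) hg
    exact this.trans (one_smul R x)
  · intro h z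
    obtain ⟨f, hf, rfl⟩ := CochainComplex.HomComplex.Cocycle.fromSingleMk_surjective z n
      (zero_add n) (n + 1) rfl
    rw [CochainComplex.HomComplex.Cocycle.fromSingleMk_mem_coboundaries_iff _ _ _ _ _
      (n - 1) (by omega)]
    obtain ⟨y, hy⟩ := h (f.hom (1 : R)) (by
      exact congrArg (fun t => t.hom (1 : R)) hf)
    refine ⟨ModuleCat.ofHom (LinearMap.toSpanSingleton R (L.X (n - 1)) y), ?_⟩
    ext
    exact (congrArg (L.d (n - 1) n).hom (one_smul R y)).trans hy

lemma van_reg_iff (X : DerivedCategory (ModuleCat.{u} R)) (n : ℤ) :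
    Van (reg R) X n ↔ IsZero ((homologyFunctor (ModuleCat.{u} R) n).obj X) := by
  obtain ⟨L, ⟨e⟩⟩ := exists_iso_Q X
  refine Iff.trans ?_ ((homologyFunctor (ModuleCat.{u} R) n).mapIso e).isZero_iff.symm
  refine Iff.trans ?_ ((homologyFunctorFactors (ModuleCat.{u} R) n).app L).isZero_iff.symm
  have h1 : Van (reg R) X n ↔ Van (reg R) (Q.obj L) n := ⟨.of_iso e, .of_iso e.symm⟩
  rw [h1]
  change Van (Q.obj ((CochainComplex.singleFunctor (ModuleCat.{u} R) 0).obj (ModuleCat.of R R))) _ _ ↔ _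
  rw [van_Q_iff, homotopy_iff_cocycle, cocycle_from_reg_iff]
  exact HomologicalComplex.exactAt_iff_isZero_homology _ _

end Mod

end DerEq

namespace DerEq

open CategoryTheory Limits Pretriangulated Triangulated DerivedCategory

universe v w w'

/-- The degree zero piece. -/
def cohZero {C : Type w} [Category.{v} C] [Preadditive C] [HasShift C ℤ] (P X : C) :
    coh P X 0 ≃ₗ[(End P)ᵐᵒᵖ] (P ⟶ X) where
  toFun x := x ≫ (shiftFunctorZero C ℤ).hom.app X
  invFun x := x ≫ (shiftFunctorZero C ℤ).inv.app X
  left_inv x := by simp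
  right_inv x := by simp
  map_add' := by intros; simp
  map_smul' := by intro r x; exact Category.assoc _ _ _

lemma distinguished_of_smul {C : Type w} [Category.{v} C] [Preadditive C] [HasShift C ℤ]
    [HasZeroObject C] [∀ n : ℤ, (shiftFunctor C n).Additive] [Pretriangulated C]
    {X Y Z : C} (ε : ℤˣ) (f : X ⟶ Y) (g : Y ⟶ Z) (h : Z ⟶ X⟦(1 : ℤ)⟧)
    (hT : Triangle.mk (ε • f) (ε • g) h ∈ distTriang C) : Triangle.mk f g h ∈ distTriang C := by
  rcases Int.units_eq_one_or ε with rfl | rfl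
  · simpa using hT
  · let e : Y ≅ Y := ⟨-𝟙 Y, -𝟙 Y, by simp, by simp⟩
    have h1 : f ≫ e.hom = 𝟙 X ≫ ((-1 : ℤˣ) • f) := by simp [e]
    have h2 : g ≫ 𝟙 Z = e.hom ≫ ((-1 : ℤˣ) • g) := by simp [e]
    have h3 : h ≫ (𝟙 X)⟦(1 : ℤ)⟧' = 𝟙 Z ≫ h := by simp
    exact isomorphic_distinguished _ hT _ (Triangle.isoMk _ _ (Iso.refl X) e (Iso.refl Z) h1 h2 h3)

section Mod

variable {R : Type u} [Ring R] [HasDerivedCategory.{w} (ModuleCat.{u} R)]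

lemma reg_isGE_iff (X : DerivedCategory (ModuleCat.{u} R)) (n : ℤ) :
    X.IsGE n ↔ ∀ i < n, Van (reg R) X i := by
  simp only [isGE_iff, van_reg_iff]

lemma reg_isLE_iff (X : DerivedCategory (ModuleCat.{u} R)) (n : ℤ) :
    X.IsLE n ↔ ∀ i, n < i → Van (reg R) X i := by
  simp only [isLE_iff, van_reg_iff]

lemma van_reg_single (M : ModuleCat.{u} R) (j : ℤ) (hj : j ≠ 0) :
    Van (reg R) ((singleFunctor (ModuleCat.{u} R) 0).obj M) j := by
  rcases lt_or_gt_of_ne hj with h | h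
  · exact (reg_isGE_iff _ 0).1 inferInstance j h
  · exact (reg_isLE_iff _ 0).1 inferInstance j h

lemma van_reg_self (j : ℤ) (hj : j ≠ 0) : Van (reg R) (reg R) j :=
  van_reg_single (ModuleCat.of R R) j hj

lemma exists_truncation (X : DerivedCategory (ModuleCat.{u} R)) (n : ℤ) :
    ∃ (F Z : DerivedCategory (ModuleCat.{u} R)) (i : F ⟶ X) (p : X ⟶ Z) (d : Z ⟶ F⟦(1 : ℤ)⟧),
      Triangle.mk i p d ∈ distTriang (DerivedCategory (ModuleCat.{u} R)) ∧
      (∀ j, n < j → Van (reg R) F j) ∧ (∀ j, j ≤ n → Van (reg R) Z j) := by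
  obtain ⟨F, Z, hF, hZ, i, p, d, h⟩ :=
    (TStructure.t (C := ModuleCat.{u} R)).exists_triangle X n (n + 1) rfl
  refine ⟨F, Z, i, p, d, h, ?_, ?_⟩
  · have : F.IsLE n := ⟨hF⟩
    exact (reg_isLE_iff F n).1 this
  · have : Z.IsGE (n + 1) := ⟨hZ⟩
    intro j hj
    exact (reg_isGE_iff Z (n + 1)).1 this j (by omega)

/-- The embedding of modules in degree `-n`. -/
noncomputable abbrev emb (R : Type u) [Ring R] [HasDerivedCategory.{w} (ModuleCat.{u} R)] (n : ℤ) :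
    ModuleCat.{u} R ⥤ DerivedCategory (ModuleCat.{u} R) :=
  singleFunctor (ModuleCat.{u} R) 0 ⋙ shiftFunctor _ n

lemma emb_triangle (n : ℤ) {X Y Z : ModuleCat.{u} R} (f : X →ₗ[R] Y) (g : Y →ₗ[R] Z)
    (h : Paper.IsSES R f g) : ∃ d, Triangle.mk ((emb R n).map (ModuleCat.ofHom f))
      ((emb R n).map (ModuleCat.ofHom g)) d ∈ distTriang (DerivedCategory (ModuleCat.{u} R)) := by
  let S : ShortComplex (ModuleCat.{u} R) := ShortComplex.mk (ModuleCat.ofHom f) (ModuleCat.ofHom g)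
    (by
      ext x
      have : f x ∈ LinearMap.ker g := h.2.2 ▸ ⟨x, rfl⟩
      exact this)
  have hS : S.ShortExact :=
    { exact := by
        rw [ShortComplex.moduleCat_exact_iff_range_eq_ker]
        exact h.2.2
      mono_f := (ModuleCat.mono_iff_injective _).2 h.1
      epi_g := (ModuleCat.epi_iff_surjective _).2 h.2.1 }
  have := Triangle.shift_distinguished _ hS.singleTriangle_distinguished n
  exact ⟨_, distinguished_of_smul n.negOnePow _ _ _ this⟩

end Mod

end DerEq

namespace DerEq

open CategoryTheory Limits Pretriangulated Triangulated DerivedCategory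

universe v w w'

section Mod

variable {R : Type u} [Ring R] [HasDerivedCategory.{w} (ModuleCat.{u} R)]

lemma van_emb (n : ℤ) (X : ModuleCat.{u} R) (j : ℤ) (hj : j ≠ -n) :
    Van (reg R) ((emb R n).obj X) j :=
  (van_shift_iff _ _ n j (n + j) rfl).2 (van_reg_single X _ (by omega))

/-- Right multiplication. -/
def rmul (r : R) : ModuleCat.of R R ⟶ ModuleCat.of R R :=
  ModuleCat.ofHom (LinearMap.toSpanSingleton R R r)

lemma rmul_mul (r s : R) : rmul (r * s) = rmul r ≫ rmul s := by
  ext; simp [rmul]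

lemma rmul_add (r s : R) : rmul (r + s) = rmul r + rmul s := by
  ext; simp [rmul]

lemma rmul_one : rmul (1 : R) = 𝟙 _ := by
  ext; simp [rmul]

lemma rmul_surjective (f : ModuleCat.of R R ⟶ ModuleCat.of R R) :
    rmul (f.hom (1 : R)) = f := by
  ext; simp [rmul]

/-- The ring of endomorphisms of the regular module. -/
noncomputable def regEnd : R →+* (End (reg R))ᵐᵒᵖ where
  toFun r := MulOpposite.op ((singleFunctor (ModuleCat.{u} R) 0).map (rmul r))
  map_one' := by
    rw [rmul_one, CategoryTheory.Functor.map_id]; rfl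
  map_mul' r s := by
    rw [rmul_mul, Functor.map_comp]; rfl
  map_zero' := by
    have : rmul (0 : R) = 0 := by ext; simp [rmul]
    rw [this, Functor.map_zero]; rfl
  map_add' r s := by
    rw [rmul_add, Functor.map_add]; rfl

lemma regEnd_bijective : Function.Bijective (regEnd (R := R)) := by
  constructor
  · intro r s h
    have h' : rmul r = rmul s :=
      (singleFunctor (ModuleCat.{u} R) 0).map_injective (MulOpposite.op_injective h)
    have := congrArg (fun t => t.hom (1 : R)) h'
    simpa [rmul] using this
  · intro x
    obtain ⟨f, hf⟩ := (singleFunctor (ModuleCat.{u} R) 0).map_surjective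
      (X := ModuleCat.of R R) (Y := ModuleCat.of R R) x.unop
    refine ⟨f.hom (1 : R), ?_⟩
    apply MulOpposite.unop_injective
    rw [← hf]
    exact congrArg (singleFunctor (ModuleCat.{u} R) 0).map (rmul_surjective f)

instance [IsNoetherianRing R] : IsNoetherianRing (End (reg R))ᵐᵒᵖ :=
  isNoetherianRing_of_surjective _ _ regEnd regEnd_bijective.2

lemma finite_of_coh (Y : ModuleCat.{u} R)
    (h : Module.Finite (End (reg R))ᵐᵒᵖ (reg R ⟶ (singleFunctor (ModuleCat.{u} R) 0).obj Y)) :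
    Module.Finite R Y := by
  obtain ⟨s, hs⟩ := h.fg_top
  have hsur : ∀ x : reg R ⟶ (singleFunctor (ModuleCat.{u} R) 0).obj Y,
      ∃ f : ModuleCat.of R R ⟶ Y, (singleFunctor (ModuleCat.{u} R) 0).map f = x :=
    fun x => (singleFunctor (ModuleCat.{u} R) 0).map_surjective (X := ModuleCat.of R R) x
  choose φ hφ using hsur
  classical
  refine ⟨⟨s.image (fun x => (φ x).hom (1 : R)), ?_⟩⟩
  have key : ∀ x ∈ Submodule.span (End (reg R))ᵐᵒᵖ (s : Set (reg R ⟶ _)),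
      (φ x).hom (1 : R) ∈ Submodule.span R
        ((s.image (fun x => (φ x).hom (1 : R)) : Finset Y) : Set Y) := by
    intro x hx
    induction hx using Submodule.span_induction with
    | mem x hx => exact Submodule.subset_span (Finset.mem_coe.2 (Finset.mem_image_of_mem _ hx))
    | zero =>
      have : φ 0 = 0 := (singleFunctor (ModuleCat.{u} R) 0).map_injective (by
        rw [hφ, Functor.map_zero])
      rw [this]
      exact Submodule.zero_mem _
    | add x y _ _ hx hy =>
      have : φ (x + y) = φ x + φ y :=
        (singleFunctor (ModuleCat.{u} R) 0).map_injective (by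
          rw [Functor.map_add, hφ, hφ, hφ])
      rw [this]
      exact Submodule.add_mem _ hx hy
    | smul r x _ hx =>
      obtain ⟨r, rfl⟩ := regEnd_bijective.2 r
      have : φ (regEnd r • x) = rmul r ≫ φ x :=
        (singleFunctor (ModuleCat.{u} R) 0).map_injective (by
          rw [Functor.map_comp, hφ, hφ]; rfl)
      rw [this]
      have h2 : (rmul r ≫ φ x).hom (1 : R) = r • (φ x).hom (1 : R) := by
        rw [← map_smul]
        change (φ x).hom ((1 : R) • r) = (φ x).hom (r • (1 : R))
        simp
      rw [h2]
      exact Submodule.smul_mem _ _ hx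
  rw [eq_top_iff]
  intro y _
  have hy : φ ((singleFunctor (ModuleCat.{u} R) 0).map
      (ModuleCat.ofHom (LinearMap.toSpanSingleton R Y y))) =
      ModuleCat.ofHom (LinearMap.toSpanSingleton R Y y) :=
    (singleFunctor (ModuleCat.{u} R) 0).map_injective (hφ _)
  have := key ((singleFunctor (ModuleCat.{u} R) 0).map
      (ModuleCat.ofHom (LinearMap.toSpanSingleton R Y y))) (hs ▸ Submodule.mem_top)
  rw [hy] at this
  have h3 : (ModuleCat.ofHom (LinearMap.toSpanSingleton R Y y)).hom (1 : R) = y := one_smul R y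
  rwa [h3] at this

lemma exists_heart (n : ℤ) (E : DerivedCategory (ModuleCat.{u} R))
    (hE : ∀ j, j ≠ -n → Van (reg R) E j)
    (hf : ∀ j, IsNoetherian (End (reg R))ᵐᵒᵖ (coh (reg R) E j)) :
    ∃ X : ModuleCat.{u} R, Module.Finite R X ∧ Nonempty (E ≅ (emb R n).obj X) := by
  have h1 : E.IsGE (-n) := (reg_isGE_iff _ _).2 fun i hi => hE i (by omega)
  have h2 : E.IsLE (-n) := (reg_isLE_iff _ _).2 fun i hi => hE i (by omega)
  obtain ⟨Y, ⟨e⟩⟩ := exists_iso_singleFunctor_obj_of_isGE_of_isLE E (-n)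
  let e' : E ≅ (emb R n).obj Y := e ≪≫ ((singleFunctors (ModuleCat.{u} R)).shiftIso n (-n) 0
    (by omega)).symm.app Y
  refine ⟨Y, ?_, ⟨e'⟩⟩
  apply finite_of_coh
  have h3 : IsNoetherian (End (reg R))ᵐᵒᵖ
      (coh (reg R) (((singleFunctor (ModuleCat.{u} R) 0).obj Y)⟦n⟧) (-n)) :=
    have := hf (-n)
    isNoetherian_of_linearEquiv (cohIso (reg R) e' (-n))
  have h4 : IsNoetherian (End (reg R))ᵐᵒᵖ
      (coh (reg R) ((singleFunctor (ModuleCat.{u} R) 0).obj Y) 0) :=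
    isNoetherian_of_linearEquiv (cohShift (reg R) _ n (-n) 0 (by omega))
  exact Module.Finite.of_surjective (cohZero (reg R) ((singleFunctor (ModuleCat.{u} R) 0).obj Y)).toLinearMap
    (LinearEquiv.surjective _)

end Mod

end DerEq

namespace DerEq

open CategoryTheory Limits Pretriangulated Triangulated DerivedCategory

universe v w w'

section Mod

variable {R : Type u} [Ring R]

/-- Finitely generated projective modules. -/
def FP (M : ModuleCat.{u} R) : Prop := Projective M ∧ Module.Finite R M

lemma FP.of_iso {M N : ModuleCat.{u} R} (e : M ≅ N) (h : FP M) : FP N :=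
  ⟨Projective.of_iso e h.1, have := h.2; Module.Finite.equiv e.toLinearEquiv⟩

lemma FP.biprod {M N : ModuleCat.{u} R} (h : FP M) (h' : FP N) : FP (M ⊞ N) := by
  have := h.1; have := h'.1; have := h.2; have := h'.2
  exact ⟨inferInstance, Module.Finite.equiv (ModuleCat.biprodIsoProd M N).symm.toLinearEquiv⟩

lemma FP.of_isZero {M : ModuleCat.{u} R} (h : IsZero M) : FP M := by
  refine ⟨h.projective, ?_⟩
  have := ModuleCat.subsingleton_of_isZero h
  infer_instance

lemma FP.self : FP (ModuleCat.of R R) :=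
  ⟨inferInstance, inferInstanceAs (Module.Finite R R)⟩

/-- Strictly perfect complexes of amplitude `[-w, w]`. -/
structure IsPerf (w : ℕ) (K : CochainComplex (ModuleCat.{u} R) ℤ) : Prop where
  fp : ∀ n, FP (K.X n)
  zero : ∀ n : ℤ, n < -w ∨ w < n → IsZero (K.X n)

lemma IsPerf.mono {m n : ℕ} (h : m ≤ n) {K : CochainComplex (ModuleCat.{u} R) ℤ}
    (hK : IsPerf m K) : IsPerf n K := ⟨hK.fp, fun i hi => hK.zero i (by omega)⟩

lemma IsPerf.isKProjective {m : ℕ} {K : CochainComplex (ModuleCat.{u} R) ℤ} (hK : IsPerf m K) :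
    K.IsKProjective := by
  have : K.IsStrictlyLE m := (CochainComplex.isStrictlyLE_iff _ _).2 fun i hi => hK.zero i (.inr hi)
  have := fun n => (hK.fp n).1
  exact CochainComplex.isKProjective_of_projective K m

lemma IsPerf.shift {m : ℕ} {K : CochainComplex (ModuleCat.{u} R) ℤ} (hK : IsPerf m K) (i : ℤ) :
    IsPerf (m + i.natAbs) (K⟦i⟧) :=
  ⟨fun n => hK.fp (n + i), fun n hn => hK.zero (n + i) (by omega)⟩

lemma IsPerf.single {M : ModuleCat.{u} R} (hM : FP M) :
    IsPerf 0 ((CochainComplex.singleFunctor (ModuleCat.{u} R) 0).obj M) := by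
  refine ⟨fun n => ?_, fun n hn =>
    HomologicalComplex.isZero_single_obj_X (.up ℤ) 0 M n (by omega)⟩
  by_cases hn : n = 0
  · subst hn
    exact hM.of_iso (HomologicalComplex.singleObjXSelf (.up ℤ) 0 M).symm
  · exact .of_isZero (HomologicalComplex.isZero_single_obj_X (.up ℤ) 0 M n hn)

lemma IsPerf.cone {m : ℕ} {K L : CochainComplex (ModuleCat.{u} R) ℤ} (hK : IsPerf m K)
    (hL : IsPerf m L) (f : K ⟶ L) : IsPerf (m + 1) (CochainComplex.mappingCone f) := by
  have e (n : ℤ) : (CochainComplex.mappingCone f).X n ≅ K.X (n + 1) ⊞ L.X n :=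
    HomologicalComplex.homotopyCofiber.XIsoBiprod f n (n + 1) (by simp)
  refine ⟨fun n => ((hK.fp (n + 1)).biprod (hL.fp n)).of_iso (e n).symm, fun n hn => ?_⟩
  refine IsZero.of_iso ?_ (e n)
  rw [biprod_isZero_iff]
  exact ⟨hK.zero _ (by omega), hL.zero _ (by omega)⟩

variable [HasDerivedCategory.{w} (ModuleCat.{u} R)]

lemma van_reg_Q_iff (L : CochainComplex (ModuleCat.{u} R) ℤ) (n : ℤ) :
    Van (reg R) (Q.obj L) n ↔ L.ExactAt n := by
  change Van (Q.obj ((CochainComplex.singleFunctor (ModuleCat.{u} R) 0).obj (ModuleCat.of R R))) _ _ ↔ _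
  rw [van_Q_iff, homotopy_iff_cocycle, cocycle_from_reg_iff]

lemma IsPerf.van {m : ℕ} {K : CochainComplex (ModuleCat.{u} R) ℤ} (hK : IsPerf m K)
    (X : DerivedCategory (ModuleCat.{u} R)) (i : ℤ)
    (h : ∀ j, i - m ≤ j → j ≤ i + m → Van (reg R) X j) : Van (Q.obj K) X i := by
  have := hK.isKProjective
  rw [← van_shift_iff (Q.obj K) X i 0 i (by omega)]
  have h' : ∀ j : ℤ, -m ≤ j → j ≤ m → Van (reg R) (X⟦i⟧) j := fun j h1 h2 =>
    (van_shift_iff _ X i j (i + j) rfl).2 (h _ (by omega) (by omega))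
  obtain ⟨F, Z, a, p, d, hT, hF, hZ⟩ := exists_truncation (X⟦i⟧) (-m - 1)
  refine van₂ (Q.obj K) _ hT 0 ?_ ?_
  · have hF' : F.IsLE (-m - 1) := (reg_isLE_iff _ _).2 hF
    obtain ⟨L, hL, ⟨e⟩⟩ := exists_iso_Q_obj_of_isLE F (-m - 1)
    refine .of_iso e.symm ((van_Q_iff 0).2 fun f => ?_)
    have hf : f = 0 := by
      ext1 n
      by_cases hn : -m ≤ n
      · exact (L.isZero_of_isStrictlyLE (-m - 1) (n + 0) (by omega)).eq_of_tgt _ _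
      · exact (hK.zero n (by omega)).eq_of_src _ _
    rw [hf]
    exact ⟨Homotopy.refl _⟩
  · have hZ' : Z.IsGE (m + 1) := (reg_isGE_iff _ _).2 fun j hj => by
      rcases lt_or_ge j (-m) with h1 | h1
      · exact hZ j (by omega)
      · exact van₃ (reg R) _ hT j (j + 1) rfl (hF _ (by omega)) (h' j (by omega) (by omega))
    obtain ⟨L, hL, ⟨e⟩⟩ := exists_iso_Q_obj_of_isGE Z (m + 1)
    refine .of_iso e.symm ((van_Q_iff 0).2 fun f => ?_)
    have hf : f = 0 := by
      ext1 n
      by_cases hn : n ≤ m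
      · exact (L.isZero_of_isStrictlyGE (m + 1) (n + 0) (by omega)).eq_of_tgt _ _
      · exact (hK.zero n (by omega)).eq_of_src _ _
    rw [hf]
    exact ⟨Homotopy.refl _⟩

/-- Perfect objects. -/
def Perf (X : DerivedCategory (ModuleCat.{u} R)) : Prop :=
  ∃ (m : ℕ) (K : CochainComplex (ModuleCat.{u} R) ℤ), IsPerf m K ∧ Nonempty (X ≅ Q.obj K)

lemma Perf.of_iso {X Y : DerivedCategory (ModuleCat.{u} R)} (e : X ≅ Y) (h : Perf X) : Perf Y := by
  obtain ⟨m, K, hK, ⟨e'⟩⟩ := h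
  exact ⟨m, K, hK, ⟨e.symm ≪≫ e'⟩⟩

lemma Perf.shift {X : DerivedCategory (ModuleCat.{u} R)} (h : Perf X) (i : ℤ) : Perf (X⟦i⟧) := by
  obtain ⟨m, K, hK, ⟨e'⟩⟩ := h
  exact ⟨_, _, hK.shift i, ⟨(shiftFunctor _ i).mapIso e' ≪≫ ((Q.commShiftIso i).app K).symm⟩⟩

lemma Perf.ext₃ (T : Triangle (DerivedCategory (ModuleCat.{u} R)))
    (hT : T ∈ distTriang (DerivedCategory (ModuleCat.{u} R))) (h₁ : Perf T.obj₁) (h₂ : Perf T.obj₂) :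
    Perf T.obj₃ := by
  obtain ⟨m, K, hK, ⟨e₁⟩⟩ := h₁
  obtain ⟨n, L, hL, ⟨e₂⟩⟩ := h₂
  have := hK.isKProjective
  obtain ⟨f, hf⟩ := Q_map_surjective (e₁.inv ≫ T.mor₁ ≫ e₂.hom)
  have hcomm : T.mor₁ ≫ e₂.hom = e₁.hom ≫ Q.map f := by rw [hf]; simp
  let T' := DerivedCategory.Q.mapTriangle.obj (CochainComplex.mappingCone.triangle f)
  have hT' : T' ∈ distTriang _ := mappingCone_triangle_distinguished f
  let e := isoTriangleOfIso₁₂ T T' hT hT' e₁ e₂ hcomm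
  exact ⟨_, _, (hK.mono (le_max_left m n)).cone (hL.mono (le_max_right m n)) f,
    ⟨Triangle.π₃.mapIso e⟩⟩

lemma Perf.ext₂ (T : Triangle (DerivedCategory (ModuleCat.{u} R)))
    (hT : T ∈ distTriang (DerivedCategory (ModuleCat.{u} R))) (h₁ : Perf T.obj₁) (h₃ : Perf T.obj₃) :
    Perf T.obj₂ := by
  have := Perf.ext₃ _ (inv_rot_of_distTriang _ hT) (h₃.shift (-1)) h₁
  exact this

lemma Perf.single {M : ModuleCat.{u} R} (hM : FP M) :
    Perf ((singleFunctor (ModuleCat.{u} R) 0).obj M) :=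
  ⟨0, _, IsPerf.single hM, ⟨Iso.refl _⟩⟩

lemma Perf.of_extCl {I : Set ℤ} {X : DerivedCategory (ModuleCat.{u} R)}
    (h : ExtCl (reg R) I X) : Perf X := by
  induction h with
  | zero X h =>
    have h0 : IsZero (ModuleCat.of R PUnit.{u + 1}) := ModuleCat.isZero_of_subsingleton _
    exact .of_iso ((Functor.map_isZero (singleFunctor (ModuleCat.{u} R) 0) h0).iso h)
      (Perf.single (.of_isZero h0))
  | of n h => exact (Perf.single .self).shift n
  | ext T hT _ _ ih1 ih2 => exact Perf.ext₂ T hT ih1 ih2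

end Mod

end DerEq

namespace DerEq

open CategoryTheory Limits Pretriangulated Triangulated DerivedCategory
open scoped Classical

universe v w w'

section Sum

variable {R : Type u} [Ring R] {I : Type u}

/-- The underlying modules of a direct sum of complexes. -/
abbrev dsumX (K : I → CochainComplex (ModuleCat.{u} R) ℤ) (n : ℤ) : Type u := Π₀ i, (K i).X n

/-- Direct sums of cochain complexes of modules. -/
noncomputable def dsum (K : I → CochainComplex (ModuleCat.{u} R) ℤ) :
    CochainComplex (ModuleCat.{u} R) ℤ where
  X n := ModuleCat.of R (dsumX K n)
  d m n := ModuleCat.ofHom (DFinsupp.mapRange.linearMap fun i => ((K i).d m n).hom)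
  shape m n h := by
    apply ModuleCat.hom_ext
    refine LinearMap.ext fun (x : dsumX K m) => DFinsupp.ext fun i => ?_
    change ((K i).d m n).hom (x i) = 0
    rw [(K i).shape m n h]
    rfl
  d_comp_d' l m n _ _ := by
    apply ModuleCat.hom_ext
    refine LinearMap.ext fun (x : dsumX K l) => DFinsupp.ext fun i => ?_
    change ((K i).d m n).hom (((K i).d l m).hom (x i)) = 0
    exact congrArg (fun t => t.hom (x i)) ((K i).d_comp_d l m n)

namespace dsum

variable (K L : I → CochainComplex (ModuleCat.{u} R) ℤ)

/-- The inclusion of a summand. -/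
noncomputable def ι (i : I) : K i ⟶ dsum K where
  f n := ModuleCat.ofHom (Y := dsumX K n)
    (DFinsupp.lsingle (M := fun i => (K i).X n) (R := R) i)
  comm' m n _ := by
    apply ModuleCat.hom_ext
    refine LinearMap.ext fun (x : (K i).X m) => ?_
    exact DFinsupp.mapRange_single (f := fun i => ((K i).d m n).hom)
      (hf := fun i => map_zero ((K i).d m n).hom) (i := i) (b := x)

/-- The projection onto a summand. -/
noncomputable def π (i : I) : dsum K ⟶ K i where
  f n := ModuleCat.ofHom (X := dsumX K n)
    (DFinsupp.lapply (M := fun i => (K i).X n) (R := R) i)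
  comm' m n _ := rfl

variable {K L}

/-- The map from a direct sum given by a family of maps. -/
noncomputable def desc {M : CochainComplex (ModuleCat.{u} R) ℤ} (g : ∀ i, K i ⟶ M) :
    dsum K ⟶ M where
  f n := ModuleCat.ofHom (X := dsumX K n)
    (DFinsupp.lsum (M := fun i => (K i).X n) (R := R) ℕ fun i => ((g i).f n).hom)
  comm' m n _ := by
    apply ModuleCat.hom_ext
    refine DFinsupp.lhom_ext (N := M.X n) (M := fun i => (K i).X m) fun i x => ?_
    have h1 : (DFinsupp.mapRange (fun i => ((K i).d m n).hom) (fun i => map_zero _)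
        (DFinsupp.single i x) : dsumX K n) = DFinsupp.single i (((K i).d m n).hom x) :=
      DFinsupp.mapRange_single
    have h2 : ∀ (p : ℤ) (y : (K i).X p), DFinsupp.lsum (M := fun i => (K i).X p) (R := R) ℕ
        (fun i => ((g i).f p).hom) (DFinsupp.single i y) = ((g i).f p).hom y := fun p y =>
      DFinsupp.lsum_single _ _ _ _
    refine (congrArg (M.d m n).hom (h2 m x)).trans (Eq.trans ?_
      ((congrArg (DFinsupp.lsum (M := fun i => (K i).X n) (R := R) ℕ
        (fun i => ((g i).f n).hom)) h1).trans (h2 n _)).symm)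
    exact congrArg (fun t => t.hom x) ((g i).comm m n)

@[simp]
lemma ι_desc {M : CochainComplex (ModuleCat.{u} R) ℤ} (g : ∀ i, K i ⟶ M) (i : I) :
    ι K i ≫ desc g = g i := by
  ext n x
  exact DFinsupp.lsum_single (M := fun i => (K i).X n) (N := M.X n) (R := R) ℕ (fun i => ((g i).f n).hom) i x

lemma hom_ext {M : CochainComplex (ModuleCat.{u} R) ℤ} {f g : dsum K ⟶ M}
    (h : ∀ i, ι K i ≫ f = ι K i ≫ g) : f = g := by
  ext1 n
  apply ModuleCat.hom_ext
  refine DFinsupp.lhom_ext (N := M.X n) (M := fun i => (K i).X n) fun i x => ?_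
  exact congrArg (fun t : K i ⟶ M => (t.f n).hom x) (h i)

/-- Functoriality of direct sums. -/
noncomputable def map (s : ∀ i, K i ⟶ L i) : dsum K ⟶ dsum L := desc fun i => s i ≫ ι L i

lemma ι_map (s : ∀ i, K i ⟶ L i) (i : I) : ι K i ≫ map s = s i ≫ ι L i := ι_desc _ _

lemma ι_π (i : I) : ι K i ≫ π K i = 𝟙 _ := by
  ext n x
  exact DFinsupp.single_eq_same (β := fun i => (K i).X n) (i := i) (b := x)

lemma ι_π_ne {i j : I} (h : i ≠ j) : ι K i ≫ π K j = 0 := by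
  ext n x
  exact DFinsupp.single_eq_of_ne (β := fun i => (K i).X n) h.symm

lemma map_π (s : ∀ i, K i ⟶ L i) (i : I) : map s ≫ π L i = π K i ≫ s i := by
  refine hom_ext fun j => ?_
  rw [← Category.assoc, ι_map, Category.assoc]
  by_cases h : j = i
  · subst h
    rw [ι_π, ← Category.assoc, ι_π, Category.comp_id, Category.id_comp]
  · rw [ι_π_ne h, ← Category.assoc, ι_π_ne h, comp_zero, zero_comp]

lemma sum_π_ι (n : ℤ) (x : dsumX K n) (s : Finset I)
    (hs : ∀ i ∉ s, ((π K i).f n).hom x = 0) :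
    ∑ i ∈ s, ((π K i ≫ ι K i).f n).hom x = x := by
  change ∑ i ∈ s, (DFinsupp.single i (x i) : dsumX K n) = _
  refine DFinsupp.ext fun j => ?_
  rw [DFinsupp.finset_sum_apply]
  by_cases hj : j ∈ s
  · rw [Finset.sum_eq_single_of_mem j hj fun i _ hij => DFinsupp.single_eq_of_ne hij.symm]
    exact DFinsupp.single_eq_same
  · rw [Finset.sum_eq_zero fun i hi => DFinsupp.single_eq_of_ne (by rintro rfl; exact hj hi)]
    exact (hs j hj).symm

lemma exists_support (n : ℤ) (x : dsumX K n) :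
    ∃ s : Finset I, ∀ i ∉ s, ((π K i).f n).hom x = 0 :=
  ⟨DFinsupp.support x, fun _ hi => DFinsupp.notMem_support_iff.1 hi⟩

/-- A locally finite family of maps. -/
noncomputable def liftFun {M : CochainComplex (ModuleCat.{u} R) ℤ} (f : ∀ i, M ⟶ K i)
    (hf : ∀ n (x : M.X n), ∃ s : Finset I, ∀ i ∉ s, ((f i).f n).hom x = 0) (n : ℤ) (x : M.X n) :
    dsumX K n := DFinsupp.mk (hf n x).choose fun i => ((f i).f n).hom x

lemma liftFun_apply {M : CochainComplex (ModuleCat.{u} R) ℤ} (f : ∀ i, M ⟶ K i)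
    (hf : ∀ n (x : M.X n), ∃ s : Finset I, ∀ i ∉ s, ((f i).f n).hom x = 0) (n : ℤ) (x : M.X n)
    (i : I) : liftFun f hf n x i = ((f i).f n).hom x := by
  rw [liftFun, DFinsupp.mk_apply]
  split_ifs with h
  · rfl
  · exact ((hf n x).choose_spec i h).symm

/-- The map to a direct sum given by a locally finite family of maps. -/
noncomputable def lift {M : CochainComplex (ModuleCat.{u} R) ℤ} (f : ∀ i, M ⟶ K i)
    (hf : ∀ n (x : M.X n), ∃ s : Finset I, ∀ i ∉ s, ((f i).f n).hom x = 0) : M ⟶ dsum K where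
  f n := ModuleCat.ofHom (Y := dsumX K n)
    { toFun := liftFun f hf n
      map_add' := fun x y => DFinsupp.ext fun i => by
        rw [DFinsupp.add_apply, liftFun_apply, liftFun_apply, liftFun_apply, map_add]
      map_smul' := fun r x => DFinsupp.ext fun i => by
        rw [RingHom.id_apply, DFinsupp.smul_apply, liftFun_apply, liftFun_apply, map_smul] }
  comm' m n _ := by
    apply ModuleCat.hom_ext
    refine LinearMap.ext fun (x : M.X m) => DFinsupp.ext fun i => ?_
    refine Eq.trans ?_ (liftFun_apply f hf n ((M.d m n).hom x) i).symm
    refine (congrArg ((K i).d m n).hom (liftFun_apply f hf m x i)).trans ?_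
    exact congrArg (fun t => t.hom x) ((f i).comm m n)

lemma lift_π {M : CochainComplex (ModuleCat.{u} R) ℤ} (f : ∀ i, M ⟶ K i)
    (hf : ∀ n (x : M.X n), ∃ s : Finset I, ∀ i ∉ s, ((f i).f n).hom x = 0) (i : I) :
    lift f hf ≫ π K i = f i := by
  ext n x
  exact liftFun_apply f hf n x i

end dsum

lemma exactAt_iff (L : CochainComplex (ModuleCat.{u} R) ℤ) (n : ℤ) : L.ExactAt n ↔
    ∀ x : L.X n, (L.d n (n + 1)).hom x = 0 → ∃ y, (L.d (n - 1) n).hom y = x := by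
  rw [L.exactAt_iff' (n - 1) n (n + 1) (by simp) (by simp), ShortComplex.moduleCat_exact_iff]
  rfl

end Sum

end DerEq

namespace DerEq

open CategoryTheory Limits Pretriangulated Triangulated DerivedCategory
open CochainComplex (mappingCone)

universe v w w'

section Sum

variable {R : Type u} [Ring R] {I : Type u}

/-- A family of retracts through which a complex is locally finitely decomposed. -/
lemma exactAt_of_decomp (M : CochainComplex (ModuleCat.{u} R) ℤ)
    (C : I → CochainComplex (ModuleCat.{u} R) ℤ) (a : ∀ i, M ⟶ C i) (b : ∀ i, C i ⟶ M) (n : ℤ)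
    (h : ∀ x : M.X n, ∃ s : Finset I, ∑ i ∈ s, ((a i ≫ b i).f n).hom x = x)
    (hC : ∀ i, (C i).ExactAt n) : M.ExactAt n := by
  rw [exactAt_iff]
  intro x hx
  obtain ⟨s, hs⟩ := h x
  have h1 : ∀ i, ∃ y, ((C i).d (n - 1) n).hom y = ((a i).f n).hom x := fun i =>
    (exactAt_iff _ _).1 (hC i) _ (by
      refine (congrArg (fun t => t.hom x) ((a i).comm n (n + 1))).trans ?_
      exact (congrArg ((a i).f (n + 1)).hom hx).trans (map_zero _))
  choose y hy using h1
  refine ⟨∑ i ∈ s, ((b i).f (n - 1)).hom (y i), ?_⟩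
  rw [map_sum, ← hs]
  refine Finset.sum_congr rfl fun i _ => ?_
  refine (congrArg (fun t => t.hom (y i)) ((b i).comm (n - 1) n)).trans ?_
  exact congrArg ((b i).f n).hom (hy i)

lemma cone_map_apply {K K' L L' : CochainComplex (ModuleCat.{u} R) ℤ} (f : K ⟶ L) (f' : K' ⟶ L')
    (a : K ⟶ K') (b : L ⟶ L') (h : f ≫ b = a ≫ f') (n : ℤ) :
    (mappingCone.map f f' a b h).f n =
      (mappingCone.fst f).1.v n (n + 1) rfl ≫ a.f (n + 1) ≫
        (mappingCone.inl f').v (n + 1) n (by omega) +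
      (mappingCone.snd f).v n n (add_zero n) ≫ b.f n ≫ (mappingCone.inr f').f n := by
  have e := congrArg (fun t => t ≫ (mappingCone.map f f' a b h).f n)
    (mappingCone.id_X f n (n + 1) rfl)
  refine Eq.trans (Category.id_comp _).symm (e.symm.trans ?_)
  simp [mappingCone.map]

variable {K L : I → CochainComplex (ModuleCat.{u} R) ℤ}

lemma exactAt_cone_dsum (s : ∀ i, K i ⟶ L i) (n : ℤ)
    (h : ∀ i, (mappingCone (s i)).ExactAt n) : (mappingCone (dsum.map s)).ExactAt n := by
  refine exactAt_of_decomp _ (fun i => mappingCone (s i))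
    (fun i => mappingCone.map _ _ (dsum.π K i) (dsum.π L i) (dsum.map_π s i))
    (fun i => mappingCone.map _ _ (dsum.ι K i) (dsum.ι L i) (dsum.ι_map s i).symm) n
    (fun x => ?_) h
  obtain ⟨s₁, h₁⟩ := dsum.exists_support (n + 1) (((mappingCone.fst (dsum.map s)).1.v n (n + 1) rfl).hom x)
  obtain ⟨s₂, h₂⟩ := dsum.exists_support n (((mappingCone.snd (dsum.map s)).v n n (add_zero n)).hom x)
  classical
  refine ⟨s₁ ∪ s₂, ?_⟩
  have e1 := dsum.sum_π_ι (n + 1) _ (s₁ ∪ s₂) fun i hi => h₁ i (by simp_all)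
  have e2 := dsum.sum_π_ι n _ (s₁ ∪ s₂) fun i hi => h₂ i (by simp_all)
  have e3 : x = ((mappingCone.inl (dsum.map s)).v (n + 1) n (by omega)).hom
        (((mappingCone.fst (dsum.map s)).1.v n (n + 1) rfl).hom x) +
      ((mappingCone.inr (dsum.map s)).f n).hom
        (((mappingCone.snd (dsum.map s)).v n n (add_zero n)).hom x) :=
    (congrArg (fun t => t.hom x) (mappingCone.id_X (dsum.map s) n (n + 1) rfl)).symm
  refine Eq.trans ?_ e3.symm
  rw [← e1, ← e2, map_sum, map_sum, ← Finset.sum_add_distrib]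
  refine Finset.sum_congr rfl fun i _ => ?_
  have e4 : (mappingCone.map _ _ (dsum.π K i) (dsum.π L i) (dsum.map_π s i) ≫
      mappingCone.map _ _ (dsum.ι K i) (dsum.ι L i) (dsum.ι_map s i).symm).f n =
      (mappingCone.fst (dsum.map s)).1.v n (n + 1) rfl ≫ (dsum.π K i ≫ dsum.ι K i).f (n + 1) ≫
        (mappingCone.inl (dsum.map s)).v (n + 1) n (by omega) +
      (mappingCone.snd (dsum.map s)).v n n (add_zero n) ≫ (dsum.π L i ≫ dsum.ι L i).f n ≫
        (mappingCone.inr (dsum.map s)).f n := by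
    rw [HomologicalComplex.comp_f, cone_map_apply, cone_map_apply]
    simp
  exact congrArg (fun t => t.hom x) e4

variable [HasDerivedCategory.{w} (ModuleCat.{u} R)]

lemma isZero_iff_van (X : DerivedCategory (ModuleCat.{u} R)) :
    IsZero X ↔ ∀ n, Van (reg R) X n := by
  constructor
  · intro h n
    exact (van_iff _ _ _).2 fun f => (((shiftFunctor _ n).map_isZero h)).eq_of_tgt _ _
  · intro h
    have h1 : X.IsGE 0 := (reg_isGE_iff _ _).2 fun i _ => h i
    have h2 : X.IsLE (-1) := (reg_isLE_iff _ _).2 fun i _ => h i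
    exact TStructure.t.isZero X (-1) 0 (by omega)

lemma isZero_Q_iff (L : CochainComplex (ModuleCat.{u} R) ℤ) :
    IsZero (Q.obj L) ↔ ∀ n, L.ExactAt n := by
  rw [isZero_iff_van]
  exact forall_congr' fun n => van_reg_Q_iff L n

lemma isIso_Q_iff {M N : CochainComplex (ModuleCat.{u} R) ℤ} (f : M ⟶ N) :
    IsIso (Q.map f) ↔ ∀ n, (mappingCone f).ExactAt n := by
  rw [← isZero_Q_iff]
  exact (Triangle.isZero₃_iff_isIso₁ _ (mappingCone_triangle_distinguished f)).symm

lemma isIso_dsum_map (s : ∀ i, K i ⟶ L i) (h : ∀ i, IsIso (Q.map (s i))) :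
    IsIso (Q.map (dsum.map s)) :=
  (isIso_Q_iff _).2 fun n => exactAt_cone_dsum s n fun i => (isIso_Q_iff _).1 (h i) n

lemma exists_precomp_homotopy {M N : CochainComplex (ModuleCat.{u} R) ℤ} (b : M ⟶ N)
    (hb : Q.map b = 0) : ∃ (M' : CochainComplex (ModuleCat.{u} R) ℤ) (s : M' ⟶ M),
      IsIso (Q.map s) ∧ Nonempty (Homotopy (s ≫ b) 0) := by
  have h : Qh.map ((HomotopyCategory.quotient _ _).map b) =
      Qh.map ((HomotopyCategory.quotient _ _).map 0) := by
    have h' := (quotientCompQhIso (ModuleCat.{u} R)).hom.naturality b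
    rw [hb, comp_zero] at h'
    rw [Functor.map_zero, Functor.map_zero,
      ← cancel_mono ((quotientCompQhIso (ModuleCat.{u} R)).hom.app N), zero_comp]
    exact h'
  rw [MorphismProperty.map_eq_iff_precomp Qh (HomotopyCategory.quasiIso _ (.up ℤ))] at h
  obtain ⟨M', s, hs, fac⟩ := h
  obtain ⟨M', rfl⟩ := HomotopyCategory.quotient_obj_surjective M'
  obtain ⟨s, rfl⟩ := (HomotopyCategory.quotient _ _).map_surjective s
  refine ⟨M', s, ?_, ?_⟩
  · rw [isIso_Q_map_iff_quasiIso]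
    rwa [HomotopyCategory.quotient_map_mem_quasiIso_iff, HomologicalComplex.mem_quasiIso_iff] at hs
  · rw [← HomotopyCategory.quotient_map_eq_zero_iff, Functor.map_comp, fac, Functor.map_zero,
      comp_zero]

lemma isZero_Q_dsum (h : ∀ i, IsZero (Q.obj (K i))) : IsZero (Q.obj (dsum K)) := by
  rw [isZero_Q_iff]
  intro n
  refine exactAt_of_decomp _ K (dsum.π K) (dsum.ι K) n (fun x => ?_) fun i =>
    (isZero_Q_iff _).1 (h i) n
  obtain ⟨s, hs⟩ := dsum.exists_support n x
  exact ⟨s, dsum.sum_π_ι n x s hs⟩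

lemma Q_desc_eq_zero {N : CochainComplex (ModuleCat.{u} R) ℤ} (f : ∀ i, K i ⟶ N)
    (hf : ∀ i, Q.map (f i) = 0) : Q.map (dsum.desc f) = 0 := by
  choose M s hs h using fun i => exists_precomp_homotopy (f i) (hf i)
  have := isIso_dsum_map s hs
  have h1 : ∀ i, ∃ e : mappingCone (𝟙 (M i)) ⟶ N, mappingCone.inr _ ≫ e = s i ≫ f i := fun i => by
    obtain ⟨z, hz⟩ := CochainComplex.HomComplex.Cochain.equivHomotopy _ _ (h i).some
    refine ⟨mappingCone.desc _ z (s i ≫ f i) ?_, mappingCone.inr_desc _ _ _ _⟩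
    rw [Category.id_comp, hz, CochainComplex.HomComplex.Cochain.ofHom_zero, add_zero]
  choose e he using h1
  have h2 : dsum.map s ≫ dsum.desc f = dsum.map (fun i => mappingCone.inr (𝟙 (M i))) ≫
      dsum.desc e := by
    refine dsum.hom_ext fun i => ?_
    rw [← Category.assoc, dsum.ι_map, ← Category.assoc, dsum.ι_map, Category.assoc, Category.assoc,
      dsum.ι_desc, dsum.ι_desc, he]
  rw [← cancel_epi (Q.map (dsum.map s)), ← Functor.map_comp, h2, Functor.map_comp, comp_zero]
  have h3 : IsZero (Q.obj (dsum fun i => mappingCone (𝟙 (M i)))) := isZero_Q_dsum fun i =>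
    Triangle.isZero₃_of_isIso₁ _ (mappingCone_triangle_distinguished (𝟙 (M i)))
      (inferInstanceAs (IsIso (Q.map (𝟙 (M i)))))
  rw [h3.eq_of_tgt (Q.map (dsum.map fun i => mappingCone.inr (𝟙 (M i)))) 0, zero_comp]

lemma Q_dsum_hom_ext {Y : DerivedCategory (ModuleCat.{u} R)} {f g : Q.obj (dsum K) ⟶ Y}
    (h : ∀ i, Q.map (dsum.ι K i) ≫ f = Q.map (dsum.ι K i) ≫ g) : f = g := by
  rw [← sub_eq_zero]
  obtain ⟨L, ⟨e⟩⟩ := exists_iso_Q Y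
  obtain ⟨L', a, t, ht, h'⟩ := left_fac ((f - g) ≫ e.hom)
  have h0 : ∀ i, Q.map (dsum.ι K i ≫ a) = 0 := fun i => by
    have h1 : Q.map (dsum.ι K i) ≫ ((f - g) ≫ e.hom) = 0 := by
      rw [Preadditive.sub_comp, Preadditive.comp_sub, ← Category.assoc, h, Category.assoc, sub_self]
    rw [h', ← Category.assoc, ← Functor.map_comp] at h1
    rw [← cancel_mono (inv (Q.map t)), h1, zero_comp]
  have h1 := Q_desc_eq_zero _ h0
  have h2 : dsum.desc (fun i => dsum.ι K i ≫ a) = a := dsum.hom_ext fun i => dsum.ι_desc _ _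
  rw [h2] at h1
  rw [← cancel_mono e.hom, h', h1, zero_comp, zero_comp]

lemma exists_Q_desc {Y : DerivedCategory (ModuleCat.{u} R)} (g : ∀ i, Q.obj (K i) ⟶ Y) :
    ∃ f : Q.obj (dsum K) ⟶ Y, ∀ i, Q.map (dsum.ι K i) ≫ f = g i := by
  obtain ⟨L, ⟨e⟩⟩ := exists_iso_Q Y
  choose M s hs a h using fun i => right_fac (g i ≫ e.hom)
  have := isIso_dsum_map s hs
  refine ⟨inv (Q.map (dsum.map s)) ≫ Q.map (dsum.desc a) ≫ e.inv, fun i => ?_⟩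
  rw [← cancel_mono e.hom, h, ← cancel_epi (Q.map (s i)), IsIso.hom_inv_id_assoc, Category.assoc,
    Category.assoc, Category.assoc, e.inv_hom_id, Category.comp_id, ← Category.assoc,
    ← Functor.map_comp, ← dsum.ι_map, Functor.map_comp, Category.assoc, IsIso.hom_inv_id_assoc,
    ← Functor.map_comp, dsum.ι_desc]

/-- Compact objects: maps to a direct sum factor through a finite part. -/
def Compact (X : DerivedCategory (ModuleCat.{u} R)) : Prop :=
  ∀ (I : Type u) (K : I → CochainComplex (ModuleCat.{u} R) ℤ) (f : X ⟶ Q.obj (dsum K)),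
    ∃ s : Finset I, ∑ i ∈ s, f ≫ Q.map (dsum.π K i) ≫ Q.map (dsum.ι K i) = f

lemma Compact.of_iso {X Y : DerivedCategory (ModuleCat.{u} R)} (e : X ≅ Y) (h : Compact X) :
    Compact Y := fun I K f => by
  obtain ⟨s, hs⟩ := h I K (e.hom ≫ f)
  refine ⟨s, ?_⟩
  rw [← cancel_epi e.hom, Preadditive.comp_sum]
  simpa using hs

lemma IsPerf.compact {m : ℕ} {P : CochainComplex (ModuleCat.{u} R) ℤ} (hP : IsPerf m P) :
    Compact (Q.obj P) := fun I K f => by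
  classical
  have := hP.isKProjective
  obtain ⟨φ, rfl⟩ := Q_map_surjective f
  have h1 : ∀ n : ℤ, ∃ s : Finset I, ∀ i ∉ s, ∀ x, (((φ ≫ dsum.π K i).f n).hom x) = 0 := by
    intro n
    obtain ⟨g, hg⟩ := (hP.fp n).2.fg_top
    choose t ht using fun x : P.X n => dsum.exists_support n ((φ.f n).hom x)
    refine ⟨g.biUnion t, fun i hi x => ?_⟩
    have h2 : (⊤ : Submodule R (P.X n)) ≤ LinearMap.ker ((φ ≫ dsum.π K i).f n).hom := by
      rw [← hg, Submodule.span_le]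
      intro y hy
      exact ht y i fun h => hi (Finset.mem_biUnion.2 ⟨y, hy, h⟩)
    exact h2 (Submodule.mem_top (x := x))
  choose s hs using h1
  refine ⟨(Finset.Icc (-m : ℤ) m).biUnion s, ?_⟩
  simp only [← Functor.map_comp, ← Functor.map_sum]
  congr 1
  ext1 n
  by_cases hn : n < -m ∨ m < n
  · exact (hP.zero n hn).eq_of_src _ _
  · ext x
    have e := map_sum (HomologicalComplex.Hom.fAddMonoidHom (C₁ := P) (C₂ := dsum K) n)
      (fun i => φ ≫ dsum.π K i ≫ dsum.ι K i) ((Finset.Icc (-m : ℤ) m).biUnion s)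
    refine (congrArg (fun t => t.hom x) e).trans ?_
    rw [ModuleCat.hom_sum, LinearMap.sum_apply]
    refine dsum.sum_π_ι n ((φ.f n).hom x) _ fun i hi => hs n i (fun h => hi ?_) x
    exact Finset.mem_biUnion.2 ⟨n, Finset.mem_Icc.2 (by omega), h⟩

end Sum

section Equiv

variable {R S : Type u} [Ring R] [Ring S] [HasDerivedCategory.{w} (ModuleCat.{u} R)]
  [HasDerivedCategory.{w'} (ModuleCat.{u} S)]
  (F : DerivedCategory (ModuleCat.{u} R) ≌ DerivedCategory (ModuleCat.{u} S))

lemma Compact.map [F.functor.Additive] {X : DerivedCategory (ModuleCat.{u} R)}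
    (h : Compact X) : Compact (F.functor.obj X) := fun I M f => by
  choose K e using fun i => exists_iso_Q (F.inverse.obj (Q.obj (M i)))
  let ε : ∀ i, F.functor.obj (Q.obj (K i)) ≅ Q.obj (M i) := fun i =>
    F.functor.mapIso (e i).some.symm ≪≫ F.counitIso.app _
  obtain ⟨b, hb⟩ := exists_Q_desc (K := M) (Y := F.functor.obj (Q.obj (dsum K)))
    fun i => (ε i).inv ≫ F.functor.map (Q.map (dsum.ι K i))
  obtain ⟨a, ha⟩ := exists_Q_desc (K := K) (Y := F.inverse.obj (Q.obj (dsum M)))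
    fun i => (e i).some.inv ≫ F.inverse.map (Q.map (dsum.ι M i))
  let a' : F.functor.obj (Q.obj (dsum K)) ⟶ Q.obj (dsum M) := F.functor.map a ≫ F.counit.app _
  have ha' : ∀ i, F.functor.map (Q.map (dsum.ι K i)) ≫ a' = (ε i).hom ≫ Q.map (dsum.ι M i) :=
    fun i => by
      dsimp only [a', ε]
      rw [← Category.assoc, ← Functor.map_comp, ha]
      simp
  have hba : b ≫ a' = 𝟙 _ := Q_dsum_hom_ext fun i => by
    rw [← Category.assoc, hb, Category.assoc, ha', Iso.inv_hom_id_assoc, Category.comp_id]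
  clear_value a'
  obtain ⟨g, hg⟩ := F.functor.map_surjective (f ≫ b)
  obtain ⟨s, hs⟩ := h I K g
  let c : ∀ i, F.functor.obj X ⟶ Q.obj (M i) := fun i =>
    F.functor.map (g ≫ Q.map (dsum.π K i)) ≫ (ε i).hom
  have hf : f = ∑ i ∈ s, c i ≫ Q.map (dsum.ι M i) := by
    have h1 : f = F.functor.map g ≫ a' := by rw [hg, Category.assoc, hba, Category.comp_id]
    rw [h1, ← hs, Functor.map_sum, Preadditive.sum_comp]
    refine Finset.sum_congr rfl fun i _ => ?_
    dsimp only [c]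
    rw [Category.assoc, ← ha', ← Category.assoc, ← Category.assoc, ← Functor.map_comp,
]
  refine ⟨s, ?_⟩
  conv_rhs => rw [hf]
  refine Finset.sum_congr rfl fun j hj => ?_
  rw [← Category.assoc]
  congr 1
  rw [hf, Preadditive.sum_comp, Finset.sum_eq_single_of_mem j hj]
  · rw [Category.assoc, ← Functor.map_comp, dsum.ι_π, CategoryTheory.Functor.map_id, Category.comp_id]
  · intro i _ hij
    rw [Category.assoc, ← Functor.map_comp, dsum.ι_π_ne hij, Functor.map_zero, comp_zero]

end Equiv

end DerEq

namespace DerEq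

open CategoryTheory Limits Pretriangulated Triangulated DerivedCategory HomologicalComplex

universe v w w'

lemma noeth_of_semilinear {R S M N N' : Type*} [Ring R] [Ring S] [AddCommGroup M] [Module R M]
    [AddCommGroup N] [Module S N] [AddCommGroup N'] [Module R N'] [IsNoetherian R N']
    (σ : R → S) (φ : M →+ N) (hφ : Function.Surjective φ) (h : ∀ r m, φ (r • m) = σ r • φ m)
    (u : M →ₗ[R] N') (hu : ∀ m, u m = 0 → φ m = 0) : IsNoetherian S N := by
  let ψ (W : Submodule S N) : Submodule R M :=
    { carrier := {m | φ m ∈ W}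
      add_mem' := fun {a b} ha hb => by
        change φ (a + b) ∈ W
        rw [map_add]
        exact W.add_mem ha hb
      zero_mem' := by
        change φ 0 ∈ W
        rw [map_zero]
        exact W.zero_mem
      smul_mem' := fun r m hm => by
        change φ (r • m) ∈ W
        rw [h]
        exact W.smul_mem _ hm }
  have hψ : StrictMono fun W => (ψ W).map u := by
    intro W W' hW
    refine lt_of_le_of_ne (Submodule.map_mono fun m hm => hW.le hm) fun he => ?_
    obtain ⟨w, hw', hw⟩ := SetLike.exists_of_lt hW
    obtain ⟨m, rfl⟩ := hφ w
    have hm : u m ∈ (ψ W').map u := ⟨m, hw', rfl⟩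
    rw [← show (ψ W).map u = (ψ W').map u from he] at hm
    obtain ⟨m', hm', e⟩ := hm
    have h0 : φ (m - m') = 0 := hu _ (by rw [map_sub, e, sub_self])
    rw [map_sub, sub_eq_zero] at h0
    exact hw (h0 ▸ hm')
  rw [isNoetherian_iff']
  exact hψ.wellFoundedGT

section Mod

variable {R : Type u} [Ring R]

/-- The chain map from the regular module given by a cocycle. -/
noncomputable def fromReg (L : CochainComplex (ModuleCat.{u} R) ℤ) (n : ℤ) (z : L.X n)
    (hz : (L.d n (n + 1)).hom z = 0) :
    (single (ModuleCat.{u} R) (.up ℤ) n).obj (ModuleCat.of R R) ⟶ L :=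
  mkHomFromSingle (ModuleCat.ofHom (LinearMap.toSpanSingleton R (L.X n) z)) (by
    intro k hk
    obtain rfl : n + 1 = k := hk
    ext
    exact (congrArg (L.d n (n + 1)).hom (one_smul R z)).trans hz)

lemma fromReg_f (L : CochainComplex (ModuleCat.{u} R) ℤ) (n : ℤ) (z : L.X n)
    (hz : (L.d n (n + 1)).hom z = 0) : (fromReg L n z hz).f n =
      (singleObjXSelf (.up ℤ) n (ModuleCat.of R R)).hom ≫
        ModuleCat.ofHom (LinearMap.toSpanSingleton R (L.X n) z) := mkHomFromSingle_f _ _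

lemma fromReg_surjective {L : CochainComplex (ModuleCat.{u} R) ℤ} {n : ℤ}
    (f : (single (ModuleCat.{u} R) (.up ℤ) n).obj (ModuleCat.of R R) ⟶ L) :
    ∃ z hz, fromReg L n z hz = f := by
  have h := f.comm n (n + 1)
  rw [((isZero_single_obj_X (.up ℤ) n (ModuleCat.of R R) (n + 1) (by omega)).eq_of_tgt
    (((single (ModuleCat.{u} R) (.up ℤ) n).obj (ModuleCat.of R R)).d n (n + 1)) 0), zero_comp] at h
  refine ⟨(f.f n).hom ((singleObjXSelf (.up ℤ) n (ModuleCat.of R R)).inv.hom (1 : R)),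
    congrArg (fun t => t.hom ((singleObjXSelf (.up ℤ) n (ModuleCat.of R R)).inv.hom (1 : R))) h, from_single_hom_ext ?_⟩
  rw [fromReg_f, ← cancel_epi (singleObjXSelf (.up ℤ) n (ModuleCat.of R R)).inv,
    Iso.inv_hom_id_assoc]
  ext
  exact one_smul R _

lemma fromReg_add (L : CochainComplex (ModuleCat.{u} R) ℤ) (n : ℤ) (z z' : L.X n) (hz hz' h) :
    fromReg L n (z + z') h = fromReg L n z hz + fromReg L n z' hz' := by
  refine from_single_hom_ext ?_
  rw [add_f_apply, fromReg_f, fromReg_f, fromReg_f, ← Preadditive.comp_add]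
  congr 1
  ext
  exact (one_smul R _).trans (congrArg₂ (· + ·) (one_smul R _) (one_smul R _)).symm

lemma fromReg_smul (L : CochainComplex (ModuleCat.{u} R) ℤ) (n : ℤ) (r : R) (z : L.X n) (hz h) :
    fromReg L n (r • z) h =
      (single (ModuleCat.{u} R) (.up ℤ) n).map (rmul r) ≫ fromReg L n z hz := by
  refine from_single_hom_ext ?_
  rw [comp_f, fromReg_f, fromReg_f, single_map_f_self, Category.assoc, Category.assoc,
    Iso.inv_hom_id_assoc]
  congr 1
  ext
  refine (one_smul R _).trans ?_
  change r • z = ((1 : R) • r) • z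
  rw [smul_eq_mul, one_mul]

variable [HasDerivedCategory.{w} (ModuleCat.{u} R)]

lemma Q_fromReg_boundary (L : CochainComplex (ModuleCat.{u} R) ℤ) (y : L.X (-1)) (h) :
    Q.map (fromReg L 0 ((L.d (-1) 0).hom y) h) = 0 := by
  let g (i j : ℤ) (_ : (ComplexShape.up ℤ).Rel j i) :
      ((single (ModuleCat.{u} R) (.up ℤ) 0).obj (ModuleCat.of R R)).X i ⟶ L.X j :=
    if hh : i = 0 ∧ j = -1 then (XIsoOfEq _ hh.1).hom ≫
      (singleObjXSelf (.up ℤ) 0 (ModuleCat.of R R)).hom ≫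
        ModuleCat.ofHom (LinearMap.toSpanSingleton R (L.X (-1)) y) ≫ (XIsoOfEq L hh.2).inv else 0
  have e : fromReg L 0 ((L.d (-1) 0).hom y) h = Homotopy.nullHomotopicMap' g := by
    refine from_single_hom_ext ?_
    rw [fromReg_f, Homotopy.nullHomotopicMap'_f (k₂ := -1) (k₁ := 0) (k₀ := 1) (by simp) (by simp)]
    have h1 : g 1 0 (by simp) = 0 := dif_neg (by omega)
    have h2 : g 0 (-1) (by simp) = (singleObjXSelf (.up ℤ) 0 (ModuleCat.of R R)).hom ≫
        ModuleCat.ofHom (LinearMap.toSpanSingleton R (L.X (-1)) y) := by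
      refine (dif_pos ⟨rfl, rfl⟩).trans ?_
      simp [XIsoOfEq]
    rw [h1, h2, comp_zero, zero_add, Category.assoc]
    congr 1
    ext
    exact (one_smul R _).trans (congrArg (L.d (-1) 0).hom (one_smul R y)).symm
  rw [e, Q_map_eq_of_homotopy _ (Homotopy.nullHomotopy' g), Functor.map_zero]

lemma noeth_coh_zero (L : CochainComplex (ModuleCat.{u} R) ℤ) {N : Type*} [AddCommGroup N]
    [Module R N] [IsNoetherian R N] (u : LinearMap.ker (L.d 0 (0 + 1)).hom →ₗ[R] N)
    (hu : ∀ z, u z = 0 → ∃ y, (L.d (-1) 0).hom y = z.1) :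
    IsNoetherian (End (reg R))ᵐᵒᵖ (coh (reg R) (Q.obj L) 0) := by
  let φ : LinearMap.ker (L.d 0 (0 + 1)).hom →+ (reg R ⟶ Q.obj L) :=
    AddMonoidHom.mk' (fun z => Q.map (fromReg L 0 z.1 z.2)) fun z z' => by
      exact (congrArg Q.map (fromReg_add L 0 z.1 z'.1 z.2 z'.2 _)).trans (Functor.map_add _)
  have : IsNoetherian (End (reg R))ᵐᵒᵖ (reg R ⟶ Q.obj L) := by
    refine noeth_of_semilinear (fun r => regEnd r) φ (fun f => ?_) (fun r z => ?_) u fun z hz => ?_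
    · obtain ⟨g, rfl⟩ := Q_map_surjective
        (K := (CochainComplex.singleFunctor (ModuleCat.{u} R) 0).obj (ModuleCat.of R R)) f
      obtain ⟨z, hz, rfl⟩ := fromReg_surjective g
      exact ⟨⟨z, hz⟩, rfl⟩
    · refine (congrArg Q.map (fromReg_smul L 0 r z.1 z.2 _)).trans ?_
      exact Functor.map_comp _ _ _
    · obtain ⟨y, hy⟩ := hu z hz
      obtain ⟨z, hz'⟩ := z
      obtain rfl : _ = z := hy
      exact Q_fromReg_boundary L y hz'
  exact isNoetherian_of_linearEquiv (cohZero (reg R) (Q.obj L)).symm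

lemma noeth_coh_of_shift (L : CochainComplex (ModuleCat.{u} R) ℤ) (n : ℤ)
    (h : IsNoetherian (End (reg R))ᵐᵒᵖ (coh (reg R) (Q.obj (L⟦n⟧)) 0)) :
    IsNoetherian (End (reg R))ᵐᵒᵖ (coh (reg R) (Q.obj L) n) := by
  have h0 : IsNoetherian (End (reg R))ᵐᵒᵖ
    (coh (reg R) ((shiftFunctor (CochainComplex (ModuleCat.{u} R) ℤ) n ⋙ Q).obj L) 0) := h
  have h1 : IsNoetherian (End (reg R))ᵐᵒᵖ (coh (reg R) ((Q.obj L)⟦n⟧) 0) :=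
    isNoetherian_of_linearEquiv (cohIso (reg R) ((Q.commShiftIso n).app L) 0)
  exact isNoetherian_of_linearEquiv (cohShift (reg R) (Q.obj L) n 0 n (by omega))

/-- The cohomology of a complex, as a submodule of the cokernel of the differential. -/
def cohSub (L : CochainComplex (ModuleCat.{u} R) ℤ) :
    Submodule R (L.X 0 ⧸ LinearMap.range (L.d (-1) 0).hom) :=
  (LinearMap.ker (L.d 0 (0 + 1)).hom).map (LinearMap.range (L.d (-1) 0).hom).mkQ

lemma noeth_coh_of_cohSub (L : CochainComplex (ModuleCat.{u} R) ℤ) [IsNoetherian R (cohSub L)] :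
    IsNoetherian (End (reg R))ᵐᵒᵖ (coh (reg R) (Q.obj L) 0) := by
  have : IsNoetherian R ((LinearMap.ker (L.d 0 (0 + 1)).hom).map
    (LinearMap.range (L.d (-1) 0).hom).mkQ) := ‹IsNoetherian R (cohSub L)›
  refine noeth_coh_zero L (LinearMap.submoduleMap (LinearMap.range (L.d (-1) 0).hom).mkQ
    (LinearMap.ker (L.d 0 (0 + 1)).hom)) fun z hz => ?_
  have h1 : (LinearMap.range (L.d (-1) 0).hom).mkQ z.1 = 0 := congrArg Subtype.val hz
  rw [← LinearMap.mem_ker, Submodule.ker_mkQ] at h1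
  exact h1

lemma noeth_coh_of_finite [IsNoetherianRing R] (L : CochainComplex (ModuleCat.{u} R) ℤ)
    (hL : ∀ n, Module.Finite R (L.X n)) (n : ℤ) :
    IsNoetherian (End (reg R))ᵐᵒᵖ (coh (reg R) (Q.obj L) n) := by
  refine noeth_coh_of_shift L n ?_
  have : Module.Finite R ((L⟦n⟧).X 0) := hL (0 + n)
  exact noeth_coh_of_cohSub _

end Mod

end DerEq

namespace DerEq

open CategoryTheory Limits Pretriangulated Triangulated DerivedCategory HomologicalComplex

universe v w w'

section Test

variable (k : Type u) [Field k] {A : Type u} [Ring A] [Algebra k A]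

/-- The `A`-linear map to the dual of `A` given by a functional. -/
def toDual {C : Type*} [AddCommGroup C] [Module k C] [Module A C] [IsScalarTower k A C]
    (φ : C →ₗ[k] k) : C →ₗ[A] Module.Dual k A where
  toFun c := φ ∘ₗ (LinearMap.toSpanSingleton A C c).restrictScalars k
  map_add' c c' := by
    ext a
    change φ (a • (c + c')) = φ (a • c) + φ (a • c')
    rw [smul_add, map_add]
  map_smul' b c := by
    ext a
    change φ (a • b • c) = φ ((a * b) • c)
    rw [mul_smul]

lemma toDual_apply {C : Type*} [AddCommGroup C] [Module k C] [Module A C] [IsScalarTower k A C]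
    (φ : C →ₗ[k] k) (c : C) (a : A) : toDual k φ c a = φ (a • c) := rfl

lemma exists_test [Module.Finite k A] (C : Type u) [AddCommGroup C] [Module A C] :
    ∃ (J : Type u) (g : J → C →ₗ[A] Module.Dual k A),
      (∀ c, ∃ s : Finset J, ∀ j ∉ s, g j c = 0) ∧ (∀ c, (∀ j, g j c = 0) → c = 0) ∧
      ∀ (s : Finset J) (N : Submodule A C), (∀ c ∈ N, ∀ j ∉ s, g j c = 0) →
        IsNoetherian A N := by
  classical
  let : Module k C := Module.compHom C (algebraMap k A)
  have : IsScalarTower k A C := IsScalarTower.of_algebraMap_smul fun r x => rfl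
  let b := Module.Basis.ofVectorSpace k C
  refine ⟨_, fun j => toDual k (b.coord j), fun c => ?_, fun c hc => ?_, fun s N hN => ?_⟩
  · let a := Module.finBasis k A
    refine ⟨Finset.univ.biUnion fun i => (b.repr (a i • c)).support, fun j hj => ?_⟩
    refine a.ext fun i => ?_
    rw [toDual_apply]
    by_contra h
    exact hj (Finset.mem_biUnion.2 ⟨i, Finset.mem_univ _, Finsupp.mem_support_iff.2 h⟩)
  · rw [← b.repr.map_eq_zero_iff]
    ext j
    have := congrArg (fun t => t (1 : A)) (hc j)
    dsimp only at this
    rwa [toDual_apply, one_smul] at this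
  · have h1 : N.restrictScalars k ≤ Submodule.span k (s.image b : Finset C) := by
      intro c hc
      rw [← b.linearCombination_repr c, Finsupp.linearCombination_apply]
      refine Submodule.sum_mem _ fun j hj => Submodule.smul_mem _ _ (Submodule.subset_span ?_)
      rw [Finset.mem_coe, Finset.mem_image]
      refine ⟨j, ?_, rfl⟩
      by_contra h
      have := congrArg (fun t => t (1 : A)) (hN c hc j h)
      dsimp only at this
      rw [toDual_apply, one_smul] at this
      exact Finsupp.mem_support_iff.1 hj this
    have h2 : IsNoetherian k (Submodule.span k ((s.image b : Finset C) : Set C)) :=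
      isNoetherian_span_of_finite k (Finset.finite_toSet _)
    have h3 : IsNoetherian k (N.restrictScalars k) := isNoetherian_of_le h1
    have h4 : IsNoetherian k N := h3
    exact isNoetherian_of_tower k h4

end Test

end DerEq

namespace DerEq

open CategoryTheory Limits Pretriangulated Triangulated DerivedCategory HomologicalComplex

universe v w w'

lemma Compact.comp_eq_zero {R : Type u} [Ring R] [HasDerivedCategory.{w} (ModuleCat.{u} R)]
    {X : DerivedCategory (ModuleCat.{u} R)} (hX : Compact X) {I : Type u}
    {M : CochainComplex (ModuleCat.{u} R) ℤ} {K : I → CochainComplex (ModuleCat.{u} R) ℤ}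
    (f : ∀ i, M ⟶ K i)
    (hf : ∀ n (x : M.X n), ∃ s : Finset I, ∀ i ∉ s, ((f i).f n).hom x = 0)
    (c : X ⟶ Q.obj M) : ∃ s : Finset I, ∀ i ∉ s, c ≫ Q.map (f i) = 0 := by
  classical
  obtain ⟨s, hs⟩ := hX _ _ (c ≫ Q.map (dsum.lift f hf))
  refine ⟨s, fun i hi => ?_⟩
  rw [← dsum.lift_π f hf i, Functor.map_comp, ← Category.assoc, ← hs, Preadditive.sum_comp]
  refine Finset.sum_eq_zero fun j hj => ?_
  rw [Category.assoc, Category.assoc, Category.assoc, ← Functor.map_comp (Q) (dsum.ι _ j), dsum.ι_π_ne,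
    Functor.map_zero, comp_zero, comp_zero, comp_zero]
  rintro rfl
  exact hi hj

section Finite

variable {k : Type u} [Field k] {A : Type u} [Ring A] [Algebra k A]
  [HasDerivedCategory.{w} (ModuleCat.{u} A)]

/-- The morphism to a stalk complex given by a linear map on a cokernel. -/
noncomputable def toSingle (K : CochainComplex (ModuleCat.{u} A) ℤ) (M : ModuleCat.{u} A) (n : ℤ)
    (g : (K.X n ⧸ LinearMap.range (K.d (n - 1) n).hom) →ₗ[A] M) :
    K ⟶ (CochainComplex.singleFunctor (ModuleCat.{u} A) n).obj M :=
  mkHomToSingle (ModuleCat.ofHom (g ∘ₗ (LinearMap.range (K.d (n - 1) n).hom).mkQ)) (by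
    intro i hi
    obtain rfl : i = n - 1 := by
      have : i + 1 = n := hi
      omega
    ext x
    change g (Submodule.Quotient.mk ((K.d (n - 1) n).hom x)) = 0
    have h0 : (Submodule.Quotient.mk ((K.d (n - 1) n).hom x) :
        K.X n ⧸ LinearMap.range (K.d (n - 1) n).hom) = 0 :=
      (Submodule.Quotient.mk_eq_zero _).2 (LinearMap.mem_range_self _ x)
    rw [h0, map_zero])

lemma toSingle_f (K : CochainComplex (ModuleCat.{u} A) ℤ) (M : ModuleCat.{u} A) (n : ℤ)
    (g : (K.X n ⧸ LinearMap.range (K.d (n - 1) n).hom) →ₗ[A] M) :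
    (toSingle K M n g).f n =
      ModuleCat.ofHom (g ∘ₗ (LinearMap.range (K.d (n - 1) n).hom).mkQ) ≫
        (singleObjXSelf (.up ℤ) n M).inv :=
  mkHomToSingle_f _ _

lemma Q_toSingle_apply (K : CochainComplex (ModuleCat.{u} A) ℤ) (M : ModuleCat.{u} A) (n : ℤ)
    (g : (K.X n ⧸ LinearMap.range (K.d (n - 1) n).hom) →ₗ[A] M) (hg : Q.map (toSingle K M n g) = 0)
    (z : K.X n) (hz : (K.d n (n + 1)).hom z = 0) : g (Submodule.Quotient.mk z) = 0 := by
  have e : fromReg K n z hz ≫ toSingle K M n g =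
      (CochainComplex.singleFunctor (ModuleCat.{u} A) n).map (X := ModuleCat.of A A)
        (ModuleCat.ofHom (LinearMap.toSpanSingleton A M (g (Submodule.Quotient.mk z)))) := by
    refine from_single_hom_ext ?_
    rw [comp_f, fromReg_f, toSingle_f]
    refine Eq.trans ?_ (single_map_f_self (.up ℤ) n _).symm
    refine Eq.trans (Category.assoc _ _ _) (congrArg (_ ≫ ·) ?_)
    refine Eq.trans (Category.assoc _ _ _).symm (congrArg (· ≫ _) ?_)
    ext
    change g (Submodule.Quotient.mk ((1 : A) • z)) = (1 : A) • g (Submodule.Quotient.mk z)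
    rw [one_smul, one_smul]
  have h0 : (DerivedCategory.singleFunctor (ModuleCat.{u} A) n).map (X := ModuleCat.of A A)
        (ModuleCat.ofHom (LinearMap.toSpanSingleton A M (g (Submodule.Quotient.mk z)))) = 0 := by
    refine (congrArg Q.map e).symm.trans ?_
    rw [Functor.map_comp, hg, comp_zero]
    rfl
  have h1 := (DerivedCategory.singleFunctor (ModuleCat.{u} A) n).map_injective
    (h0.trans (Functor.map_zero _ _ _).symm)
  have h2 := congrArg (fun t => t.hom (1 : A)) h1
  exact (one_smul A _).symm.trans h2

variable (k)

lemma Compact.exists_finset [Module.Finite k A] {K : CochainComplex (ModuleCat.{u} A) ℤ}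
    (h : Compact (Q.obj K)) :
    (∃ s : Finset ℤ, ∀ n ∉ s, Van (reg A) (Q.obj K) n) ∧ IsNoetherian A (cohSub K) := by
  classical
  choose J g hfin hsep hnoeth using fun n =>
    exists_test k (A := A) (K.X n ⧸ LinearMap.range (K.d (n - 1) n).hom)
  let f : ∀ i : (Σ n, J n), K ⟶ (CochainComplex.singleFunctor (ModuleCat.{u} A) i.1).obj
    (ModuleCat.of A (Module.Dual k A)) := fun i => toSingle K _ i.1 (g i.1 i.2)
  have hf : ∀ n (x : K.X n), ∃ s : Finset (Σ n, J n), ∀ i ∉ s, ((f i).f n).hom x = 0 := by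
    intro n x
    obtain ⟨s, hs⟩ := hfin n (Submodule.Quotient.mk x)
    refine ⟨s.map ⟨Sigma.mk n, sigma_mk_injective⟩, fun i hi => ?_⟩
    by_cases hin : i.1 = n
    · obtain ⟨m, j⟩ := i
      obtain rfl : m = n := hin
      have h1 : j ∉ s := fun hj => hi (Finset.mem_map.2 ⟨j, hj, rfl⟩)
      have h2 := congrArg (fun t => t.hom x) (toSingle_f K (ModuleCat.of A (Module.Dual k A)) m (g m j))
      refine h2.trans ?_
      refine (congrArg (singleObjXSelf (.up ℤ) m (ModuleCat.of A (Module.Dual k A))).inv.hom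
        (hs j h1)).trans (map_zero _)
    · have h1 : (f i).f n = 0 := (isZero_single_obj_X (.up ℤ) i.1 _ n (Ne.symm hin)).eq_of_tgt _ _
      rw [h1]
      rfl
  obtain ⟨s, hs⟩ := h.comp_eq_zero f hf (𝟙 _)
  have hQ : ∀ i ∉ s, Q.map (f i) = 0 := fun i hi => (Category.id_comp _).symm.trans (hs i hi)
  constructor
  · refine ⟨s.image Sigma.fst, fun n hn => ?_⟩
    rw [van_reg_Q_iff, exactAt_iff]
    intro z hz
    have h1 : (Submodule.Quotient.mk z : K.X n ⧸ LinearMap.range (K.d (n - 1) n).hom) = 0 := by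
      refine hsep n _ fun j => Q_toSingle_apply K (ModuleCat.of A (Module.Dual k A)) n (g n j) (hQ ⟨n, j⟩ fun hj => hn ?_) z hz
      exact Finset.mem_image.2 ⟨_, hj, rfl⟩
    exact (Submodule.Quotient.mk_eq_zero _).1 h1
  · refine hnoeth 0 (s.preimage (Sigma.mk 0) sigma_mk_injective.injOn) (cohSub K) ?_
    rintro _ ⟨z, hz, rfl⟩ j hj
    exact Q_toSingle_apply K (ModuleCat.of A (Module.Dual k A)) 0 (g 0 j)
      (hQ ⟨0, j⟩ fun h => hj (Finset.mem_preimage.2 h)) z hz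

end Finite

end DerEq

namespace DerEq

open CategoryTheory Limits Pretriangulated Triangulated DerivedCategory HomologicalComplex

universe v w w'

section PD

variable {R : Type u} [Ring R] [HasDerivedCategory.{w} (ModuleCat.{u} R)]

lemma Compact.hasProjectiveDimensionLT {X L : DerivedCategory (ModuleCat.{u} R)}
    {N : ModuleCat.{u} R} (hX : Compact X) (i : L ⟶ X)
    (p : X ⟶ (singleFunctor (ModuleCat.{u} R) 0).obj N)
    (d : (singleFunctor (ModuleCat.{u} R) 0).obj N ⟶ L⟦(1 : ℤ)⟧)
    (hT : Triangle.mk i p d ∈ distTriang (DerivedCategory (ModuleCat.{u} R))) (c : ℤ)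
    (hL : ExtCl (reg R) {k | k < c} L) : ∃ m : ℕ, HasProjectiveDimensionLT N m := by
  classical
  have h0 : ∀ n : ℕ, ∃ (Y : ModuleCat.{u} R) (f : (singleFunctor (ModuleCat.{u} R) 0).obj N ⟶
      ((singleFunctor (ModuleCat.{u} R) 0).obj Y)⟦(n : ℤ)⟧), f = 0 →
      ∀ (Y' : ModuleCat.{u} R) (f' : (singleFunctor (ModuleCat.{u} R) 0).obj N ⟶
        ((singleFunctor (ModuleCat.{u} R) 0).obj Y')⟦(n : ℤ)⟧), f' = 0 := by
    intro n
    by_cases h : ∀ (Y' : ModuleCat.{u} R) (f' : (singleFunctor (ModuleCat.{u} R) 0).obj N ⟶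
        ((singleFunctor (ModuleCat.{u} R) 0).obj Y')⟦(n : ℤ)⟧), f' = 0
    · exact ⟨N, 0, fun _ => h⟩
    · push Not at h
      obtain ⟨Y, f, hf⟩ := h
      exact ⟨Y, f, fun h => absurd h hf⟩
  choose Y f hf using h0
  let P := projectiveResolution N
  have : P.cochainComplex.IsKProjective := CochainComplex.isKProjective_of_projective _ 0
  have hπ : IsIso (Q.map P.π') := isIso_Q_map_iff_quasiIso (φ := P.π') |>.2 inferInstance
  let eπ : Q.obj P.cochainComplex ≅ (singleFunctor (ModuleCat.{u} R) 0).obj N :=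
    @asIso _ _ _ _ (Q.map P.π') hπ
  let ε (n : ℕ) := ((singleFunctors (ModuleCat.{u} R)).shiftIso (n : ℤ) (-n) 0 (by omega)).app (Y n)
  have hg (n : ℕ) : ∃ g : P.cochainComplex ⟶
      (CochainComplex.singleFunctor (ModuleCat.{u} R) (-n)).obj (Y n),
      Q.map g = eπ.hom ≫ f n ≫ (ε n).hom := Q_map_surjective _
  choose g hg using hg
  let T (n : ULift.{u} ℕ) := (CochainComplex.singleFunctor (ModuleCat.{u} R) (-n.down)).obj (Y n.down)
  have hlf : ∀ n (x : P.cochainComplex.X n), ∃ s : Finset (ULift.{u} ℕ), ∀ i ∉ s,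
      (((fun i => g i.down : ∀ i, P.cochainComplex ⟶ T i) i).f n).hom x = 0 := by
    intro n x
    refine ⟨{⟨(-n).toNat⟩}, fun i hi => ?_⟩
    have h1 : (g i.down).f n = 0 := by
      refine (isZero_single_obj_X (.up ℤ) _ _ n fun h => hi ?_).eq_of_tgt _ _
      rw [Finset.mem_singleton]
      apply ULift.ext
      dsimp only
      omega
    change ((g i.down).f n).hom x = 0
    rw [h1]
    rfl
  obtain ⟨s, hs⟩ := hX.comp_eq_zero _ hlf (p ≫ eπ.inv)
  have hz : ∀ n : ℕ, ULift.up n ∉ s → p ≫ f n = 0 := by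
    intro n hn
    have h1 : (p ≫ eπ.inv) ≫ eπ.hom ≫ f n ≫ (ε n).hom = 0 :=
      (congrArg ((p ≫ eπ.inv) ≫ ·) (hg n)).symm.trans (hs ⟨n⟩ hn)
    rw [Category.assoc, Iso.inv_hom_id_assoc, ← Category.assoc] at h1
    exact (cancel_mono (ε n).hom).1 (h1.trans zero_comp.symm)
  have hz' : ∀ n : ℕ, ULift.up n ∉ s → c < n → f n = 0 := by
    intro n hn hc
    obtain ⟨ψ, hψ⟩ : ∃ ψ : L⟦(1 : ℤ)⟧ ⟶ ((singleFunctor (ModuleCat.{u} R) 0).obj (Y n))⟦(n : ℤ)⟧,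
      f n = d ≫ ψ := Triangle.yoneda_exact₃ _ hT (f n) (hz n hn)
    have h1 : ψ = 0 := by
      refine (hL.shift 1 {k | k < c + 1} fun k hk => ?_).hom_eq_zero (fun k hk => ?_) ψ
      · exact Int.add_lt_add_right hk 1
      · have hk' : k < c + 1 := hk
        exact van_emb n (Y n) _ (by omega)
    rw [hψ, h1, comp_zero]
  let : HasExt.{w} (ModuleCat.{u} R) := hasExt_of_hasDerivedCategory _
  refine ⟨s.sup ULift.down + c.toNat + 1, ?_⟩
  rw [hasProjectiveDimensionLT_iff]
  intro i hi W e
  have h1 : Abelian.Ext.homAddEquiv e = 0 := hf i (hz' i (fun hs => ?_) (by omega)) W _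
  · exact (AddEquiv.map_eq_zero_iff _).1 h1
  · have := Finset.le_sup (f := ULift.down) hs
    dsimp only at this
    omega

lemma perf_of_pd [IsNoetherianRing R] (m : ℕ) (N : ModuleCat.{u} R) [Module.Finite R N]
    (h : HasProjectiveDimensionLT N m) : Perf ((singleFunctor (ModuleCat.{u} R) 0).obj N) := by
  induction m generalizing N with
  | zero => exact Perf.single (FP.of_isZero (isZero_of_hasProjectiveDimensionLT_zero N))
  | succ m ih =>
    rcases m with _ | m
    · have h1 : Projective N := projective_iff_hasProjectiveDimensionLT_one.2 h
      exact Perf.single ⟨h1, inferInstance⟩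
    · obtain ⟨r, f, hf⟩ := Module.Finite.exists_fin' R N
      let F : ModuleCat.{u} R := ModuleCat.of R (Fin r → R)
      let S : ShortComplex (ModuleCat.{u} R) := ShortComplex.mk
        (ModuleCat.ofHom (LinearMap.ker f).subtype) (ModuleCat.ofHom (X := Fin r → R) f) (by
          ext x
          exact x.2)
      have hS : S.ShortExact := by
        have := (ModuleCat.mono_iff_injective S.f).2 Subtype.val_injective
        have := (ModuleCat.epi_iff_surjective S.g).2 hf
        refine ShortComplex.ShortExact.mk ((ShortComplex.moduleCat_exact_iff S).2 fun x hx => ?_)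
        exact ⟨⟨x, hx⟩, rfl⟩
      have hF : FP S.X₂ := by
        refine ⟨(IsProjective.iff_projective _).1 (inferInstanceAs (Module.Projective R (Fin r → R))), ?_⟩
        exact inferInstanceAs (Module.Finite R (Fin r → R))
      have := hF.1
      have h3 : Module.Finite R S.X₁ := inferInstanceAs (Module.Finite R (LinearMap.ker f))
      have h1 := ih S.X₁ (hS.hasProjectiveDimensionLT_X₁ (m + 1) inferInstance h)
      exact Perf.ext₃ _ hS.singleTriangle_distinguished h1 (Perf.single hF)

end PD

section Main

lemma Compact.shift {R : Type u} [Ring R] [HasDerivedCategory.{w} (ModuleCat.{u} R)]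
    {X : DerivedCategory (ModuleCat.{u} R)} (hX : Compact X) (i : ℤ) : Compact (X⟦i⟧) :=
  by
  have : (shiftEquiv (DerivedCategory (ModuleCat.{u} R)) i).functor.Additive :=
    inferInstanceAs (shiftFunctor (DerivedCategory (ModuleCat.{u} R)) i).Additive
  exact Compact.map (shiftEquiv (DerivedCategory (ModuleCat.{u} R)) i) hX

variable (k : Type u) [Field k] {A : Type u} [Ring A] [Algebra k A] [Module.Finite k A]
  [HasDerivedCategory.{w} (ModuleCat.{u} A)]

include k in
lemma Compact.perf {X : DerivedCategory (ModuleCat.{u} A)} (hX : Compact X) : Perf X := by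
  have : IsNoetherianRing A := isNoetherian_of_tower k (inferInstanceAs (IsNoetherian k A))
  obtain ⟨K, ⟨e⟩⟩ := exists_iso_Q X
  have hK : Compact (Q.obj K) := hX.of_iso e
  obtain ⟨⟨s, hs⟩, -⟩ := hK.exists_finset k
  have hn (n : ℤ) : IsNoetherian (End (reg A))ᵐᵒᵖ (coh (reg A) (Q.obj K) n) := by
    have := ((hK.shift n).of_iso ((Q.commShiftIso n).app K).symm).exists_finset k |>.2
    exact noeth_coh_of_shift K n (noeth_coh_of_cohSub (K⟦n⟧))
  refine Perf.of_iso e.symm ?_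
  clear e hX
  generalize Q.obj K = X at *
  let b := s.sup Int.natAbs
  have hb : ∀ n : ℤ, b < n.natAbs → Van (reg A) X n := fun n hn => hs n fun h => by
    have := Finset.le_sup (f := Int.natAbs) h
    omega
  have h1 : ∀ j, (0 : ℤ) + (2 * b : ℕ) < j → Van (reg A) (X⟦-(b : ℤ)⟧) j := fun j hj =>
    (van_shift_iff _ _ _ j (-b + j) rfl).2 (hb _ (by omega))
  have h2 : ∀ j, IsNoetherian (End (reg A))ᵐᵒᵖ (coh (reg A) (X⟦-(b : ℤ)⟧) j) := fun j => by
    have := hn (-b + j)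
    exact isNoetherian_of_linearEquiv (cohShift (reg A) X (-b) j (-b + j) rfl).symm
  obtain ⟨L, E, i, p, d, hT, hL, hE, hE', hE''⟩ := exists_approx (reg A) van_reg_self 0 (2 * b) _ h1 h2
  obtain ⟨N, hN, ⟨e⟩⟩ := exists_heart 0 E (fun j hj => by
    rcases lt_or_gt_of_ne hj with h | h
    · exact hE' j (by omega) ((van_shift_iff _ _ _ j (-b + j) rfl).2 (hb _ (by omega)))
    · exact hE j (by omega)) hE''
  let e' : E ≅ (singleFunctor (ModuleCat.{u} A) 0).obj N :=
    e ≪≫ (shiftFunctorZero (DerivedCategory (ModuleCat.{u} A)) ℤ).app _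
  have hT' : Triangle.mk i (p ≫ e'.hom) (e'.inv ≫ d) ∈
      distTriang (DerivedCategory (ModuleCat.{u} A)) := by
    refine isomorphic_distinguished _ hT _ (Triangle.isoMk _ _ (Iso.refl _) (Iso.refl _) e'.symm ?_ ?_ ?_)
    · exact (Category.comp_id _).trans (Category.id_comp _).symm
    · exact (Category.assoc _ _ _).trans ((congrArg (p ≫ ·) e'.hom_inv_id).trans
        ((Category.comp_id _).trans (Category.id_comp _).symm))
    · refine Eq.trans (congrArg (_ ≫ ·) (CategoryTheory.Functor.map_id _ _)) (Category.comp_id _)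
  obtain ⟨m, hm⟩ := Compact.hasProjectiveDimensionLT (hK.shift _) i _ _ hT' 0
    (hL.mono fun k hk => by simpa using hk.2)
  have h3 := Perf.ext₂ _ hT' (Perf.of_extCl hL) (perf_of_pd m N hm)
  refine Perf.of_iso (shiftNegShift X (b : ℤ)) (h3.shift b)

end Main

end DerEq

namespace DerEq

open CategoryTheory Limits Pretriangulated Triangulated DerivedCategory HomologicalComplex

universe v w w' v'

lemma van_map_iff {C : Type w} {D : Type w'} [Category.{v} C] [Category.{v'} D] [Preadditive C]
    [Preadditive D] [HasShift C ℤ] [HasShift D ℤ] [∀ n : ℤ, (shiftFunctor C n).Additive]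
    [∀ n : ℤ, (shiftFunctor D n).Additive] (F : C ⥤ D) [F.CommShift ℤ]
    [F.Full] [F.Faithful] (X Y : C) (j : ℤ) : Van (F.obj X) (F.obj Y) j ↔ Van X Y j := by
  let e : (X ⟶ Y⟦j⟧) ≃ (F.obj X ⟶ (F.obj Y)⟦j⟧) :=
    (Functor.FullyFaithful.ofFullyFaithful F).homEquiv.trans
      ((Iso.refl _).homCongr ((F.commShiftIso j).app Y))
  exact e.symm.subsingleton_congr

lemma van_iff_of_iso {C : Type w} [Category.{v} C] [Preadditive C]
    [HasShift C ℤ] [∀ n : ℤ, (shiftFunctor C n).Additive] {X X' : C} (e : X ≅ X') (Y : C) (j : ℤ) :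
    Van X Y j ↔ Van X' Y j :=
  (e.homCongr (Iso.refl (Y⟦j⟧))).subsingleton_congr

section Transport

variable (k : Type u) [Field k] {A : Type u} [Ring A]
  {B : Type u} [Ring B] [Algebra k B] [Module.Finite k B]
  [HasDerivedCategory.{w} (ModuleCat.{u} A)] [HasDerivedCategory.{w'} (ModuleCat.{u} B)]
  (F : DerivedCategory (ModuleCat.{u} A) ≌ DerivedCategory (ModuleCat.{u} B))

include k in
lemma Perf.map [F.functor.Additive] {X : DerivedCategory (ModuleCat.{u} A)} (h : Perf X) :
    Perf (F.functor.obj X) := by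
  obtain ⟨m, K, hK, ⟨e⟩⟩ := h
  exact Compact.perf k (Compact.map F (hK.compact.of_iso e.symm))

variable [Algebra k A] [Module.Finite k A] [F.functor.CommShift ℤ] [F.functor.IsTriangulated]

include k in
/-- A derived equivalence is given by a tilting complex. -/
lemma exists_tilting : ∃ (m : ℕ) (K : CochainComplex (ModuleCat.{u} A) ℤ), IsPerf m K ∧
    Nonempty (F.functor.obj (Q.obj K) ≅ reg B) ∧
    ∀ (X : DerivedCategory (ModuleCat.{u} A)) (i : ℤ),
      (∀ j, i - m ≤ j → j ≤ i + m → Van (Q.obj K) X j) → Van (reg A) X i := by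
  have : F.functor.Additive := inferInstance
  have : F.symm.functor.Additive := inferInstanceAs F.inverse.Additive
  obtain ⟨m₁, K, hK, ⟨e⟩⟩ := Perf.map k F.symm (Perf.single (FP.self (R := B)))
  obtain ⟨m₂, K', hK', ⟨e'⟩⟩ := Perf.map k F (Perf.single (FP.self (R := A)))
  have e₁ : F.functor.obj (Q.obj K) ≅ reg B :=
    F.functor.mapIso e.symm ≪≫ F.counitIso.app (reg B)
  refine ⟨max m₁ m₂, K, hK.mono (le_max_left _ _), ⟨e₁⟩, fun X i h => ?_⟩
  rw [← van_map_iff F.functor]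
  refine (van_iff_of_iso (e'.symm) _ _).1 (hK'.van _ i fun j h1 h2 => ?_)
  refine (van_iff_of_iso e₁ _ _).1 ((van_map_iff F.functor _ _ _).2 (h j ?_ ?_)) <;> omega

end Transport

end DerEq

namespace DerEq

open CategoryTheory

section Ind

variable (k : Type u) [Field k] {A : Type u} [Ring A] [Algebra k A]

/-- The value of the Nakayama functor on a module. -/
def Nu (M : Type u) [AddCommGroup M] [Module A M] : Type u := Module.Dual k (M →ₗ[A] A)

variable (M : Type u) [AddCommGroup M] [Module A M] (N : Type u) [AddCommGroup N] [Module A N]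
  (L : Type u) [AddCommGroup L] [Module A L]

noncomputable instance : AddCommGroup (Nu k (A := A) M) :=
  inferInstanceAs (AddCommGroup (Module.Dual k (M →ₗ[A] A)))

noncomputable instance : Module k (Nu k (A := A) M) :=
  inferInstanceAs (Module k (Module.Dual k (M →ₗ[A] A)))

variable {M N L}

/-- Right multiplication on the dual of a module. -/
noncomputable def dualMul (a : A) : (M →ₗ[A] A) →ₗ[k] (M →ₗ[A] A) where
  toFun ψ := (LinearMap.toSpanSingleton A A a).comp ψ
  map_add' ψ ψ' := by ext m; simp [add_mul]
  map_smul' c ψ := by ext m; simp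

@[simp] lemma dualMul_apply (a : A) (ψ : M →ₗ[A] A) (m : M) : dualMul k a ψ m = ψ m * a := rfl

namespace Nu

/-- Evaluation of an element of the Nakayama functor. -/
noncomputable def ev : Nu k (A := A) M ≃ₗ[k] Module.Dual k (M →ₗ[A] A) := LinearEquiv.refl _ _

variable {k} in
@[ext] lemma ext' {φ φ' : Nu k (A := A) M} (h : ∀ ψ, ev k φ ψ = ev k φ' ψ) : φ = φ' :=
  (ev k).injective (LinearMap.ext h)

noncomputable instance : Module A (Nu k (A := A) M) where
  smul a φ := (ev k).symm ((ev k φ).comp (dualMul k a))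
  one_smul φ := by
    ext ψ
    exact congrArg (ev k φ) (LinearMap.ext fun m => mul_one _)
  mul_smul a b φ := by
    ext ψ
    exact congrArg (ev k φ) (LinearMap.ext fun m => (mul_assoc _ _ _).symm)
  smul_zero a := rfl
  smul_add a φ φ' := rfl
  add_smul a b φ := by
    ext ψ
    exact (congrArg (ev k φ) (LinearMap.ext fun m => mul_add _ _ _)).trans
      (map_add (ev k φ) (dualMul k a ψ) (dualMul k b ψ))
  zero_smul φ := by
    ext ψ
    exact (congrArg (ev k φ) (LinearMap.ext fun m => mul_zero _)).trans (map_zero (ev k φ))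

@[simp] lemma ev_smul (a : A) (φ : Nu k (A := A) M) (ψ : M →ₗ[A] A) :
    ev k (a • φ) ψ = ev k φ (dualMul k a ψ) := rfl

/-- Precomposition with a linear map. -/
noncomputable def dualMap (v : M →ₗ[A] N) : (N →ₗ[A] A) →ₗ[k] (M →ₗ[A] A) where
  toFun ψ := ψ.comp v
  map_add' _ _ := rfl
  map_smul' _ _ := rfl

/-- Functoriality of the Nakayama functor. -/
noncomputable def map (v : M →ₗ[A] N) : Nu k (A := A) M →ₗ[A] Nu k (A := A) N where
  toFun φ := (ev k).symm ((ev k φ).comp (dualMap k v))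
  map_add' _ _ := rfl
  map_smul' _ _ := rfl

@[simp] lemma ev_map (v : M →ₗ[A] N) (φ : Nu k (A := A) M) (ψ : N →ₗ[A] A) :
    ev k (map k v φ) ψ = ev k φ (ψ.comp v) := rfl

/-- The pairing of a functional and an element. -/
noncomputable def tens (f : Module.Dual k A) (m : M) : Nu k (A := A) M :=
  (ev k).symm
    { toFun := fun ψ => f (ψ m)
      map_add' := fun _ _ => map_add f _ _
      map_smul' := fun _ _ => map_smul f _ _ }

@[simp] lemma ev_tens (f : Module.Dual k A) (m : M) (ψ : M →ₗ[A] A) :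
    ev k (tens k f m) ψ = f (ψ m) := rfl

lemma tens_smul_left (a : A) (f : Module.Dual k A) (m : M) :
    tens k (a • f) m = a • tens k f m := rfl

lemma tens_smul_right (a : A) (f : Module.Dual k A) (m : M) :
    tens k (MulOpposite.op a • f) m = tens k f (a • m) := by
  ext ψ
  exact congrArg f ((ψ.map_smul a m).symm)

lemma tens_add_left (f g : Module.Dual k A) (m : M) :
    tens k (f + g) m = tens k f m + tens k g m := rfl

lemma tens_add_right (f : Module.Dual k A) (m m' : M) :
    tens k f (m + m') = tens k f m + tens k f m' := by
  ext ψ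
  exact (congrArg f (ψ.map_add m m')).trans (map_add f _ _)

lemma tens_zero_left (m : M) : tens k (0 : Module.Dual k A) m = 0 := rfl

lemma tens_zero_right (f : Module.Dual k A) : tens k f (0 : M) = 0 := by
  ext ψ
  exact (congrArg f (ψ.map_zero)).trans (map_zero f)

lemma map_tens (v : M →ₗ[A] N) (f : Module.Dual k A) (m : M) :
    map k v (tens k f m) = tens k f (v m) := rfl

end Nu

variable (M) in
/-- The module over the trivial extension induced by `M`. -/
def IndM : Type u := M × Nu k (A := A) M

noncomputable instance : AddCommGroup (IndM k (A := A) M) :=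
  inferInstanceAs (AddCommGroup (M × Nu k (A := A) M))

namespace IndM

/-- The constructor. -/
def mk (m : M) (φ : Nu k (A := A) M) : IndM k (A := A) M := (m, φ)

variable {k}

/-- The first component. -/
def fst (p : IndM k (A := A) M) : M := Prod.fst p

/-- The second component. -/
def snd (p : IndM k (A := A) M) : Nu k (A := A) M := Prod.snd p

@[ext] lemma ext' {x y : IndM k (A := A) M} (h : x.fst = y.fst) (h' : x.snd = y.snd) : x = y :=
  Prod.ext h h'

variable (k)

noncomputable instance : Module (Paper.TrivExt k A) (IndM k (A := A) M) where
  smul x p := mk k (x.fst • p.fst) (x.fst • p.snd + Nu.tens k x.snd p.fst)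
  one_smul p := by
    refine ext' (one_smul A p.fst) ?_
    change (1 : A) • p.snd + Nu.tens k (0 : Module.Dual k A) p.fst = p.snd
    rw [one_smul, Nu.tens_zero_left, add_zero]
  mul_smul x y p := by
    refine ext' (mul_smul x.fst y.fst p.fst) ?_
    change (x.fst * y.fst) • p.snd + Nu.tens k (x.fst • y.snd + MulOpposite.op y.fst • x.snd) p.fst =
      x.fst • (y.fst • p.snd + Nu.tens k y.snd p.fst) + Nu.tens k x.snd (y.fst • p.fst)
    rw [Nu.tens_add_left, Nu.tens_smul_left, Nu.tens_smul_right, mul_smul, smul_add]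
    abel
  smul_zero x := by
    refine ext' (smul_zero x.fst) ?_
    change x.fst • (0 : Nu k (A := A) M) + Nu.tens k x.snd (0 : M) = 0
    rw [smul_zero, Nu.tens_zero_right, add_zero]
  smul_add x p q := by
    refine ext' (smul_add x.fst p.fst q.fst) ?_
    change x.fst • (p.snd + q.snd) + Nu.tens k x.snd (p.fst + q.fst) =
      (x.fst • p.snd + Nu.tens k x.snd p.fst) + (x.fst • q.snd + Nu.tens k x.snd q.fst)
    rw [smul_add, Nu.tens_add_right]
    abel
  add_smul x y p := by
    refine ext' (add_smul x.fst y.fst p.fst) ?_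
    change (x.fst + y.fst) • p.snd + Nu.tens k (x.snd + y.snd) p.fst =
      (x.fst • p.snd + Nu.tens k x.snd p.fst) + (y.fst • p.snd + Nu.tens k y.snd p.fst)
    rw [add_smul, Nu.tens_add_left]
    abel
  zero_smul p := by
    refine ext' (zero_smul A p.fst) ?_
    change (0 : A) • p.snd + Nu.tens k (0 : Module.Dual k A) p.fst = 0
    rw [zero_smul, Nu.tens_zero_left, add_zero]

lemma smul_fst (x : Paper.TrivExt k A) (p : IndM k (A := A) M) : (x • p).fst = x.fst • p.fst := rfl

lemma smul_snd (x : Paper.TrivExt k A) (p : IndM k (A := A) M) :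
    (x • p).snd = x.fst • p.snd + Nu.tens k x.snd p.fst := rfl

lemma add_fst (p q : IndM k (A := A) M) : (p + q).fst = p.fst + q.fst := rfl

lemma add_snd (p q : IndM k (A := A) M) : (p + q).snd = p.snd + q.snd := rfl

/-- The inclusion of a module in the induced module. -/
noncomputable def inl : M →ₛₗ[TrivSqZeroExt.inlHom A (Module.Dual k A)] IndM k (A := A) M where
  toFun m := mk k m 0
  map_add' m m' := ext' rfl (add_zero _).symm
  map_smul' a m := by
    refine ext' rfl ?_
    change 0 = a • (0 : Nu k (A := A) M) + Nu.tens k (0 : Module.Dual k A) m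
    rw [smul_zero, Nu.tens_zero_left, add_zero]

lemma inr_smul_inl (f : Module.Dual k A) (m : M) :
    (TrivSqZeroExt.inr f : Paper.TrivExt k A) • inl k m = mk k 0 (Nu.tens k f m) := by
  refine ext' (zero_smul A m) ?_
  change (0 : A) • (0 : Nu k (A := A) M) + Nu.tens k f m = Nu.tens k f m
  rw [smul_zero, zero_add]

/-- Functoriality of induction. -/
noncomputable def map (v : M →ₗ[A] N) : IndM k (A := A) M →ₗ[Paper.TrivExt k A] IndM k (A := A) N where
  toFun p := mk k (v p.fst) (Nu.map k v p.snd)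
  map_add' p q := ext' (v.map_add _ _) ((Nu.map k v).map_add _ _)
  map_smul' x p := by
    refine ext' (v.map_smul _ _) ?_
    change Nu.map k v (x.fst • p.snd + Nu.tens k x.snd p.fst) =
      x.fst • Nu.map k v p.snd + Nu.tens k x.snd (v p.fst)
    rw [map_add, map_smul, Nu.map_tens]

lemma map_inl (v : M →ₗ[A] N) (m : M) : map k v (inl k m) = inl k (v m) :=
  ext' rfl ((Nu.map k v).map_zero)

end IndM

end Ind

end DerEq

namespace DerEq

open CategoryTheory

section Ind

/-- A finite dual basis. -/
structure DBasis (A : Type u) [Ring A] (M : Type u) [AddCommGroup M] [Module A M] where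
  /-- The number of elements. -/
  r : ℕ
  /-- The elements. -/
  e : Fin r → M
  /-- The functionals. -/
  c : Fin r → (M →ₗ[A] A)
  sum_eq (m : M) : ∑ i, c i m • e i = m

lemma FP.dbasis {A : Type u} [Ring A] {M : ModuleCat.{u} A} (h : FP M) : Nonempty (DBasis A M) := by
  obtain ⟨hp, hf⟩ := h
  obtain ⟨n, f, hf⟩ := Module.Finite.exists_fin' A M
  have : Module.Projective A M := (IsProjective.iff_projective (R := A) M).2 hp
  obtain ⟨s, hs⟩ := Module.projective_lifting_property f LinearMap.id hf
  refine ⟨⟨n, fun i => f (Pi.single i 1), fun i => (LinearMap.proj i).comp s, fun m => ?_⟩⟩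
  refine Eq.trans ?_ (LinearMap.congr_fun hs m)
  change _ = f (s m)
  conv_rhs => rw [LinearMap.pi_apply_eq_sum_univ f (s m)]
  refine Finset.sum_congr rfl fun i _ => ?_
  congr 2
  ext j
  simp [Pi.single_apply, eq_comm]

lemma DBasis.fp {A : Type u} [Ring A] {M : ModuleCat.{u} A} (b : DBasis A M) : FP M := by
  let p : (Fin b.r → A) →ₗ[A] M := Fintype.linearCombination A b.e
  let s : M →ₗ[A] (Fin b.r → A) := LinearMap.pi b.c
  have h : p.comp s = LinearMap.id := LinearMap.ext fun m => by
    change Fintype.linearCombination A b.e (s m) = m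
    rw [Fintype.linearCombination_apply]
    exact b.sum_eq m
  refine ⟨(IsProjective.iff_projective (R := A) M).1 (Module.Projective.of_split s p h), ?_⟩
  exact Module.Finite.of_surjective p fun m => ⟨s m, LinearMap.congr_fun h m⟩

variable (k : Type u) [Field k] {A : Type u} [Ring A] [Algebra k A]
variable {M : Type u} [AddCommGroup M] [Module A M] {N : Type u} [AddCommGroup N] [Module A N]
  {N' : Type u} [AddCommGroup N'] [Module A N']
  {L : Type u} [AddCommGroup L] [Module (Paper.TrivExt k A) L]

namespace DBasis

variable (b : DBasis A M)

/-- The functionals obtained by right multiplication. -/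
noncomputable def cmul (i : Fin b.r) : A →ₗ[k] (M →ₗ[A] A) where
  toFun x := dualMul k x (b.c i)
  map_add' x y := LinearMap.ext fun m => mul_add _ _ _
  map_smul' c x := LinearMap.ext fun m => mul_smul_comm c (b.c i m) x

/-- The coefficients of an element of the Nakayama functor. -/
noncomputable def coef (φ : Nu k (A := A) M) (i : Fin b.r) : Module.Dual k A :=
  (Nu.ev k φ).comp (b.cmul k i)

lemma coef_apply (φ : Nu k (A := A) M) (i : Fin b.r) (x : A) :
    b.coef k φ i x = Nu.ev k φ (dualMul k x (b.c i)) := rfl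

lemma coef_add (φ φ' : Nu k (A := A) M) (i : Fin b.r) :
    b.coef k (φ + φ') i = b.coef k φ i + b.coef k φ' i := rfl

lemma coef_smul (a : A) (φ : Nu k (A := A) M) (i : Fin b.r) :
    b.coef k (a • φ) i = a • b.coef k φ i := by
  ext x
  exact congrArg (Nu.ev k φ) (LinearMap.ext fun m => (mul_assoc (b.c i m) x a))

lemma coef_tens (f : Module.Dual k A) (m : M) (i : Fin b.r) :
    b.coef k (Nu.tens k f m) i = MulOpposite.op (b.c i m) • f := rfl

lemma sum_dualMul (ψ : M →ₗ[A] A) : ∑ i, dualMul k (ψ (b.e i)) (b.c i) = ψ := by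
  ext m
  rw [LinearMap.sum_apply]
  simp only [dualMul_apply]
  conv_rhs => rw [← b.sum_eq m, map_sum]
  simp

lemma sum_tens (φ : Nu k (A := A) M) : ∑ i, Nu.tens k (b.coef k φ i) (b.e i) = φ := by
  refine (Nu.ev k).injective ?_
  rw [map_sum]
  ext ψ
  rw [LinearMap.sum_apply]
  simp only [Nu.ev_tens, coef_apply]
  exact (map_sum (Nu.ev k φ) _ _).symm.trans (congrArg _ (b.sum_dualMul k ψ))

lemma sum_smul_inl (p : IndM k (A := A) M) :
    p = IndM.inl k p.fst +
      ∑ i, (TrivSqZeroExt.inr (b.coef k p.snd i) : Paper.TrivExt k A) • IndM.inl k (b.e i) := by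
  simp only [IndM.inr_smul_inl]
  let j : Nu k (A := A) M →+ IndM k (A := A) M :=
    { toFun := fun φ => IndM.mk k 0 φ
      map_zero' := rfl
      map_add' := fun _ _ => IndM.ext' (add_zero _).symm rfl }
  have h : ∑ i, IndM.mk k 0 (Nu.tens k (b.coef k p.snd i) (b.e i)) =
      j p.snd := (map_sum j _ _).symm.trans (congrArg j (b.sum_tens k p.snd))
  refine Eq.trans ?_ (congrArg (IndM.inl k p.fst + ·) h.symm)
  exact IndM.ext' (add_zero _).symm (zero_add _).symm

include b in
lemma ind_ext {f g : IndM k (A := A) M →ₗ[Paper.TrivExt k A] L}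
    (h : ∀ m, f (IndM.inl k m) = g (IndM.inl k m)) : f = g := by
  ext p
  rw [b.sum_smul_inl k p]
  simp only [map_add, map_sum, map_smul, h]

include b in
lemma exists_ext (g : M →ₛₗ[TrivSqZeroExt.inlHom A (Module.Dual k A)] L) :
    ∃ f : IndM k (A := A) M →ₗ[Paper.TrivExt k A] L, ∀ m, f (IndM.inl k m) = g m := by
  refine ⟨⟨⟨fun p => g p.fst + ∑ i, (TrivSqZeroExt.inr (b.coef k p.snd i) : Paper.TrivExt k A) •
    g (b.e i), fun p q => ?_⟩, fun x p => ?_⟩, fun m => ?_⟩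
  · simp only [IndM.add_fst, IndM.add_snd, map_add, coef_add, TrivSqZeroExt.inr_add, add_smul,
      Finset.sum_add_distrib]
    abel
  · have h1 : ∑ i, (TrivSqZeroExt.inr (b.coef k (x.fst • p.snd) i) : Paper.TrivExt k A) • g (b.e i) =
        (TrivSqZeroExt.inl x.fst : Paper.TrivExt k A) •
          ∑ i, (TrivSqZeroExt.inr (b.coef k p.snd i) : Paper.TrivExt k A) • g (b.e i) := by
      rw [Finset.smul_sum]
      refine Finset.sum_congr rfl fun i _ => ?_
      rw [coef_smul, smul_smul, TrivSqZeroExt.inl_mul_inr]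
    have h2 : ∑ i, (TrivSqZeroExt.inr (b.coef k (Nu.tens k x.snd p.fst) i) : Paper.TrivExt k A) •
        g (b.e i) = (TrivSqZeroExt.inr x.snd : Paper.TrivExt k A) • g p.fst := by
      conv_rhs => rw [← b.sum_eq p.fst, map_sum, Finset.smul_sum]
      refine Finset.sum_congr rfl fun i _ => ?_
      rw [coef_tens, ← TrivSqZeroExt.inr_mul_inl, ← smul_smul]
      exact congrArg _ (g.map_smulₛₗ _ _).symm
    have h3 : (TrivSqZeroExt.inr x.snd : Paper.TrivExt k A) •
          ∑ i, (TrivSqZeroExt.inr (b.coef k p.snd i) : Paper.TrivExt k A) • g (b.e i) = 0 := by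
      rw [Finset.smul_sum]
      refine Finset.sum_eq_zero fun i _ => ?_
      rw [smul_smul, TrivSqZeroExt.inr_mul_inr, zero_smul]
    have h4 : x = TrivSqZeroExt.inl x.fst + TrivSqZeroExt.inr x.snd :=
      (TrivSqZeroExt.inl_fst_add_inr_snd_eq x).symm
    have h5 : g (x.fst • p.fst) = (TrivSqZeroExt.inl x.fst : Paper.TrivExt k A) • g p.fst :=
      g.map_smulₛₗ _ _
    simp only [IndM.smul_fst, IndM.smul_snd, coef_add, TrivSqZeroExt.inr_add, add_smul,
      Finset.sum_add_distrib, RingHom.id_apply]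
    rw [h1, h2, h5]
    conv_rhs => rw [h4, add_smul, smul_add, smul_add, h3]
    abel
  · change g m + ∑ i, (TrivSqZeroExt.inr (b.coef k (0 : Nu k (A := A) M) i) : Paper.TrivExt k A) •
      g (b.e i) = g m
    have : ∀ i, b.coef k (0 : Nu k (A := A) M) i = 0 := fun i => rfl
    simp [this]

/-- The dual basis of an induced module. -/
noncomputable def ind : DBasis (Paper.TrivExt k A) (IndM k (A := A) M) where
  r := b.r
  e i := IndM.inl k (b.e i)
  c i := (b.exists_ext k (L := Paper.TrivExt k A)
    ⟨⟨fun m => TrivSqZeroExt.inl (b.c i m), fun m m' => by simp⟩, fun a m => by simp⟩).choose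
  sum_eq p := by
    set c : Fin b.r → (IndM k (A := A) M →ₗ[Paper.TrivExt k A] Paper.TrivExt k A) := fun i =>
      (b.exists_ext k (L := Paper.TrivExt k A)
        ⟨⟨fun m => TrivSqZeroExt.inl (b.c i m), fun m m' => by simp⟩, fun a m => by simp⟩).choose
      with hc
    have hc' : ∀ i m, c i (IndM.inl k m) = TrivSqZeroExt.inl (b.c i m) := fun i =>
      (b.exists_ext k (L := Paper.TrivExt k A)
        ⟨⟨fun m => TrivSqZeroExt.inl (b.c i m), fun m m' => by simp⟩,
          fun a m => by simp⟩).choose_spec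
    have h : ∑ i, (LinearMap.toSpanSingleton _ _ (IndM.inl k (b.e i))).comp (c i) =
        LinearMap.id := by
      refine b.ind_ext k fun m => ?_
      rw [LinearMap.sum_apply]
      simp only [LinearMap.comp_apply, LinearMap.toSpanSingleton_apply, LinearMap.id_apply]
      conv_rhs => rw [← b.sum_eq m, map_sum]
      refine Finset.sum_congr rfl fun i _ => ?_
      rw [hc']
      exact ((IndM.inl k).map_smulₛₗ _ _).symm
    have := LinearMap.congr_fun h p
    rw [LinearMap.sum_apply] at this
    exact this

end DBasis

/-! ### Maps between induced modules -/

namespace IndM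

/-- The first component of a map of induced modules. -/
noncomputable def pr : (IndM k (A := A) M →ₗ[Paper.TrivExt k A] IndM k (A := A) N) →+
    (M →ₗ[A] N) where
  toFun f :=
    { toFun := fun m => (f (inl k m)).fst
      map_add' := fun m m' => by rw [map_add, map_add]; rfl
      map_smul' := fun a m => by
        rw [(inl k).map_smulₛₗ, map_smul]
        rfl }
  map_zero' := rfl
  map_add' _ _ := rfl

/-- The second component of a map of induced modules. -/
noncomputable def px : (IndM k (A := A) M →ₗ[Paper.TrivExt k A] IndM k (A := A) N) →+
    (M →ₗ[A] Nu k (A := A) N) where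
  toFun f :=
    { toFun := fun m => (f (inl k m)).snd
      map_add' := fun m m' => by rw [map_add, map_add]; rfl
      map_smul' := fun a m => by
        rw [(inl k).map_smulₛₗ, map_smul]
        exact add_zero _ }
  map_zero' := rfl
  map_add' _ _ := rfl

lemma pr_apply (f : IndM k (A := A) M →ₗ[Paper.TrivExt k A] IndM k (A := A) N) (m : M) :
    pr k f m = (f (inl k m)).fst := rfl

lemma px_apply (f : IndM k (A := A) M →ₗ[Paper.TrivExt k A] IndM k (A := A) N) (m : M) :
    px k f m = (f (inl k m)).snd := rfl

lemma pr_map (v : M →ₗ[A] N) : pr k (map k v) = v := rfl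

lemma px_map (v : M →ₗ[A] N) : px k (map k v) = 0 := by
  ext m
  rfl

lemma ext_pr_px (b : DBasis A M)
    {f g : IndM k (A := A) M →ₗ[Paper.TrivExt k A] IndM k (A := A) N}
    (h : pr k f = pr k g) (h' : px k f = px k g) : f = g :=
  b.ind_ext k fun m => ext' (LinearMap.congr_fun h m) (LinearMap.congr_fun h' m)

lemma exists_pr_px (b : DBasis A M) (r : M →ₗ[A] N) (x : M →ₗ[A] Nu k (A := A) N) :
    ∃ f : IndM k (A := A) M →ₗ[Paper.TrivExt k A] IndM k (A := A) N,
      pr k f = r ∧ px k f = x := by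
  obtain ⟨f, hf⟩ := b.exists_ext k (L := IndM k (A := A) N)
    ⟨⟨fun m => mk k (r m) (x m), fun m m' => ext' (r.map_add _ _) (x.map_add _ _)⟩,
      fun a m => ext' (r.map_smul _ _) ((x.map_smul _ _).trans (add_zero _).symm)⟩
  exact ⟨f, LinearMap.ext fun m => congrArg IndM.fst (hf m),
    LinearMap.ext fun m => congrArg IndM.snd (hf m)⟩

lemma apply_eq (b : DBasis A M) (f : IndM k (A := A) M →ₗ[Paper.TrivExt k A] IndM k (A := A) N)
    (p : IndM k (A := A) M) :
    f p = mk k (pr k f p.fst) (px k f p.fst + Nu.map k (pr k f) p.snd) := by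
  have h : ∀ i, (TrivSqZeroExt.inr (b.coef k p.snd i) : Paper.TrivExt k A) • f (inl k (b.e i)) =
      mk k 0 (Nu.tens k (b.coef k p.snd i) (pr k f (b.e i))) := fun i =>
    ext' (zero_smul A _) (by
      change (0 : A) • _ + _ = _
      rw [zero_smul, zero_add]
      rfl)
  let j : Nu k (A := A) N →+ IndM k (A := A) N :=
    { toFun := fun φ => mk k 0 φ
      map_zero' := rfl
      map_add' := fun _ _ => ext' (add_zero _).symm rfl }
  have h' : ∑ i, mk k 0 (Nu.tens k (b.coef k p.snd i) (pr k f (b.e i))) = j (Nu.map k (pr k f) p.snd) := by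
    refine (map_sum j _ _).symm.trans (congrArg j ?_)
    conv_rhs => rw [← b.sum_tens k p.snd, map_sum]
    rfl
  conv_lhs => rw [b.sum_smul_inl k p, map_add, map_sum]
  simp only [map_smul, h]
  refine (congrArg (f (inl k p.fst) + ·) h').trans ?_
  exact ext' (add_zero _) rfl

lemma pr_comp (b : DBasis A N)
    (g : IndM k (A := A) N →ₗ[Paper.TrivExt k A] IndM k (A := A) N')
    (f : IndM k (A := A) M →ₗ[Paper.TrivExt k A] IndM k (A := A) N) :
    pr k (g.comp f) = (pr k g).comp (pr k f) :=
  LinearMap.ext fun m => (congrArg IndM.fst (apply_eq k b g (f (inl k m))) : (g (f (inl k m))).fst = _)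

lemma px_comp (b : DBasis A N)
    (g : IndM k (A := A) N →ₗ[Paper.TrivExt k A] IndM k (A := A) N')
    (f : IndM k (A := A) M →ₗ[Paper.TrivExt k A] IndM k (A := A) N) :
    px k (g.comp f) = (px k g).comp (pr k f) + (Nu.map k (pr k g)).comp (px k f) :=
  LinearMap.ext fun m => (congrArg IndM.snd (apply_eq k b g (f (inl k m))) : (g (f (inl k m))).snd = _)

end IndM

end Ind

end DerEq

namespace DerEq

open CategoryTheory

section Serre

variable (k : Type u) [Field k] {A : Type u} [Ring A] [Algebra k A]
variable {M : Type u} [AddCommGroup M] [Module A M] [Module k M] [IsScalarTower k A M]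
  {M' : Type u} [AddCommGroup M'] [Module A M'] [Module k M'] [IsScalarTower k A M']
  {N : Type u} [AddCommGroup N] [Module A N] [Module k N] [IsScalarTower k A N]
  {N' : Type u} [AddCommGroup N'] [Module A N'] [Module k N'] [IsScalarTower k A N']

/-- Postcomposition as a linear map. -/
noncomputable def postc (N : Type u) [AddCommGroup N] [Module A N] (u : M →ₗ[A] M') :
    (N →ₗ[A] M) →ₗ[k] (N →ₗ[A] M') where
  toFun g := u.comp g
  map_add' _ _ := LinearMap.comp_add _ _ _
  map_smul' c g := LinearMap.ext fun n => u.map_smul_of_tower c (g n)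

/-- Precomposition as a linear map. -/
noncomputable def prec (M : Type u) [AddCommGroup M] [Module A M] [Module k M]
    [IsScalarTower k A M] (u : N →ₗ[A] N') : (N' →ₗ[A] M) →ₗ[k] (N →ₗ[A] M) where
  toFun g := g.comp u
  map_add' _ _ := rfl
  map_smul' _ _ := rfl

/-- The rank one maps. -/
noncomputable def rankOne (N : Type u) [AddCommGroup N] [Module A N] (m : M) :
    (N →ₗ[A] A) →ₗ[k] (N →ₗ[A] M) where
  toFun ψ := (LinearMap.toSpanSingleton A M m).comp ψ
  map_add' _ _ := LinearMap.comp_add _ _ _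
  map_smul' c ψ := LinearMap.ext fun n => smul_assoc c (ψ n) m

lemma rankOne_apply (m : M) (ψ : N →ₗ[A] A) (n : N) : rankOne k N m ψ n = ψ n • m := rfl

/-- The map to the Nakayama functor given by a functional on homomorphisms. -/
noncomputable def serreFun (θ : Module.Dual k (N →ₗ[A] M)) : M →ₗ[A] Nu k (A := A) N where
  toFun m := (Nu.ev k).symm (θ.comp (rankOne k N m))
  map_add' m m' := by
    ext ψ
    exact (congrArg θ (LinearMap.ext fun n => smul_add (ψ n) m m')).trans
      (map_add θ (rankOne k N m ψ) (rankOne k N m' ψ))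
  map_smul' a m := by
    ext ψ
    exact congrArg θ (LinearMap.ext fun n => smul_smul (ψ n) a m)

/-- A map to the Nakayama functor is linear over the ground field. -/
lemma ev_map_smul (x : M →ₗ[A] Nu k (A := A) N) (c : k) (m : M) (ψ : N →ₗ[A] A) :
    Nu.ev k (x (c • m)) ψ = c • Nu.ev k (x m) ψ := by
  rw [← algebraMap_smul A c m, map_smul, Nu.ev_smul, ← map_smul]
  refine congrArg _ (LinearMap.ext fun n => ?_)
  rw [dualMul_apply, LinearMap.smul_apply, Algebra.smul_def, Algebra.commutes]

/-- The inverse construction. -/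
noncomputable def serreInv (b : DBasis A N) (x : M →ₗ[A] Nu k (A := A) N) :
    Module.Dual k (N →ₗ[A] M) where
  toFun g := ∑ i, Nu.ev k (x (g (b.e i))) (b.c i)
  map_add' g g' := by
    rw [← Finset.sum_add_distrib]
    refine Finset.sum_congr rfl fun i _ => ?_
    rw [LinearMap.add_apply, map_add, map_add, LinearMap.add_apply]
  map_smul' c g := by
    rw [RingHom.id_apply, Finset.smul_sum]
    refine Finset.sum_congr rfl fun i _ => ?_
    rw [LinearMap.smul_apply, ev_map_smul]

/-- Serre duality for homomorphisms of finitely generated projective modules. -/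
noncomputable def serre (b : DBasis A N) :
    Module.Dual k (N →ₗ[A] M) ≃+ (M →ₗ[A] Nu k (A := A) N) where
  toFun := serreFun k
  invFun := serreInv k b
  map_add' _ _ := rfl
  left_inv θ := by
    ext g
    change ∑ i, θ (rankOne k N (g (b.e i)) (b.c i)) = θ g
    rw [← map_sum]
    refine congrArg θ (LinearMap.ext fun n => ?_)
    rw [LinearMap.sum_apply]
    conv_rhs => rw [← b.sum_eq n, map_sum]
    refine Finset.sum_congr rfl fun i _ => ?_
    rw [rankOne_apply, map_smul]
  right_inv x := by
    ext m ψ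
    change ∑ i, Nu.ev k (x (ψ (b.e i) • m)) (b.c i) = _
    simp only [map_smul, Nu.ev_smul]
    exact (map_sum (Nu.ev k (x m)) _ _).symm.trans (congrArg _ (b.sum_dualMul k ψ))

lemma serre_apply (b : DBasis A N) (θ : Module.Dual k (N →ₗ[A] M)) : serre k b θ = serreFun k θ :=
  rfl

lemma serreFun_comp (θ : Module.Dual k (N →ₗ[A] M')) (u : M →ₗ[A] M') :
    (serreFun k θ).comp u = serreFun k (θ.comp (postc k N u)) := by
  ext m ψ
  exact congrArg θ (LinearMap.ext fun n => (u.map_smul (ψ n) m).symm)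

lemma map_comp_serreFun (θ : Module.Dual k (N →ₗ[A] M)) (v : N →ₗ[A] N') :
    (Nu.map k v).comp (serreFun k θ) = serreFun k (θ.comp (prec k M v)) := rfl

/-- The functional on homomorphisms given by a map to the Nakayama functor. -/
noncomputable def tr (b : DBasis A N) :
    (M →ₗ[A] Nu k (A := A) N) ≃+ Module.Dual k (N →ₗ[A] M) := (serre k b).symm

lemma serreFun_tr (b : DBasis A N) (x : M →ₗ[A] Nu k (A := A) N) : serreFun k (tr k b x) = x :=
  (serre k b).apply_symm_apply x

lemma tr_serreFun (b : DBasis A N) (θ : Module.Dual k (N →ₗ[A] M)) : tr k b (serreFun k θ) = θ :=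
  (serre k b).symm_apply_apply θ

lemma tr_comp (b : DBasis A N) (x : M' →ₗ[A] Nu k (A := A) N) (u : M →ₗ[A] M') :
    tr k b (x.comp u) = (tr k b x).comp (postc k N u) := by
  refine (serre k b).injective ?_
  rw [serre_apply, serre_apply, ← serreFun_comp, serreFun_tr, serreFun_tr]

lemma tr_map_comp (b : DBasis A N) (b' : DBasis A N') (x : M →ₗ[A] Nu k (A := A) N)
    (v : N →ₗ[A] N') : tr k b' ((Nu.map k v).comp x) = (tr k b x).comp (prec k M v) := by
  refine (serre k b').injective ?_
  rw [serre_apply, serre_apply, ← map_comp_serreFun, serreFun_tr, serreFun_tr]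

end Serre

end DerEq

namespace DerEq

open CategoryTheory

/-- The alternating sign. -/
def sgn (k : Type u) [Field k] (n : ℤ) : k := (((n.negOnePow : ℤˣ) : ℤ) : k)

lemma sgn_succ (k : Type u) [Field k] (n : ℤ) : sgn k (n + 1) = - sgn k n := by
  simp [sgn, Int.negOnePow_succ]

lemma sgn_mul_self (k : Type u) [Field k] (n : ℤ) : sgn k n * sgn k n = 1 := by
  rw [sgn, ← Int.cast_mul, ← Units.val_mul, ← Int.negOnePow_add, Int.negOnePow_even _ ⟨n, rfl⟩]
  simp

section Chain

variable (k : Type u) [Field k] {A : Type u} [Ring A] [Algebra k A]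
variable {K : ℤ → Type u} [∀ n, AddCommGroup (K n)] [∀ n, Module A (K n)] [∀ n, Module k (K n)]
  [∀ n, IsScalarTower k A (K n)]
  {L : ℤ → Type u} [∀ n, AddCommGroup (L n)] [∀ n, Module A (L n)] [∀ n, Module k (L n)]
  [∀ n, IsScalarTower k A (L n)]
  (dK : ∀ n, K n →ₗ[A] K (n + 1)) (dL : ∀ n, L n →ₗ[A] L (n + 1))
  (b : ∀ n, DBasis A (L n)) (T : Finset ℤ)

/-- The differential of a degree zero cochain. -/
noncomputable def chainδ : (∀ n, L n →ₗ[A] K n) →ₗ[k] (∀ n, L n →ₗ[A] K (n + 1)) :=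
  LinearMap.pi fun n => (postc k (L n) (dK n)).comp (LinearMap.proj n) -
    (prec k (K (n + 1)) (dL n)).comp (LinearMap.proj (n + 1))

lemma chainδ_apply (g : ∀ n, L n →ₗ[A] K n) (n : ℤ) :
    chainδ k dK dL g n = (dK n).comp (g n) - (g (n + 1)).comp (dL n) := rfl

lemma chainδ_eq_zero_iff (g : ∀ n, L n →ₗ[A] K n) :
    chainδ k dK dL g = 0 ↔ ∀ n, (dK n).comp (g n) = (g (n + 1)).comp (dL n) := by
  rw [funext_iff]
  exact forall_congr' fun n => sub_eq_zero

/-- The functional on cochains given by a family of maps to the Nakayama functor. -/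
noncomputable def chainTr :
    (∀ n, K n →ₗ[A] Nu k (A := A) (L n)) →+ Module.Dual k (∀ n, L n →ₗ[A] K n) where
  toFun x := ∑ n ∈ T, sgn k n • (tr k (b n) (x n)).comp (LinearMap.proj n)
  map_zero' := by simp
  map_add' x y := by
    rw [← Finset.sum_add_distrib]
    refine Finset.sum_congr rfl fun n _ => ?_
    rw [Pi.add_apply, map_add, LinearMap.add_comp, smul_add]

lemma chainTr_apply (x : ∀ n, K n →ₗ[A] Nu k (A := A) (L n)) (g : ∀ n, L n →ₗ[A] K n) :
    chainTr k b T x g = ∑ n ∈ T, sgn k n * tr k (b n) (x n) (g n) := by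
  change (∑ n ∈ T, sgn k n • (tr k (b n) (x n)).comp (LinearMap.proj n)) g = _
  rw [LinearMap.sum_apply]
  rfl

lemma chainTr_comp {K' : ℤ → Type u} [∀ n, AddCommGroup (K' n)] [∀ n, Module A (K' n)]
    [∀ n, Module k (K' n)] [∀ n, IsScalarTower k A (K' n)]
    (x : ∀ n, K n →ₗ[A] Nu k (A := A) (L n)) (r : ∀ n, K' n →ₗ[A] K n)
    (g : ∀ n, L n →ₗ[A] K' n) :
    chainTr k b T (fun n => (x n).comp (r n)) g =
      chainTr k b T x (fun n => (r n).comp (g n)) := by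
  rw [chainTr_apply, chainTr_apply]
  refine Finset.sum_congr rfl fun n _ => ?_
  rw [tr_comp]
  rfl

lemma chainTr_map_comp {L' : ℤ → Type u} [∀ n, AddCommGroup (L' n)] [∀ n, Module A (L' n)]
    [∀ n, Module k (L' n)] [∀ n, IsScalarTower k A (L' n)] (b' : ∀ n, DBasis A (L' n))
    (x : ∀ n, K n →ₗ[A] Nu k (A := A) (L n)) (r : ∀ n, L n →ₗ[A] L' n)
    (g : ∀ n, L' n →ₗ[A] K n) :
    chainTr k b' T (fun n => (Nu.map k (r n)).comp (x n)) g =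
      chainTr k b T x (fun n => (g n).comp (r n)) := by
  rw [chainTr_apply, chainTr_apply]
  refine Finset.sum_congr rfl fun n _ => ?_
  rw [tr_map_comp k (b n)]
  rfl

variable (hT : ∀ n, n ∉ T → Subsingleton (L n))

include hT in
lemma chainTr_eq_finsum (x : ∀ n, K n →ₗ[A] Nu k (A := A) (L n)) (g : ∀ n, L n →ₗ[A] K n) :
    chainTr k b T x g = ∑ᶠ n, sgn k n * tr k (b n) (x n) (g n) := by
  rw [chainTr_apply, finsum_eq_sum_of_support_subset]
  intro n hn
  by_contra hc
  have := hT n hc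
  refine hn ?_
  have : g n = 0 := Subsingleton.elim _ _
  change sgn k n * tr k (b n) (x n) (g n) = 0
  rw [this, map_zero, mul_zero]

include hT in
lemma chainTr_single (x : ∀ n, K n →ₗ[A] Nu k (A := A) (L n)) (n : ℤ) (g : L n →ₗ[A] K n) :
    chainTr k b T x (Pi.single n g) = sgn k n * tr k (b n) (x n) g := by
  rw [chainTr_eq_finsum k b T hT, finsum_eq_single _ n, Pi.single_eq_same]
  intro m hm
  rw [Pi.single_eq_of_ne hm, map_zero, mul_zero]

include hT in
/-- The functional of a chain map vanishes on null homotopic chain maps. -/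
lemma chainTr_null {x : ∀ n, K n →ₗ[A] Nu k (A := A) (L n)}
    (hx : ∀ n, (x (n + 1)).comp (dK n) = (Nu.map k (dL n)).comp (x n))
    {g : ∀ n, L n →ₗ[A] K n} {h : ∀ n, L (n + 1) →ₗ[A] K n}
    (hg : ∀ n, g (n + 1) = (dK n).comp (h n) + (h (n + 1)).comp (dL (n + 1))) :
    chainTr k b T x g = 0 := by
  let c : ℤ → k := fun n => sgn k n * tr k (b n) (x n) ((h n).comp (dL n))
  have hb : ∀ n, tr k (b (n + 1)) (x (n + 1)) ((dK n).comp (h n)) =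
      tr k (b n) (x n) ((h n).comp (dL n)) := fun n => by
    have := congrArg (tr k (b (n + 1))) (hx n)
    rw [tr_comp, tr_map_comp k (b n)] at this
    exact LinearMap.congr_fun this (h n)
  have hc : c.HasFiniteSupport := by
    refine T.finite_toSet.subset fun n hn => ?_
    by_contra hc
    have := hT n hc
    refine hn ?_
    have h0 : (h n).comp (dL n) = 0 := Subsingleton.elim _ _
    change sgn k n * tr k (b n) (x n) ((h n).comp (dL n)) = 0
    rw [h0, map_zero, mul_zero]
  have hc' : (fun n => c (n + 1)).HasFiniteSupport :=
    hc.preimage ((Equiv.addRight (1 : ℤ)).injective.injOn)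
  have h1 : ∀ n, sgn k (n + 1) * tr k (b (n + 1)) (x (n + 1)) (g (n + 1)) = c (n + 1) - c n := by
    intro n
    rw [hg, map_add, hb]
    change _ = sgn k (n + 1) * _ - sgn k n * _
    rw [sgn_succ]
    ring
  rw [chainTr_eq_finsum k b T hT, ← finsum_comp_equiv (Equiv.addRight (1 : ℤ))]
  refine (finsum_congr h1).trans ?_
  rw [finsum_sub_distrib hc' hc]
  exact sub_eq_zero.2 (finsum_comp_equiv (f := c) (Equiv.addRight (1 : ℤ)))

include hT in
/-- Every functional vanishing on null homotopic chain maps comes from a chain map. -/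
lemma exists_chainTr (Θ : Module.Dual k (∀ n, L n →ₗ[A] K n))
    (hΘ : ∀ (g : ∀ n, L n →ₗ[A] K n) (h : ∀ n, L (n + 1) →ₗ[A] K n),
      (∀ n, g (n + 1) = (dK n).comp (h n) + (h (n + 1)).comp (dL (n + 1))) → Θ g = 0) :
    ∃ x : ∀ n, K n →ₗ[A] Nu k (A := A) (L n),
      (∀ n, (x (n + 1)).comp (dK n) = (Nu.map k (dL n)).comp (x n)) ∧ chainTr k b T x = Θ := by
  let θ : ∀ n, Module.Dual k (L n →ₗ[A] K n) := fun n =>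
    sgn k n • Θ.comp (LinearMap.single k (fun n => L n →ₗ[A] K n) n)
  have hθ : ∀ n g, θ n g = sgn k n * Θ (Pi.single n g) := fun n g => rfl
  refine ⟨fun n => serreFun k (θ n), fun n => ?_, ?_⟩
  · rw [serreFun_comp, map_comp_serreFun]
    congr 1
    ext h
    change θ (n + 1) ((dK n).comp h) = θ n (h.comp (dL n))
    have h0 := hΘ (Pi.single n (h.comp (dL n)) + Pi.single (n + 1) ((dK n).comp h))
      (Pi.single n h) (fun m => by
        refine (add_comm _ _).trans (congrArg₂ (· + ·) ?_ ?_)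
        · by_cases hm : m = n
          · subst hm
            rw [Pi.single_eq_same, Pi.single_eq_same]
          · rw [Pi.single_eq_of_ne hm, Pi.single_eq_of_ne (by omega), LinearMap.comp_zero]
        · by_cases hm : m + 1 = n
          · subst hm
            rw [Pi.single_eq_same, Pi.single_eq_same]
          · rw [Pi.single_eq_of_ne hm, Pi.single_eq_of_ne hm, LinearMap.zero_comp])
    rw [map_add] at h0
    rw [hθ, hθ, sgn_succ, eq_neg_of_add_eq_zero_right h0]
    ring
  · have key : ∀ n g, chainTr k b T (fun n => serreFun k (θ n)) (Pi.single n g) =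
        Θ (Pi.single n g) := fun n g => by
      rw [chainTr_single k b T hT, tr_serreFun, hθ, ← mul_assoc, sgn_mul_self, one_mul]
    ext g
    have hg : g = ∑ n ∈ T, Pi.single n (g n) := by
      ext1 m
      rw [Finset.sum_apply]
      by_cases hm : m ∈ T
      · rw [Finset.sum_eq_single m (fun j _ hj => Pi.single_eq_of_ne hj.symm _)
          (fun h => absurd hm h), Pi.single_eq_same]
      · have := hT m hm
        exact Subsingleton.elim _ _
    rw [hg, map_sum, map_sum]
    exact Finset.sum_congr rfl fun n _ => key n _

include hT in
/-- A chain map whose functional vanishes on chain maps is null homotopic. -/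
lemma null_of_chainTr {x : ∀ n, K n →ₗ[A] Nu k (A := A) (L n)}
    (hx : ∀ g : ∀ n, L n →ₗ[A] K n, (∀ n, (dK n).comp (g n) = (g (n + 1)).comp (dL n)) →
      chainTr k b T x g = 0) :
    ∃ h : ∀ n, K (n + 1) →ₗ[A] Nu k (A := A) (L n), ∀ n,
      x (n + 1) = (Nu.map k (dL n)).comp (h n) + (h (n + 1)).comp (dK (n + 1)) := by
  obtain ⟨Θ, hΘ⟩ : ∃ Θ, (chainδ k dK dL).dualMap Θ = chainTr k b T x := by
    have : chainTr k b T x ∈ LinearMap.range (chainδ k dK dL).dualMap := by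
      rw [LinearMap.range_dualMap_eq_dualAnnihilator_ker, Submodule.mem_dualAnnihilator]
      intro g hg
      exact hx g ((chainδ_eq_zero_iff k dK dL g).1 hg)
    exact this
  let θ : ∀ n, Module.Dual k (L n →ₗ[A] K (n + 1)) := fun n =>
    sgn k n • Θ.comp (LinearMap.single k (fun n => L n →ₗ[A] K (n + 1)) n)
  have hθ : ∀ n g, θ n g = sgn k n * Θ (Pi.single n g) := fun n g => rfl
  refine ⟨fun n => serreFun k (θ n), fun n => ?_⟩
  rw [serreFun_comp, map_comp_serreFun, ← serreFun_tr k (b (n + 1)) (x (n + 1))]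
  refine congrArg (serreFun k (A := A) (M := K (n + 1)) (N := L (n + 1)))
    (?_ : _ = (θ n).comp (prec k _ (dL n)) + (θ (n + 1)).comp (postc k _ (dK (n + 1))))
  ext g
  change tr k (b (n + 1)) (x (n + 1)) g =
    θ n (g.comp (dL n)) + θ (n + 1) ((dK (n + 1)).comp g)
  have h1 : Θ (chainδ k dK dL (Pi.single (n + 1) g)) = _ :=
    (LinearMap.congr_fun hΘ (Pi.single (n + 1) g)).trans (chainTr_single k b T hT x (n + 1) g)
  have h2 : chainδ k dK dL (Pi.single (n + 1) g) =
      Pi.single (n + 1) ((dK (n + 1)).comp g) - Pi.single n (g.comp (dL n)) := by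
    ext1 m
    rw [chainδ_apply, Pi.sub_apply]
    congr 1
    · by_cases hm : m = n + 1
      · subst hm
        rw [Pi.single_eq_same, Pi.single_eq_same]
      · rw [Pi.single_eq_of_ne hm, Pi.single_eq_of_ne hm, LinearMap.comp_zero]
    · by_cases hm : m = n
      · subst hm
        rw [Pi.single_eq_same, Pi.single_eq_same]
      · rw [Pi.single_eq_of_ne hm, Pi.single_eq_of_ne (by omega), LinearMap.zero_comp]
  rw [h2, map_sub] at h1
  rw [hθ, hθ, ← one_mul (tr k (b (n + 1)) (x (n + 1)) g), ← sgn_mul_self k (n + 1), mul_assoc,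
    ← h1, sgn_succ]
  ring

end Chain

end DerEq

namespace DerEq

open CategoryTheory Limits HomologicalComplex DerivedCategory

universe w w'

section Null

variable {R : Type u} [Ring R]

/-- A chain map is null homotopic. -/
def Null {K L : CochainComplex (ModuleCat.{u} R) ℤ} (f : K ⟶ L) : Prop := Nonempty (Homotopy f 0)

lemma Null.comp {K L M : CochainComplex (ModuleCat.{u} R) ℤ} {f : K ⟶ L} (h : Null f) (g : L ⟶ M) :
    Null (f ≫ g) := by
  obtain ⟨h⟩ := h
  exact ⟨(h.compRight g).trans (Homotopy.ofEq zero_comp)⟩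

lemma null_iff {K L : CochainComplex (ModuleCat.{u} R) ℤ} (f : K ⟶ L) :
    Null f ↔ ∃ h : ∀ n, K.X (n + 1) →ₗ[R] L.X n, ∀ n,
      (f.f (n + 1)).hom = (L.d n (n + 1)).hom.comp (h n) +
        (h (n + 1)).comp (K.d (n + 1) (n + 1 + 1)).hom := by
  constructor
  · rintro ⟨H⟩
    refine ⟨fun n => (H.hom (n + 1) n).hom, fun n => ?_⟩
    have h := H.comm (n + 1)
    rw [dNext_eq H.hom (i := n + 1) (i' := n + 1 + 1) rfl,
      prevD_eq H.hom (j := n + 1) (j' := n) rfl, HomologicalComplex.zero_f, add_zero] at h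
    exact (congrArg ModuleCat.Hom.hom h).trans (add_comm _ _)
  · rintro ⟨h, hh⟩
    let h' : ∀ i j, (ComplexShape.up ℤ).Rel j i → (K.X i ⟶ L.X j) := fun i j hij =>
      (K.XIsoOfEq hij.symm).hom ≫ ModuleCat.ofHom (h j)
    have e : f = Homotopy.nullHomotopicMap' h' := by
      ext1 i
      obtain ⟨n, rfl⟩ : ∃ n, i = n + 1 := ⟨i - 1, by omega⟩
      rw [Homotopy.nullHomotopicMap'_f (k₂ := n) (k₁ := n + 1) (k₀ := n + 1 + 1) rfl rfl]
      refine ModuleCat.hom_ext ((hh n).trans ?_)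
      have e1 : h' (n + 1) n rfl = ModuleCat.ofHom (h n) := Category.id_comp _
      have e2 : h' (n + 1 + 1) (n + 1) rfl = ModuleCat.ofHom (h (n + 1)) := Category.id_comp _
      rw [e1, e2]
      exact add_comm _ _
    exact ⟨(Homotopy.ofEq e).trans (Homotopy.nullHomotopy' h')⟩

/-- Chain maps from families of linear maps. -/
def mkHom {K L : CochainComplex (ModuleCat.{u} R) ℤ} (f : ∀ n, K.X n →ₗ[R] L.X n)
    (hf : ∀ n, (L.d n (n + 1)).hom.comp (f n) = (f (n + 1)).comp (K.d n (n + 1)).hom) : K ⟶ L where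
  f n := ModuleCat.ofHom (f n)
  comm' i j hij := by
    obtain rfl : i + 1 = j := hij
    exact ModuleCat.hom_ext (hf i)

lemma hom_comm {K L : CochainComplex (ModuleCat.{u} R) ℤ} (f : K ⟶ L) (n : ℤ) :
    (L.d n (n + 1)).hom.comp (f.f n).hom = (f.f (n + 1)).hom.comp (K.d n (n + 1)).hom :=
  congrArg ModuleCat.Hom.hom (f.comm n (n + 1))

end Null

section IndC

variable (k : Type u) [Field k] {A : Type u} [Ring A] [Algebra k A]

/-- The induction functor. -/
noncomputable def indF : ModuleCat.{u} A ⥤ ModuleCat.{u} (Paper.TrivExt k A) where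
  obj M := ModuleCat.of _ (IndM k (A := A) M)
  map f := ModuleCat.ofHom (IndM.map k f.hom)
  map_id _ := rfl
  map_comp _ _ := rfl

instance : (indF k (A := A)).Additive where
  map_add {M N f g} := by
    refine ModuleCat.hom_ext (LinearMap.ext fun p => IndM.ext' rfl ?_)
    refine (Nu.ev k).injective (LinearMap.ext fun ψ => ?_)
    exact (congrArg (Nu.ev k p.snd) (LinearMap.ext fun m => ψ.map_add _ _)).trans
      (map_add (Nu.ev k p.snd) _ _)

/-- Induction for complexes. -/
noncomputable abbrev indC : CochainComplex (ModuleCat.{u} A) ℤ ⥤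
    CochainComplex (ModuleCat.{u} (Paper.TrivExt k A)) ℤ :=
  (indF k).mapHomologicalComplex _

lemma IsPerf.dbasis {m : ℕ} {K : CochainComplex (ModuleCat.{u} A) ℤ} (hK : IsPerf m K) :
    Nonempty (∀ n, DBasis A (K.X n)) :=
  ⟨fun n => (hK.fp n).dbasis.some⟩

lemma IsPerf.ind {m : ℕ} {K : CochainComplex (ModuleCat.{u} A) ℤ} (hK : IsPerf m K) :
    IsPerf m ((indC k).obj K) := by
  obtain ⟨b⟩ := hK.dbasis
  exact ⟨fun n => ((b n).ind k).fp (M := ModuleCat.of _ (IndM k (A := A) (K.X n))),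
    fun n hn => (indF k).map_isZero (hK.zero n hn)⟩

/-- Restriction for complexes. -/
noncomputable abbrev resC : CochainComplex (ModuleCat.{u} (Paper.TrivExt k A)) ℤ ⥤
    CochainComplex (ModuleCat.{u} A) ℤ :=
  (ModuleCat.restrictScalars
    (TrivSqZeroExt.inlHom A (Module.Dual k A))).mapHomologicalComplex _

lemma null_of_ind {m : ℕ} {K : CochainComplex (ModuleCat.{u} A) ℤ} (hK : IsPerf m K)
    {L : CochainComplex (ModuleCat.{u} (Paper.TrivExt k A)) ℤ}
    (h : ∀ f : (indC k).obj K ⟶ L, Null f) (g : K ⟶ (resC k).obj L) : Null g := by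
  obtain ⟨b⟩ := hK.dbasis
  let σ := TrivSqZeroExt.inlHom A (Module.Dual k A)
  let e : ∀ n, K.X n →ₛₗ[σ] L.X n := fun n => (ModuleCat.semilinearMapAddEquiv σ _ _).symm (g.f n)
  have he : ∀ n x, e n x = (g.f n).hom x := fun n x => rfl
  choose f hf using fun n => (b n).exists_ext k (L := L.X n) (e n)
  have hcomm : ∀ n, (L.d n (n + 1)).hom.comp (f n) =
      (f (n + 1)).comp (((indC k).obj K).d n (n + 1)).hom := fun n => by
    refine (b n).ind_ext k fun x => ?_
    have h1 : (((indC k).obj K).d n (n + 1)).hom (IndM.inl k x) =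
      IndM.inl k ((K.d n (n + 1)).hom x) := IndM.map_inl k _ x
    change (L.d n (n + 1)).hom (f n (IndM.inl k x)) =
      f (n + 1) ((((indC k).obj K).d n (n + 1)).hom (IndM.inl k x))
    rw [h1, hf, hf, he, he]
    exact LinearMap.congr_fun (hom_comm g n) x
  obtain ⟨H, hH⟩ := (null_iff _).1 (h (mkHom f hcomm))
  refine (null_iff _).2 ⟨fun n => (ModuleCat.semilinearMapAddEquiv σ (K.X (n + 1)) (L.X n)
    ((H n).comp (IndM.inl k))).hom, fun n => LinearMap.ext fun x => ?_⟩
  have h1 : (((indC k).obj K).d (n + 1) (n + 1 + 1)).hom (IndM.inl k x) =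
      IndM.inl k ((K.d (n + 1) (n + 1 + 1)).hom x) := IndM.map_inl k _ x
  have h2 := LinearMap.congr_fun (hH n) (IndM.inl k x)
  have h3 : (g.f (n + 1)).hom x = ((mkHom (K := (indC k).obj K) f hcomm).f (n + 1)).hom (IndM.inl k x) :=
    (hf (n + 1) x).symm
  have h4 : (L.d n (n + 1)).hom (H n (IndM.inl k x)) +
      H (n + 1) ((((indC k).obj K).d (n + 1) (n + 1 + 1)).hom (IndM.inl k x)) =
      (L.d n (n + 1)).hom (H n (IndM.inl k x)) +
        H (n + 1) (IndM.inl k ((K.d (n + 1) (n + 1 + 1)).hom x)) :=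
    congrArg₂ (· + ·) rfl (congrArg (H (n + 1)) h1)
  exact h3.trans (h2.trans h4)

end IndC

end DerEq

namespace DerEq

open CategoryTheory Limits HomologicalComplex DerivedCategory

open scoped ModuleCat

universe w w'

section ChainBoundary

variable (k : Type u) [Field k] {A : Type u} [Ring A] [Algebra k A]
variable {K : ℤ → Type u} [∀ n, AddCommGroup (K n)] [∀ n, Module A (K n)] [∀ n, Module k (K n)]
  [∀ n, IsScalarTower k A (K n)]
  {L : ℤ → Type u} [∀ n, AddCommGroup (L n)] [∀ n, Module A (L n)] [∀ n, Module k (L n)]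
  [∀ n, IsScalarTower k A (L n)]
  (dK : ∀ n, K n →ₗ[A] K (n + 1)) (dL : ∀ n, L n →ₗ[A] L (n + 1))
  (b : ∀ n, DBasis A (L n)) (T : Finset ℤ) (hT : ∀ n, n ∉ T → Subsingleton (L n))

include hT in
/-- The functional of a null homotopic family vanishes on chain maps. -/
lemma chainTr_boundary {x : ∀ n, K n →ₗ[A] Nu k (A := A) (L n)} {g : ∀ n, L n →ₗ[A] K n}
    {h : ∀ n, K (n + 1) →ₗ[A] Nu k (A := A) (L n)}
    (hx : ∀ n, x (n + 1) = (Nu.map k (dL n)).comp (h n) + (h (n + 1)).comp (dK (n + 1)))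
    (hg : ∀ n, (dK n).comp (g n) = (g (n + 1)).comp (dL n)) :
    chainTr k b T x g = 0 := by
  let c : ℤ → k := fun n => sgn k n * tr k (b n) ((h n).comp (dK n)) (g n)
  have hb : ∀ n, tr k (b (n + 1)) ((Nu.map k (dL n)).comp (h n)) (g (n + 1)) =
      tr k (b n) ((h n).comp (dK n)) (g n) := fun n => by
    rw [tr_map_comp k (b n), tr_comp]
    exact congrArg (tr k (b n) (h n)) (hg n).symm
  have hc : c.HasFiniteSupport := by
    refine T.finite_toSet.subset fun n hn => ?_
    by_contra hc
    have := hT n hc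
    refine hn ?_
    have h0 : g n = 0 := LinearMap.ext fun y => by
      rw [Subsingleton.elim y 0, map_zero, map_zero]
    change sgn k n * tr k (b n) ((h n).comp (dK n)) (g n) = 0
    rw [h0, map_zero, mul_zero]
  have hc' : (fun n => c (n + 1)).HasFiniteSupport :=
    hc.preimage ((Equiv.addRight (1 : ℤ)).injective.injOn)
  have h1 : ∀ n, sgn k (n + 1) * tr k (b (n + 1)) (x (n + 1)) (g (n + 1)) = c (n + 1) - c n := by
    intro n
    rw [hx, map_add, LinearMap.add_apply, hb]
    change _ = sgn k (n + 1) * _ - sgn k n * _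
    rw [sgn_succ]
    ring
  rw [chainTr_eq_finsum k b T hT, ← finsum_comp_equiv (Equiv.addRight (1 : ℤ))]
  refine (finsum_congr h1).trans ?_
  rw [finsum_sub_distrib hc' hc]
  exact sub_eq_zero.2 (finsum_comp_equiv (f := c) (Equiv.addRight (1 : ℤ)))

end ChainBoundary

section IndHom

variable (k : Type u) [Field k] {A : Type u} [Ring A] [Algebra k A]
variable {K L M : CochainComplex (ModuleCat.{u} A) ℤ}

/-- The components of a chain map of induced complexes. -/
noncomputable def icomp (f : (indC k).obj K ⟶ (indC k).obj L) (n : ℤ) :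
    IndM k (A := A) (K.X n) →ₗ[Paper.TrivExt k A] IndM k (A := A) (L.X n) := (f.f n).hom

lemma icomp_comm (f : (indC k).obj K ⟶ (indC k).obj L) (n : ℤ) :
    (IndM.map k (L.d n (n + 1)).hom).comp (icomp k f n) =
      (icomp k f (n + 1)).comp (IndM.map k (K.d n (n + 1)).hom) := hom_comm f n

/-- The first part of a chain map of induced complexes. -/
noncomputable def prC (f : (indC k).obj K ⟶ (indC k).obj L) : K ⟶ L :=
  mkHom (fun n => IndM.pr k (icomp k f n)) fun n => LinearMap.ext fun m =>
    congrArg IndM.fst (LinearMap.congr_fun (icomp_comm k f n) (IndM.inl k m))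

/-- The second part of a chain map of induced complexes. -/
noncomputable def pxC (f : (indC k).obj K ⟶ (indC k).obj L) (n : ℤ) :
    K.X n →ₗ[A] Nu k (A := A) (L.X n) := IndM.px k (icomp k f n)

lemma pxC_comm (f : (indC k).obj K ⟶ (indC k).obj L) (n : ℤ) :
    (pxC k f (n + 1)).comp (K.d n (n + 1)).hom = (Nu.map k (L.d n (n + 1)).hom).comp (pxC k f n) :=
  LinearMap.ext fun m =>
    (congrArg IndM.snd (LinearMap.congr_fun (icomp_comm k f n) (IndM.inl k m))).symm

lemma prC_comp (b : ∀ n, DBasis A (L.X n)) (f : (indC k).obj K ⟶ (indC k).obj L)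
    (g : (indC k).obj L ⟶ (indC k).obj M) : prC k (f ≫ g) = prC k f ≫ prC k g :=
  HomologicalComplex.hom_ext _ _ fun n => ModuleCat.hom_ext
    (IndM.pr_comp k (b n) (icomp k g n) (icomp k f n))

lemma pxC_comp (b : ∀ n, DBasis A (L.X n)) (f : (indC k).obj K ⟶ (indC k).obj L)
    (g : (indC k).obj L ⟶ (indC k).obj M) (n : ℤ) : pxC k (f ≫ g) n =
      (pxC k g n).comp ((prC k f).f n).hom +
        (Nu.map k ((prC k g).f n).hom).comp (pxC k f n) :=
  IndM.px_comp k (b n) (icomp k g n) (icomp k f n)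

lemma exists_prC_pxC (b : ∀ n, DBasis A (K.X n)) (r : K ⟶ L)
    (x : ∀ n, K.X n →ₗ[A] Nu k (A := A) (L.X n))
    (hx : ∀ n, (x (n + 1)).comp (K.d n (n + 1)).hom = (Nu.map k (L.d n (n + 1)).hom).comp (x n)) :
    ∃ f : (indC k).obj K ⟶ (indC k).obj L, prC k f = r ∧ pxC k f = x := by
  choose f hf hf' using fun n => IndM.exists_pr_px k (b n) (r.f n).hom (x n)
  refine ⟨mkHom (K := (indC k).obj K) (L := (indC k).obj L) f fun n =>
    (b n).ind_ext k fun m => ?_, ?_, ?_⟩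
  · have h1 : IndM.map k (L.d n (n + 1)).hom (f n (IndM.inl k m)) =
        f (n + 1) (IndM.inl k ((K.d n (n + 1)).hom m)) := by
      refine IndM.ext' ?_ ?_
      · have e1 := LinearMap.congr_fun (hf n) m
        have e2 := LinearMap.congr_fun (hf (n + 1)) ((K.d n (n + 1)).hom m)
        refine (congrArg (L.d n (n + 1)).hom e1).trans (Eq.trans ?_ e2.symm)
        exact LinearMap.congr_fun (hom_comm r n) m
      · have e1 := LinearMap.congr_fun (hf' n) m
        have e2 := LinearMap.congr_fun (hf' (n + 1)) ((K.d n (n + 1)).hom m)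
        refine (congrArg (Nu.map k (L.d n (n + 1)).hom) e1).trans (Eq.trans ?_ e2.symm)
        exact (LinearMap.congr_fun (hx n) m).symm
    refine h1.trans (congrArg (f (n + 1)) ?_)
    exact (IndM.map_inl k _ m).symm
  · exact HomologicalComplex.hom_ext _ _ fun n => ModuleCat.hom_ext (hf n)
  · exact funext hf'

/-- The functional on chain maps given by a chain map of induced complexes. -/
noncomputable def icTr (b : ∀ n, DBasis A (L.X n)) (T : Finset ℤ)
    (f : (indC k).obj K ⟶ (indC k).obj L) (g : L ⟶ K) : k :=
  chainTr k (K := fun n => K.X n) (L := fun n => L.X n) b T (pxC k f) fun n => (g.f n).hom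

variable (b : ∀ n, DBasis A (L.X n)) (T : Finset ℤ) (hT : ∀ n, n ∉ T → Subsingleton (L.X n))

include hT in
lemma icTr_null (f : (indC k).obj K ⟶ (indC k).obj L) {g : L ⟶ K} (hg : Null g) :
    icTr k b T f g = 0 := by
  obtain ⟨h, hh⟩ := (null_iff _).1 hg
  exact chainTr_null k (K := fun n => K.X n) (L := fun n => L.X n)
    (fun n => (K.d n (n + 1)).hom) (fun n => (L.d n (n + 1)).hom) b T hT (pxC_comm k f) (h := h) hh

include hT in
lemma icTr_of_null {f : (indC k).obj K ⟶ (indC k).obj L} (hf : Null f) (bK : ∀ n, DBasis A (K.X n))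
    (g : L ⟶ K) : icTr k b T f g = 0 := by
  obtain ⟨H, hH⟩ := (null_iff _).1 hf
  refine chainTr_boundary k (K := fun n => K.X n) (L := fun n => L.X n)
    (fun n => (K.d n (n + 1)).hom) (fun n => (L.d n (n + 1)).hom) b T hT
    (h := fun n => IndM.px k (H n)) (fun n => ?_) (hom_comm g)
  have h1 := congrArg (IndM.px k) (hH n)
  refine h1.trans ((map_add _ _ _).trans ?_)
  have e1 := IndM.px_comp k (b n) (IndM.map k (L.d n (n + 1)).hom) (H n)
  have e2 := IndM.px_comp k (bK (n + 1 + 1)) (H (n + 1))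
    (IndM.map k (K.d (n + 1) (n + 1 + 1)).hom)
  rw [IndM.px_map, LinearMap.zero_comp, zero_add, IndM.pr_map] at e1
  rw [IndM.px_map, LinearMap.comp_zero, add_zero, IndM.pr_map] at e2
  exact congrArg₂ (· + ·) e1 e2

lemma prC_of_null {f : (indC k).obj K ⟶ (indC k).obj L} (hf : Null f)
    (bK : ∀ n, DBasis A (K.X n)) (b : ∀ n, DBasis A (L.X n)) : Null (prC k f) := by
  obtain ⟨H, hH⟩ := (null_iff _).1 hf
  refine (null_iff _).2 ⟨fun n => IndM.pr k (H n), fun n => ?_⟩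
  refine (congrArg (IndM.pr k) (hH n)).trans ((map_add _ _ _).trans ?_)
  exact congrArg₂ (· + ·) (IndM.pr_comp k (b n) (IndM.map k (L.d n (n + 1)).hom) (H n))
    (IndM.pr_comp k (bK (n + 1 + 1)) (H (n + 1)) (IndM.map k (K.d (n + 1) (n + 1 + 1)).hom))

include hT in
lemma null_of_prC_icTr (bK : ∀ n, DBasis A (K.X n)) {f : (indC k).obj K ⟶ (indC k).obj L}
    (hf : Null (prC k f)) (hf' : ∀ g : L ⟶ K, icTr k b T f g = 0) : Null f := by
  obtain ⟨h, hh⟩ := (null_iff _).1 hf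
  obtain ⟨h', hh'⟩ := null_of_chainTr k (K := fun n => K.X n) (L := fun n => L.X n)
    (fun n => (K.d n (n + 1)).hom) (fun n => (L.d n (n + 1)).hom) b T hT (x := pxC k f)
    fun g hg => hf' (mkHom g hg)
  choose H e e' using fun n => IndM.exists_pr_px k (bK (n + 1)) (h n) (h' n)
  refine (null_iff _).2 ⟨H, fun n => IndM.ext_pr_px k (bK (n + 1)) ?_ ?_⟩
  · refine (hh n).trans (Eq.trans ?_ (map_add (IndM.pr k) _ _).symm)
    have e1 := IndM.pr_comp k (b n) (IndM.map k (L.d n (n + 1)).hom) (H n)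
    have e2 := IndM.pr_comp k (bK (n + 1 + 1)) (H (n + 1))
      (IndM.map k (K.d (n + 1) (n + 1 + 1)).hom)
    rw [e, IndM.pr_map] at e1 e2
    exact (congrArg₂ (· + ·) e1 e2).symm
  · refine (hh' n).trans (Eq.trans ?_ (map_add (IndM.px k) _ _).symm)
    have e1 := IndM.px_comp k (b n) (IndM.map k (L.d n (n + 1)).hom) (H n)
    have e2 := IndM.px_comp k (bK (n + 1 + 1)) (H (n + 1))
      (IndM.map k (K.d (n + 1) (n + 1 + 1)).hom)
    rw [IndM.px_map, LinearMap.zero_comp, zero_add, IndM.pr_map, e'] at e1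
    rw [IndM.px_map, LinearMap.comp_zero, add_zero, IndM.pr_map, e'] at e2
    exact (congrArg₂ (· + ·) e1 e2).symm

end IndHom

end DerEq

namespace DerEq

open CategoryTheory Limits HomologicalComplex DerivedCategory

open scoped ModuleCat

universe w w'

section VanInd

variable (k : Type u) [Field k] {A : Type u} [Ring A] [Algebra k A]
variable [HasDerivedCategory.{w} (ModuleCat.{u} A)]
  [HasDerivedCategory.{w'} (ModuleCat.{u} (Paper.TrivExt k A))]

lemma Null.of_comp_inv {R : Type u} [Ring R] {K L M : CochainComplex (ModuleCat.{u} R) ℤ}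
    {f : K ⟶ L} (e : L ≅ M) (h : Null (f ≫ e.hom)) : Null f := by
  have := h.comp e.inv
  rwa [Category.assoc, e.hom_inv_id, Category.comp_id] at this

lemma van_res_of_ind {m : ℕ} {K : CochainComplex (ModuleCat.{u} A) ℤ} (hK : IsPerf m K)
    (L : CochainComplex (ModuleCat.{u} (Paper.TrivExt k A)) ℤ) (j : ℤ)
    (h : Van (Q.obj ((indC k).obj K)) (Q.obj L) j) : Van (Q.obj K) (Q.obj ((resC k).obj L)) j := by
  have := hK.isKProjective
  have := (hK.ind k).isKProjective
  rw [van_Q_iff] at h ⊢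
  intro g
  let e : (resC k).obj (L⟦j⟧) ≅ ((resC k).obj L)⟦j⟧ := ((resC k).commShiftIso j).app L
  exact Null.of_comp_inv e.symm (null_of_ind k hK h (g ≫ e.inv))

lemma exactAt_of_res {L : CochainComplex (ModuleCat.{u} (Paper.TrivExt k A)) ℤ} {n : ℤ}
    (h : ((resC k).obj L).ExactAt n) : L.ExactAt n :=
  (exactAt_iff L n).2 fun x hx => (exactAt_iff ((resC k).obj L) n).1 h x hx

lemma van_reg_of_ind {m : ℕ} {K : CochainComplex (ModuleCat.{u} A) ℤ} (hK : IsPerf m K) {w : ℕ}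
    (ht : ∀ (X : DerivedCategory (ModuleCat.{u} A)) (i : ℤ),
      (∀ j, i - w ≤ j → j ≤ i + w → Van (Q.obj K) X j) → Van (reg A) X i)
    (X : DerivedCategory (ModuleCat.{u} (Paper.TrivExt k A))) (i : ℤ)
    (h : ∀ j, i - w ≤ j → j ≤ i + w → Van (Q.obj ((indC k).obj K)) X j) :
    Van (reg (Paper.TrivExt k A)) X i := by
  obtain ⟨L, ⟨e⟩⟩ := exists_iso_Q X
  refine Van.of_iso e.symm ((van_reg_Q_iff L i).2 (exactAt_of_res k ?_))
  exact (van_reg_Q_iff _ i).1 (ht _ i fun j h1 h2 =>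
    van_res_of_ind k hK L j (Van.of_iso e (h j h1 h2)))

lemma IsPerf.subsingleton {R : Type u} [Ring R] {m : ℕ} {K : CochainComplex (ModuleCat.{u} R) ℤ}
    (hK : IsPerf m K) (n : ℤ) (hn : n ∉ Finset.Icc (-(m : ℤ)) m) : Subsingleton (K.X n) :=
  ModuleCat.subsingleton_of_isZero (hK.zero n (by rw [Finset.mem_Icc] at hn; omega))

lemma null_of_van {K L : CochainComplex (ModuleCat.{u} A) ℤ} [K.IsKProjective] {j : ℤ}
    (h : Van (Q.obj K) (Q.obj L) j) (f : K ⟶ L⟦j⟧) : Null f :=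
  (van_Q_iff j).1 h f

lemma null_of_van_shift {m : ℕ} {K : CochainComplex (ModuleCat.{u} A) ℤ} (hK : IsPerf m K)
    {L : CochainComplex (ModuleCat.{u} A) ℤ} {j : ℤ}
    (h : Van (Q.obj K) (Q.obj L) (-j)) (g : K⟦j⟧ ⟶ L) : Null g := by
  have := (hK.shift j).isKProjective
  refine (Q_map_eq_zero_iff g).1 ?_
  let f : (Q.obj K)⟦j⟧ ⟶ (Q.obj L)⟦(0 : ℤ)⟧ :=
    (Q.commShiftIso j).inv.app K ≫ Q.map g ≫ (shiftFunctorZero _ ℤ).inv.app (Q.obj L)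
  have hf : f = 0 := van_shift_eq_zero _ _ 0 j (by rwa [zero_sub]) f
  have h2 : Q.map g = (Q.commShiftIso j).hom.app K ≫ f ≫ (shiftFunctorZero _ ℤ).hom.app (Q.obj L) := by
    simp [f]
  rw [h2, hf, zero_comp, comp_zero]

lemma van_ind {m : ℕ} {K : CochainComplex (ModuleCat.{u} A) ℤ} (hK : IsPerf m K)
    (hv : ∀ j : ℤ, j ≠ 0 → Van (Q.obj K) (Q.obj K) j) (j : ℤ) (hj : j ≠ 0) :
    Van (Q.obj ((indC k).obj K)) (Q.obj ((indC k).obj K)) j := by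
  have := hK.isKProjective
  have := (hK.ind k).isKProjective
  rw [van_Q_iff]
  intro f
  let e : (indC k).obj (K⟦j⟧) ≅ ((indC k).obj K)⟦j⟧ := ((indC k).commShiftIso j).app K
  obtain ⟨bK⟩ := hK.dbasis
  obtain ⟨b⟩ := (hK.shift j).dbasis
  refine Null.of_comp_inv e.symm (null_of_prC_icTr k b _ (hK.shift j).subsingleton bK
    (null_of_van (hv j hj) _) fun g => ?_)
  exact icTr_null k b _ (hK.shift j).subsingleton _ (null_of_van_shift hK (hv (-j) (by omega)) g)

end VanInd

end DerEq

namespace DerEq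

open CategoryTheory Limits HomologicalComplex DerivedCategory

open scoped ModuleCat

universe w w'

section FiniteHom

variable (k : Type u) [Field k] {A : Type u} [Ring A] [Algebra k A]
  {m : ℕ} {K : CochainComplex (ModuleCat.{u} A) ℤ}

/-- The components of a chain map in a finite range. -/
def homPiT (K L : CochainComplex (ModuleCat.{u} A) ℤ) (T : Finset ℤ) :
    (K ⟶ L) →ₗ[k] (∀ n : T, K.X n →ₗ[A] L.X n) where
  toFun g n := (g.f n).hom
  map_add' _ _ := rfl
  map_smul' _ _ := rfl

lemma finite_linearMap [Module.Finite k A] (M N : ModuleCat.{u} A) [Module.Finite A M]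
    [Module.Finite A N] : Module.Finite k (M →ₗ[A] N) := by
  have : Module.Finite k M := Module.Finite.trans A M
  have : Module.Finite k N := Module.Finite.trans A N
  let r : (M →ₗ[A] N) →ₗ[k] (M →ₗ[k] N) :=
    { toFun := fun f => f.restrictScalars k
      map_add' := fun _ _ => rfl
      map_smul' := fun _ _ => rfl }
  exact Module.Finite.of_injective r (LinearMap.restrictScalars_injective k)

lemma finite_hom [Module.Finite k A] (hK : IsPerf m K) {L : CochainComplex (ModuleCat.{u} A) ℤ}
    (hL : ∀ n, Module.Finite A (L.X n)) : Module.Finite k (K ⟶ L) := by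
  have := fun n => (hK.fp n).2
  have := fun n => finite_linearMap k (K.X n) (L.X n)
  refine Module.Finite.of_injective (homPiT k K L (Finset.Icc (-(m : ℤ)) m)) fun f g h => ?_
  refine HomologicalComplex.hom_ext _ _ fun n => ModuleCat.hom_ext ?_
  by_cases hn : n ∈ Finset.Icc (-(m : ℤ)) m
  · exact congrFun h ⟨n, hn⟩
  · have := hK.subsingleton n hn
    exact LinearMap.ext fun x => by rw [Subsingleton.elim x 0, map_zero, map_zero]

end FiniteHom

section RingIso

variable (k : Type u) [Field k] {A : Type u} [Ring A] [Algebra k A]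
variable [HasDerivedCategory.{u} (ModuleCat.{u} A)]

/-- The opposite endomorphism algebra of a complex in the derived category. -/
abbrev EndQ (K : CochainComplex (ModuleCat.{u} A) ℤ) : Type u := (End (Q.obj K))ᵐᵒᵖ

variable {m : ℕ} {K : CochainComplex (ModuleCat.{u} A) ℤ} 

noncomputable instance : Algebra k (End (Q.obj K)) := inferInstance
noncomputable instance : Algebra k (EndQ K) := inferInstance

/-- The components of an endomorphism. -/
def homPi (K : CochainComplex (ModuleCat.{u} A) ℤ) : (K ⟶ K) →ₗ[k] (∀ n, K.X n →ₗ[A] K.X n) where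
  toFun g n := (g.f n).hom
  map_add' _ _ := rfl
  map_smul' _ _ := rfl

lemma homPi_injective : Function.Injective (homPi k K) := fun f g h =>
  HomologicalComplex.hom_ext _ _ fun n => ModuleCat.hom_ext (congrFun h n)

/-- The class of an endomorphism. -/
noncomputable def qOp (K : CochainComplex (ModuleCat.{u} A) ℤ) : (K ⟶ K) →ₗ[k] EndQ K where
  toFun g := MulOpposite.op (Q.map g)
  map_add' g h := congrArg MulOpposite.op (Functor.map_add Q)
  map_smul' c g := congrArg MulOpposite.op (CategoryTheory.Functor.map_smul Q c g)

lemma qOp_surjective [K.IsKProjective] : Function.Surjective (qOp k K) := fun s => by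
  obtain ⟨g, hg⟩ := Q_map_surjective s.unop
  exact ⟨g, congrArg MulOpposite.op hg⟩

lemma qOp_eq_zero_iff [K.IsKProjective] (g : K ⟶ K) : qOp k K g = 0 ↔ Null g :=
  (MulOpposite.op_eq_zero_iff _).trans (Q_map_eq_zero_iff g)

lemma qOp_comp (f g : K ⟶ K) : qOp k K (f ≫ g) = qOp k K f * qOp k K g :=
  congrArg MulOpposite.op (Q.map_comp f g)

lemma finite_endQ [Module.Finite k A] (hK : IsPerf m K) : Module.Finite k (EndQ K) := by
  have := hK.isKProjective
  have := finite_hom k hK fun n => (hK.fp n).2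
  exact Module.Finite.of_surjective _ (qOp_surjective k (K := K))

lemma exists_section [K.IsKProjective] : ∃ s : EndQ K →ₗ[k] (K ⟶ K), (qOp k K).comp s = .id :=
  LinearMap.exists_rightInverse_of_surjective _ (LinearMap.range_eq_top.2 (qOp_surjective k))

section Theta

variable [K.IsKProjective] (b : ∀ n, DBasis A (K.X n)) (T : Finset ℤ)
  (hT : ∀ n, n ∉ T → Subsingleton (K.X n))

/-- The functional on the endomorphism algebra given by an endomorphism of the induced complex. -/
noncomputable def theta (f : (indC k).obj K ⟶ (indC k).obj K) : Module.Dual k (EndQ K) :=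
  ((chainTr k (K := fun n => K.X n) (L := fun n => K.X n) b T (pxC k f)).comp (homPi k K)).comp
    (exists_section k).choose

include hT in
lemma theta_qOp (f : (indC k).obj K ⟶ (indC k).obj K) (g : K ⟶ K) :
    theta k b T f (qOp k K g) = icTr k b T f g := by
  let s := (exists_section k (K := K)).choose
  have hs : ∀ x, qOp k K (s x) = x := LinearMap.congr_fun (exists_section k (K := K)).choose_spec
  have h1 : Null (s (qOp k K g) - g) := by
    rw [← qOp_eq_zero_iff k, map_sub, hs, sub_self]
  have h2 := icTr_null k b T hT f h1
  have h3 : icTr k b T f (s (qOp k K g) - g) = icTr k b T f (s (qOp k K g)) - icTr k b T f g :=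
    map_sub ((chainTr k (K := fun n => K.X n) (L := fun n => K.X n) b T (pxC k f)).comp
      (homPi k K)) _ _
  exact sub_eq_zero.1 (h3.symm.trans h2)

lemma theta_add (f g : (indC k).obj K ⟶ (indC k).obj K) :
    theta k b T (f + g) = theta k b T f + theta k b T g := by
  refine LinearMap.ext fun s => ?_
  have h := map_add (chainTr k (K := fun n => K.X n) (L := fun n => K.X n) b T) (pxC k f) (pxC k g)
  exact LinearMap.congr_fun h _

include hT in
lemma theta_comp (f g : (indC k).obj K ⟶ (indC k).obj K) :
    theta k b T (f ≫ g) = qOp k K (prC k f) • theta k b T g +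
      MulOpposite.op (qOp k K (prC k g)) • theta k b T f := by
  refine LinearMap.ext fun s => ?_
  obtain ⟨s, rfl⟩ := qOp_surjective k s
  change _ = theta k b T g (qOp k K s * qOp k K (prC k f)) +
    theta k b T f (qOp k K (prC k g) * qOp k K s)
  rw [← qOp_comp, ← qOp_comp, theta_qOp k b T hT, theta_qOp k b T hT, theta_qOp k b T hT]
  have h : pxC k (f ≫ g) = (fun n => (pxC k g n).comp ((prC k f).f n).hom) +
      fun n => (Nu.map k ((prC k g).f n).hom).comp (pxC k f n) := funext (pxC_comp k b f g)
  have h1 := LinearMap.congr_fun (congrArg (chainTr k (K := fun n => K.X n) (L := fun n => K.X n) b T) h)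
    fun n => (s.f n).hom
  rw [map_add] at h1
  refine (h1.trans (LinearMap.add_apply _ _ _)).trans (congrArg₂ (· + ·) ?_ ?_)
  · exact chainTr_comp k b T (K := fun n => K.X n) (K' := fun n => K.X n) (L := fun n => K.X n) _ _ _
  · exact chainTr_map_comp k b T (K := fun n => K.X n) (L' := fun n => K.X n) (L := fun n => K.X n) b _ _ _

include hT in
/-- The comparison map to the trivial extension. -/
lemma exists_toTriv : ∃ φ : (End ((indC k).obj K))ᵐᵒᵖ →+* Paper.TrivExt k (EndQ K),
    ∀ f, φ f = (qOp k K (prC k f.unop), theta k b T f.unop) := by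
  have h1 : qOp k K (prC k (𝟙 ((indC k).obj K))) = 1 :=
    congrArg MulOpposite.op (Q.map_id K)
  have h2 : theta k b T (𝟙 ((indC k).obj K)) = 0 := by
    refine LinearMap.ext fun s => ?_
    obtain ⟨s, rfl⟩ := qOp_surjective k s
    rw [theta_qOp k b T hT]
    exact LinearMap.congr_fun
      (map_zero (chainTr k (K := fun n => K.X n) (L := fun n => K.X n) b T)) _
  have h3 : ∀ f g : (indC k).obj K ⟶ (indC k).obj K, qOp k K (prC k (f ≫ g)) =
      qOp k K (prC k f) * qOp k K (prC k g) := fun f g => by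
    rw [prC_comp k b, qOp_comp]
  have h4 : theta k b T (0 : (indC k).obj K ⟶ (indC k).obj K) = 0 := by
    have := theta_add k b T (0 : (indC k).obj K ⟶ (indC k).obj K) 0
    rwa [add_zero, left_eq_add] at this
  exact ⟨{
    toFun := fun f => (qOp k K (prC k f.unop), theta k b T f.unop)
    map_one' := Prod.ext h1 h2
    map_mul' := fun f g => Prod.ext (h3 f.unop g.unop) (theta_comp k b T hT f.unop g.unop)
    map_zero' := Prod.ext (map_zero (qOp k K)) h4
    map_add' := fun f g => Prod.ext (map_add (qOp k K) (prC k f.unop) (prC k g.unop))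
      (theta_add k b T f.unop g.unop) }, fun _ => rfl⟩

include hT in
lemma exists_theta (r : K ⟶ K) (ξ : Module.Dual k (EndQ K)) :
    ∃ f : (indC k).obj K ⟶ (indC k).obj K, prC k f = r ∧ theta k b T f = ξ := by
  obtain ⟨ρ, hρ⟩ := LinearMap.exists_leftInverse_of_injective (homPi k K)
    (LinearMap.ker_eq_bot.2 (homPi_injective k))
  have hρ' : ∀ g, ρ (homPi k K g) = g := LinearMap.congr_fun hρ
  obtain ⟨x, hx, hx'⟩ := exists_chainTr k (K := fun n => K.X n) (L := fun n => K.X n)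
    (fun n => (K.d n (n + 1)).hom) (fun n => (K.d n (n + 1)).hom) b T hT
    ((ξ.comp (qOp k K)).comp ρ) fun g h hg => by
      have : ∃ g' : K ⟶ K, homPi k K g' = g ∧ Null g' := by
        have hd : ∀ n, (K.d (n + 1) (n + 1 + 1)).hom.comp (K.d n (n + 1)).hom = 0 := fun n =>
          congrArg ModuleCat.Hom.hom (K.d_comp_d n (n + 1) (n + 1 + 1))
        have hg' : ∀ n, (K.d n (n + 1)).hom.comp (g n) = (g (n + 1)).comp (K.d n (n + 1)).hom := by
          intro i
          obtain ⟨n, rfl⟩ : ∃ n, i = n + 1 := ⟨i - 1, by omega⟩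
          rw [hg n, hg (n + 1), LinearMap.comp_add, LinearMap.add_comp, ← LinearMap.comp_assoc,
            hd n, LinearMap.zero_comp, zero_add, LinearMap.comp_assoc, LinearMap.comp_assoc,
            hd (n + 1), LinearMap.comp_zero, add_zero]
        exact ⟨mkHom g hg', rfl, (null_iff _).2 ⟨h, hg⟩⟩
      obtain ⟨g', rfl, hg'⟩ := this
      change ξ (qOp k K (ρ (homPi k K g'))) = 0
      rw [hρ', (qOp_eq_zero_iff k g').2 hg', map_zero]
  obtain ⟨f, hf, hf'⟩ := exists_prC_pxC k b r x hx
  refine ⟨f, hf, LinearMap.ext fun s => ?_⟩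
  obtain ⟨s, rfl⟩ := qOp_surjective k s
  rw [theta_qOp k b T hT, icTr, hf']
  refine (LinearMap.congr_fun hx' _).trans ?_
  exact congrArg (fun t => ξ (qOp k K t)) (hρ' s)

end Theta

theorem exists_ringEquiv_trivExt [HasDerivedCategory.{w} (ModuleCat.{u} (Paper.TrivExt k A))]
    (hK : IsPerf m K) : Nonempty ((End (Q.obj ((indC k).obj K)))ᵐᵒᵖ ≃+* Paper.TrivExt k (EndQ K)) := by
  have := hK.isKProjective
  have := (hK.ind k).isKProjective
  obtain ⟨b⟩ := hK.dbasis
  obtain ⟨φ, hφ⟩ := exists_toTriv k b _ hK.subsingleton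
  let ψ : (End ((indC k).obj K))ᵐᵒᵖ →+* (End (Q.obj ((indC k).obj K)))ᵐᵒᵖ :=
    { toFun := fun f => MulOpposite.op (Q.map f.unop)
      map_one' := congrArg MulOpposite.op (Q.map_id _)
      map_mul' := fun f g => congrArg MulOpposite.op (Q.map_comp _ _)
      map_zero' := congrArg MulOpposite.op (Functor.map_zero _ _ _)
      map_add' := fun f g => congrArg MulOpposite.op (Functor.map_add _) }
  have hψ : Function.Surjective ψ := fun s => by
    obtain ⟨g, hg⟩ := Q_map_surjective s.unop
    exact ⟨MulOpposite.op g, congrArg MulOpposite.op hg⟩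
  have hφ' : Function.Surjective φ := fun ⟨s, ξ⟩ => by
    obtain ⟨r, rfl⟩ := qOp_surjective k s
    obtain ⟨f, rfl, rfl⟩ := exists_theta k b _ hK.subsingleton r ξ
    exact ⟨MulOpposite.op f, hφ _⟩
  have hker : RingHom.ker φ = RingHom.ker ψ := by
    ext f
    rw [RingHom.mem_ker, RingHom.mem_ker, hφ]
    have h1 : ψ f = 0 ↔ Null f.unop :=
      (MulOpposite.op_eq_zero_iff _).trans (Q_map_eq_zero_iff f.unop)
    refine Iff.trans ?_ h1.symm
    constructor
    · intro h
      refine null_of_prC_icTr k b _ hK.subsingleton b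
        ((qOp_eq_zero_iff k _).1 (congrArg Prod.fst h)) fun g => ?_
      rw [← theta_qOp k b _ hK.subsingleton]
      exact LinearMap.congr_fun (congrArg Prod.snd h) _
    · intro h
      refine Prod.ext ((qOp_eq_zero_iff k _).2 (prC_of_null k h b b)) (LinearMap.ext fun s => ?_)
      obtain ⟨s, rfl⟩ := qOp_surjective k s
      exact (theta_qOp k b _ hK.subsingleton _ _).trans
        (icTr_of_null k b _ hK.subsingleton h b s)
  exact ⟨((RingHom.quotientKerEquivOfSurjective hψ).symm.trans
    (Ideal.quotEquivOfEq hker.symm)).trans (RingHom.quotientKerEquivOfSurjective hφ')⟩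

end RingIso

end DerEq

namespace DerEq

section Comm

variable (k₁ k₂ : Type u) [Field k₁] [Field k₂] (Z : Type u) [CommRing Z] [Algebra k₁ Z]
  [Algebra k₂ Z]

lemma mem_of_ker_le [Module.Finite k₁ Z] {u v : Module.Dual k₁ Z} (m : Ideal Z)
    (h : ∀ x, (∀ z, u (x * z) = 0) → x ∈ m) (hv : ∀ x ∈ m, v x = 0) : ∃ z : Z, z • u = v := by
  let l : Z →ₗ[k₁] Module.Dual k₁ Z :=
    { toFun := fun z => z • u
      map_add' := fun a b => add_smul a b u
      map_smul' := fun c z => LinearMap.ext fun x => by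
        change u (x * (c • z)) = c • u (x * z)
        rw [mul_smul_comm, map_smul] }
  have h1 : v ∈ (LinearMap.range l).dualCoannihilator.dualAnnihilator := by
    rw [Submodule.mem_dualAnnihilator]
    intro x hx
    rw [Submodule.mem_dualCoannihilator] at hx
    exact hv x (h x fun z => hx (l z) ⟨z, rfl⟩)
  rw [Subspace.dualCoannihilator_dualAnnihilator_eq] at h1
  exact h1

lemma exists_dual_maximal (m : Ideal Z) [m.IsMaximal] :
    ∃ v : Module.Dual k₁ Z, ∀ x : Z, x • v = 0 ↔ x ∈ m := by
  obtain ⟨v, hv, hv'⟩ := Submodule.exists_le_ker_of_notMem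
    (p := m.restrictScalars k₁) (v := (1 : Z)) ((Ideal.ne_top_iff_one m).1 Ideal.IsPrime.ne_top')
  have h1 : ∀ x ∈ m, x • v = 0 := fun x hx =>
    LinearMap.ext fun y => hv' (m.mul_mem_left y hx)
  refine ⟨v, fun x => ⟨fun hx => ?_, h1 x⟩⟩
  by_contra hm
  obtain ⟨y, i, hi, hy⟩ := (Ideal.IsMaximal.exists_inv (I := m) inferInstance hm)
  refine hv ?_
  rw [← hy, map_add]
  have e1 : v (y * x) = 0 := LinearMap.congr_fun hx y
  rw [e1, zero_add]
  exact hv' hi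

lemma exists_injective_dual [Module.Finite k₁ Z] :
    ∃ θ : Module.Dual k₁ Z →ₗ[Z] Module.Dual k₂ Z, Function.Injective θ := by
  choose e he using fun m : MaximalSpectrum Z => @exists_dual_maximal k₁ _ Z _ _ m.asIdeal m.isMaximal
  let I2 : Module k₂ (Module.Dual k₁ Z) := Module.compHom _ (algebraMap k₂ Z)
  have hsm : ∀ (c : k₂) (v : Module.Dual k₁ Z), c • v = algebraMap k₂ Z c • v := fun _ _ => rfl
  have hli : LinearIndependent k₂ e := by
    rw [linearIndependent_iff']
    intro s g hg i hi
    classical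
    obtain ⟨z, hz, hz'⟩ : ∃ z ∈ (s.erase i).inf fun j => j.asIdeal, z ∉ i.asIdeal := by
      refine SetLike.not_le_iff_exists.1 fun hle => ?_
      obtain ⟨j, hj, hj'⟩ := (Ideal.IsPrime.inf_le' (i.isMaximal.isPrime)).1 hle
      exact Finset.ne_of_mem_erase hj
        (MaximalSpectrum.ext (j.isMaximal.eq_of_le i.isMaximal.isPrime.ne_top hj'))
    have h1 : ∑ j ∈ s, g j • (z • e j) = 0 := by
      refine Eq.trans ?_ (congrArg (z • ·) hg)
      change _ = z • ∑ j ∈ s, g j • e j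
      rw [Finset.smul_sum]
      refine Finset.sum_congr rfl fun j _ => ?_
      rw [hsm, hsm, smul_smul, smul_smul, mul_comm]
    rw [Finset.sum_eq_single_of_mem i hi fun j hj hji => ?_] at h1
    · refine (smul_eq_zero.1 h1).resolve_right fun h => hz' ((he i z).1 h)
    · rw [(he j z).2 ?_, smul_zero]
      rw [Submodule.mem_finsetInf] at hz
      exact hz j (Finset.mem_erase.2 ⟨hji, hj⟩)
  obtain ⟨ρ, hρ⟩ := LinearMap.exists_leftInverse_of_injective _ (LinearMap.ker_eq_bot.2 hli)
  let l : Module.Dual k₁ Z →ₗ[k₂] k₂ := (Finsupp.linearCombination k₂ (fun _ => (1 : k₂))).comp ρ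
  have hl : ∀ m, l (e m) = 1 := fun m => by
    have := LinearMap.congr_fun hρ (Finsupp.single m 1)
    rw [LinearMap.comp_apply, Finsupp.linearCombination_single, one_smul] at this
    change Finsupp.linearCombination k₂ (fun _ => (1 : k₂)) (ρ (e m)) = 1
    rw [this]
    simp
  let θ : Module.Dual k₁ Z →ₗ[Z] Module.Dual k₂ Z :=
    { toFun := fun v =>
        { toFun := fun x => l (x • v)
          map_add' := fun x y => by rw [add_smul, map_add]
          map_smul' := fun c x => by
            rw [Algebra.smul_def, mul_smul, ← hsm, map_smul]
            rfl }
      map_add' := fun v v' => LinearMap.ext fun x => by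
        change l (x • (v + v')) = l (x • v) + l (x • v')
        rw [smul_add, map_add]
      map_smul' := fun z v => LinearMap.ext fun x => by
        change l (x • z • v) = l ((x * z) • v)
        rw [mul_smul] }
  refine ⟨θ, (injective_iff_map_eq_zero θ).2 fun u hu => ?_⟩
  by_contra hne
  let W : Ideal Z :=
    { carrier := {x | x • u = 0}
      add_mem' := fun {a b} ha hb => by
        change (a + b) • u = 0
        rw [add_smul, show a • u = 0 from ha, show b • u = 0 from hb, add_zero]
      zero_mem' := zero_smul _ _
      smul_mem' := fun c x hx => by
        change (c * x) • u = 0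
        rw [mul_smul, show x • u = 0 from hx, smul_zero] }
  obtain ⟨m, hm, hW⟩ := W.exists_le_maximal (by
    rw [Ideal.ne_top_iff_one]
    exact fun h => hne ((one_smul _ _).symm.trans h))
  obtain ⟨z, hz⟩ := mem_of_ker_le k₁ Z (u := u) (v := e ⟨m, hm⟩) m
    (fun x hx => hW (LinearMap.ext fun y => (congrArg u (mul_comm y x)).trans (hx y)))
    fun x hx => by
      have := LinearMap.congr_fun ((he ⟨m, hm⟩ x).2 hx) 1
      exact (congrArg (e ⟨m, hm⟩) (one_mul x)).symm.trans this
  have h1 : l (z • u) = 0 := LinearMap.congr_fun hu z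
  rw [hz, hl] at h1
  exact one_ne_zero h1

end Comm

section Bimod

variable (k₁ k₂ : Type u) [Field k₁] [Field k₂] (B : Type u) [Ring B] [Algebra k₁ B] [Algebra k₂ B]

lemma algebraMap_mem_center' (c : k₁) : algebraMap k₁ B c ∈ Subring.center B :=
  Subring.mem_center_iff.2 fun b => (Algebra.commutes c b).symm

/-- The center is an algebra over the ground field. -/
@[reducible]
def centerAlgebra : Algebra k₁ (Subring.center B) :=
  ((algebraMap k₁ B).codRestrict (Subring.center B) (algebraMap_mem_center' k₁ B)).toAlgebra

lemma exists_injective_dual_bimod [Module.Finite k₁ B] :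
    ∃ Φ : Module.Dual k₁ B →+ Module.Dual k₂ B, Function.Injective Φ ∧
      (∀ (b : B) φ, Φ (b • φ) = b • Φ φ) ∧
      (∀ (b : Bᵐᵒᵖ) φ, Φ (b • φ) = b • Φ φ) := by
  let _ := centerAlgebra k₁ B
  let _ := centerAlgebra k₂ B
  let ι₁ : Subring.center B →ₗ[k₁] B :=
    { toFun := fun z => z.1
      map_add' := fun _ _ => rfl
      map_smul' := fun c z => (Algebra.smul_def c z.1).symm }
  have hf : Module.Finite k₁ (Subring.center B) :=
    Module.Finite.of_injective ι₁ Subtype.val_injective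
  obtain ⟨θ, hθ⟩ := exists_injective_dual k₁ k₂ (Subring.center B)
  let res : B → Module.Dual k₁ B → Module.Dual k₁ (Subring.center B) := fun b φ =>
    (φ.comp (LinearMap.mulRight k₁ b)).comp ι₁
  have hres : ∀ b φ z, res b φ z = φ (z.1 * b) := fun _ _ _ => rfl
  have hres2 : ∀ b φ (z : Subring.center B), res (z.1 * b) φ = z • res b φ := fun b φ z =>
    LinearMap.ext fun x => by
      change φ (x.1 * (z.1 * b)) = φ (x.1 * z.1 * b)
      rw [mul_assoc]
  let Φ : Module.Dual k₁ B →+ Module.Dual k₂ B := AddMonoidHom.mk' (fun φ =>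
    { toFun := fun b => θ (res b φ) 1
      map_add' := fun b b' => by
        have : res (b + b') φ = res b φ + res b' φ := LinearMap.ext fun x => by
          change φ (x.1 * (b + b')) = φ (x.1 * b) + φ (x.1 * b')
          rw [mul_add, map_add]
        rw [this, map_add]
        rfl
      map_smul' := fun c b => by
        have h1 : c • b = (algebraMap k₂ (Subring.center B) c).1 * b := Algebra.smul_def c b
        rw [h1, hres2, map_smul]
        change θ (res b φ) (1 * algebraMap k₂ (Subring.center B) c) = c • θ (res b φ) 1
        rw [one_mul, Algebra.algebraMap_eq_smul_one, map_smul] }) fun φ φ' =>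
    LinearMap.ext fun b => by
      change θ (res b (φ + φ')) 1 = θ (res b φ) 1 + θ (res b φ') 1
      have : res b (φ + φ') = res b φ + res b φ' := rfl
      rw [this, map_add]
      rfl
  have hΦ : ∀ φ b, Φ φ b = θ (res b φ) 1 := fun _ _ => rfl
  refine ⟨Φ, (injective_iff_map_eq_zero Φ).2 fun φ hφ => LinearMap.ext fun b => ?_, fun b φ =>
    LinearMap.ext fun x => ?_, fun b φ => LinearMap.ext fun x => ?_⟩
  · have h1 : θ (res b φ) = 0 := LinearMap.ext fun z => by
      have h2 := LinearMap.congr_fun hφ (z.1 * b)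
      rw [hΦ, hres2, map_smul] at h2
      exact (congrArg (θ (res b φ)) (one_mul z)).symm.trans h2
    have h2 := LinearMap.congr_fun ((map_eq_zero_iff θ hθ).1 h1) 1
    exact (congrArg φ (one_mul b)).symm.trans h2
  · change θ (res x (b • φ)) 1 = θ (res (x * b) φ) 1
    congr 2
    refine LinearMap.ext fun z => ?_
    change φ (z.1 * x * b) = φ (z.1 * (x * b))
    rw [mul_assoc]
  · change θ (res x (b • φ)) 1 = θ (res (b.unop * x) φ) 1
    congr 2
    refine LinearMap.ext fun z => ?_
    change φ (b.unop * (z.1 * x)) = φ (z.1 * (b.unop * x))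
    rw [← mul_assoc, ← mul_assoc, Subring.mem_center_iff.1 z.2 b.unop]

lemma exists_bijective_dual_bimod [Module.Finite k₁ B] [Module.Finite k₂ B] :
    ∃ Φ : Module.Dual k₁ B →+ Module.Dual k₂ B, Function.Bijective Φ ∧
      (∀ (b : B) φ, Φ (b • φ) = b • Φ φ) ∧
      (∀ (b : Bᵐᵒᵖ) φ, Φ (b • φ) = b • Φ φ) := by
  obtain ⟨Φ, h1, h2, h3⟩ := exists_injective_dual_bimod k₁ k₂ B
  obtain ⟨Ψ, h1', -, -⟩ := exists_injective_dual_bimod k₂ k₁ B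
  obtain ⟨Ψ, h1', h2', h3'⟩ := exists_injective_dual_bimod k₂ k₁ B
  let E : Module.Dual k₂ B →ₗ[k₂] Module.Dual k₂ B :=
    { toFun := fun φ => Φ (Ψ φ)
      map_add' := fun _ _ => by rw [map_add, map_add]
      map_smul' := fun c φ => by
        have h : ∀ ψ : Module.Dual k₂ B, c • ψ = algebraMap k₂ B c • ψ := fun ψ =>
          LinearMap.ext fun x => by
            change c • ψ x = ψ (x * algebraMap k₂ B c)
            rw [← Algebra.commutes, ← Algebra.smul_def, map_smul]
        rw [h, h2', h2, RingHom.id_apply, h] }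
  have hE : Function.Injective E := h1.comp h1'
  have hE' : Function.Surjective E := LinearMap.injective_iff_surjective.1 hE
  exact ⟨Φ, ⟨h1, fun y => (hE' y).imp' Ψ fun _ h => h⟩, h2, h3⟩

variable {B} in
theorem trivExt_ringEquiv_of_algebra [Module.Finite k₁ B] [Module.Finite k₂ B] :
    Nonempty (Paper.TrivExt k₁ B ≃+* Paper.TrivExt k₂ B) := by
  obtain ⟨Φ, hΦ, h2, h3⟩ := exists_bijective_dual_bimod k₁ k₂ B
  let f : Paper.TrivExt k₁ B → Paper.TrivExt k₂ B := fun p => (p.1, Φ p.2)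
  refine ⟨RingEquiv.ofBijective
    ({ toFun := f
       map_one' := Prod.ext rfl (map_zero Φ)
       map_mul' := fun p q => Prod.ext rfl ((map_add Φ _ _).trans
        (congrArg₂ (· + ·) (h2 p.1 q.2) (h3 (MulOpposite.op q.1) p.2)))
       map_zero' := Prod.ext rfl (map_zero Φ)
       map_add' := fun p q => Prod.ext rfl (map_add Φ _ _) } :
       Paper.TrivExt k₁ B →+* Paper.TrivExt k₂ B) ?_⟩
  exact Function.bijective_id.prodMap hΦ

end Bimod

theorem trivExt_ringEquiv (k₁ k₂ : Type u) [Field k₁] [Field k₂] {B B' : Type u} [Ring B] [Ring B']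
    [Algebra k₁ B] [Algebra k₂ B'] [Module.Finite k₁ B] [Module.Finite k₂ B'] (e : B ≃+* B') :
    Nonempty (Paper.TrivExt k₁ B ≃+* Paper.TrivExt k₂ B') := by
  let _ : Algebra k₂ B := ((e.symm : B' →+* B).comp (algebraMap k₂ B')).toAlgebra' fun c x => by
    refine e.injective ?_
    rw [map_mul, map_mul]
    change e (e.symm (algebraMap k₂ B' c)) * e x = e x * e (e.symm (algebraMap k₂ B' c))
    rw [e.apply_symm_apply, Algebra.commutes]
  let E : B ≃ₗ[k₂] B' :=
    { e with
      map_smul' := fun c x => by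
        change e (c • x) = c • e x
        rw [Algebra.smul_def, map_mul, Algebra.smul_def]
        exact congrArg (· * e x) (e.apply_symm_apply _) }
  have : Module.Finite k₂ B := Module.Finite.equiv E.symm
  obtain ⟨ψ⟩ := trivExt_ringEquiv_of_algebra k₁ k₂ (B := B)
  have hE : ∀ x y, E.symm (x * y) = E.symm x * E.symm y := map_mul e.symm
  have hE' : ∀ x y, E (x * y) = E x * E y := map_mul e
  refine ⟨ψ.trans
    { toFun := fun p => (E p.1, p.2.comp E.symm.toLinearMap)
      invFun := fun p => (E.symm p.1, p.2.comp E.toLinearMap)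
      left_inv := fun p => Prod.ext (E.symm_apply_apply _)
        (LinearMap.ext fun x => congrArg p.2 (E.symm_apply_apply _))
      right_inv := fun p => Prod.ext (E.apply_symm_apply _)
        (LinearMap.ext fun x => congrArg p.2 (E.apply_symm_apply _))
      map_add' := fun p q => Prod.ext (map_add E _ _) rfl
      map_mul' := fun p q => Prod.ext (hE' _ _) (LinearMap.ext fun x => ?_) }⟩
  change q.2 (E.symm x * p.1) + p.2 (q.1 * E.symm x) =
    q.2 (E.symm (x * E p.1)) + p.2 (E.symm (E q.1 * x))
  rw [hE, hE, E.symm_apply_apply, E.symm_apply_apply]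

end DerEq

namespace DerEq

universe v

section TrivAlg

variable (k : Type u) [Field k] (A : Type u) [Ring A] [Algebra k A]

instance : IsScalarTower k A (Module.Dual k A) where
  smul_assoc c a f := LinearMap.ext fun x => by
    change f (x * c • a) = c • f (x * a)
    rw [mul_smul_comm, map_smul]

instance : IsScalarTower k Aᵐᵒᵖ (Module.Dual k A) where
  smul_assoc c a f := LinearMap.ext fun x => by
    change f ((c • a.unop) * x) = c • f (a.unop * x)
    rw [smul_mul_assoc, map_smul]

noncomputable instance trivExtAlgebra : Algebra k (Paper.TrivExt k A) := inferInstance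

instance [Module.Finite k A] : Module.Finite k (Paper.TrivExt k A) :=
  inferInstanceAs (Module.Finite k (A × Module.Dual k A))

instance [Module.Finite k A] : IsNoetherianRing (Paper.TrivExt k A) :=
  isNoetherian_of_tower k inferInstance

/-- The symmetrizing form. -/
noncomputable def symForm : Paper.TrivExt k A →ₗ[k] k where
  toFun x := x.snd 1
  map_add' _ _ := rfl
  map_smul' _ _ := rfl

lemma symForm_mul (x y : Paper.TrivExt k A) :
    symForm k A (x * y) = y.snd x.fst + x.snd y.fst := by
  change y.snd (1 * x.fst) + x.snd (y.fst * 1) = _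
  rw [one_mul, mul_one]

lemma exists_symForm [Module.Finite k A] (φ : Module.Dual k (Paper.TrivExt k A)) :
    ∃ y, ∀ x, symForm k A (x * y) = φ x := by
  let ev := Module.evalEquiv k A
  let a : A := ev.symm (φ.comp (TrivSqZeroExt.inrHom A (Module.Dual k A) |>.restrictScalars k))
  refine ⟨(a, φ.comp (TrivSqZeroExt.inlAlgHom k A (Module.Dual k A)).toLinearMap), fun x => ?_⟩
  refine (symForm_mul k A x _).trans ?_
  have h : x.snd a = φ (TrivSqZeroExt.inr x.snd) := by
    have := LinearMap.congr_fun (ev.apply_symm_apply (φ.comp (TrivSqZeroExt.inrHom A (Module.Dual k A) |>.restrictScalars k))) x.snd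
    exact this
  refine Eq.trans (congrArg₂ (· + ·) rfl h) ?_
  change φ (TrivSqZeroExt.inl x.fst) + _ = _
  rw [← map_add, TrivSqZeroExt.inl_fst_add_inr_snd_eq]

lemma eq_zero_of_symForm (y : Paper.TrivExt k A) (h : ∀ x, symForm k A (x * y) = 0) : y = 0 := by
  refine Prod.ext ?_ (LinearMap.ext fun a => ?_)
  · refine (Module.forall_dual_apply_eq_zero_iff k _).1 fun f => ?_
    have := h (0, f)
    refine Eq.trans ?_ ((symForm_mul k A _ y).symm.trans this)
    change _ = y.snd 0 + f y.fst
    rw [map_zero, zero_add]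
    rfl
  · have := h (a, 0)
    refine Eq.trans ?_ ((symForm_mul k A _ y).symm.trans this)
    change _ = y.snd a + 0
    rw [add_zero]
    rfl

/-- The trivial extension cogenerates its finitely generated modules. -/
lemma exists_embedding_of_finite [Module.Finite k A] (Y : Type v) [AddCommGroup Y]
    [Module (Paper.TrivExt k A) Y] [Module.Finite (Paper.TrivExt k A) Y] :
    ∃ (r : ℕ) (f : Y →ₗ[Paper.TrivExt k A] (Fin r → Paper.TrivExt k A)), Function.Injective f := by
  let I1 : Module k Y := Module.compHom _ (algebraMap k (Paper.TrivExt k A))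
  have I2 : IsScalarTower k (Paper.TrivExt k A) Y := ⟨fun c x y => by
    change (c • x) • y = algebraMap k (Paper.TrivExt k A) c • x • y
    rw [Algebra.smul_def, mul_smul]⟩
  have : Module.Finite k Y := Module.Finite.trans (Paper.TrivExt k A) Y
  let b := Module.finBasis k Y
  have h1 : ∀ (l : Module.Dual k Y) (y : Y), ∃ z, ∀ x, symForm k A (x * z) = l (x • y) := fun l y =>
    exists_symForm k A (l.comp ((LinearMap.toSpanSingleton (Paper.TrivExt k A) Y y).restrictScalars k))
  choose g hg using h1
  have huniq : ∀ a c : Paper.TrivExt k A,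
      (∀ x, symForm k A (x * a) = symForm k A (x * c)) → a = c := fun a c h =>
    sub_eq_zero.1 (eq_zero_of_symForm k A _ fun x => by rw [mul_sub, map_sub, h, sub_self])
  refine ⟨Module.finrank k Y, {
    toFun := fun y i => g (b.coord i) y
    map_add' := fun y z => funext fun i => huniq _ _ fun x => by
      rw [Pi.add_apply, mul_add, map_add, hg, hg, hg, smul_add, map_add]
    map_smul' := fun t y => funext fun i => huniq _ _ fun x => by
      rw [hg, RingHom.id_apply, Pi.smul_apply, smul_eq_mul, ← mul_assoc, hg, mul_smul] }, ?_⟩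
  rw [injective_iff_map_eq_zero]
  intro y hy
  refine b.forall_coord_eq_zero_iff.1 fun i => ?_
  have h2 := hg (b.coord i) y 1
  have h3 : g (b.coord i) y = 0 := congrFun hy i
  rw [h3, mul_zero, map_zero, one_smul] at h2
  exact h2.symm

/-- Transport of the cogenerating property along a ring isomorphism. -/
lemma exists_embedding_of_ringEquiv [Module.Finite k A] {S : Type v} [Ring S]
    (e : S ≃+* Paper.TrivExt k A) (Y : Type v) [AddCommGroup Y] [Module S Y] [Module.Finite S Y] :
    ∃ (r : ℕ) (f : Y →ₗ[S] (Fin r → S)), Function.Injective f := by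
  let I1 : Module (Paper.TrivExt k A) Y := Module.compHom _ (e.symm : Paper.TrivExt k A →+* S)
  have hsm : ∀ (s : S) (y : Y), e s • y = s • y := fun s y => by
    change e.symm (e s) • y = _
    rw [e.symm_apply_apply]
  have I2 : Module.Finite (Paper.TrivExt k A) Y :=
    let σ : S →+* Paper.TrivExt k A := e
    have : RingHomSurjective σ := ⟨e.surjective⟩
    Module.Finite.of_surjective (σ := σ) (M := Y)
      { toFun := fun y => y
        map_add' := fun _ _ => rfl
        map_smul' := fun s y => (hsm s y).symm } fun y => ⟨y, rfl⟩
  obtain ⟨r, f, hf⟩ := exists_embedding_of_finite k A Y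
  refine ⟨r, {
    toFun := fun y i => e.symm (f y i)
    map_add' := fun y z => funext fun i => by rw [map_add, Pi.add_apply, map_add]; rfl
    map_smul' := fun s y => funext fun i => by
      rw [← hsm, map_smul, Pi.smul_apply, smul_eq_mul, map_mul, e.symm_apply_apply]; rfl }, ?_⟩
  exact fun y z h => hf (funext fun i => e.symm.injective (congrFun h i))

end TrivAlg

end DerEq

namespace DerEq

open CategoryTheory Limits Pretriangulated Triangulated DerivedCategory HomologicalComplex

open scoped ModuleCat

universe w w'

section Fin

variable (k : Type u) [Field k] {R : Type u} [Ring R] [Algebra k R] [Module.Finite k R]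
  [HasDerivedCategory.{w} (ModuleCat.{u} R)]

include k in
lemma noeth_coh_perf {m : ℕ} {K : CochainComplex (ModuleCat.{u} R) ℤ} (hK : IsPerf m K)
    (L : CochainComplex (ModuleCat.{u} R) ℤ) (hL : ∀ n, Module.Finite R (L.X n)) (n : ℤ) :
    IsNoetherian (End (Q.obj K))ᵐᵒᵖ (coh (Q.obj K) (Q.obj L) n) := by
  have := hK.isKProjective
  have hL' : ∀ i, Module.Finite R ((L⟦n⟧).X i) := fun i => hL (i + n)
  have := finite_hom k hK hL'
  let φ : (K ⟶ L⟦n⟧) →+ (Q.obj K ⟶ Q.obj (L⟦n⟧)) := Q.mapAddHom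
  have h : IsNoetherian (End (Q.obj K))ᵐᵒᵖ (Q.obj K ⟶ Q.obj (L⟦n⟧)) := by
    refine noeth_of_semilinear (R := k) (fun c => MulOpposite.op (Q.map (c • 𝟙 K))) φ
      Q_map_surjective (fun c f => ?_) LinearMap.id fun f hf => ?_
    · refine Eq.trans (congrArg Q.map ?_) (Q.map_comp (c • 𝟙 K) f)
      rw [Linear.smul_comp, Category.id_comp]
    · obtain rfl : f = 0 := hf
      exact map_zero φ
  have h0 : IsNoetherian (End (Q.obj K))ᵐᵒᵖ (coh (Q.obj K) (Q.obj (L⟦n⟧)) 0) :=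
    isNoetherian_of_linearEquiv (cohZero (Q.obj K) (Q.obj (L⟦n⟧))).symm
  have h1 : IsNoetherian (End (Q.obj K))ᵐᵒᵖ
    (coh (Q.obj K) ((shiftFunctor (CochainComplex (ModuleCat.{u} R) ℤ) n ⋙ Q).obj L) 0) := h0
  have h2 : IsNoetherian (End (Q.obj K))ᵐᵒᵖ (coh (Q.obj K) ((Q.obj L)⟦n⟧) 0) :=
    isNoetherian_of_linearEquiv (cohIso (Q.obj K) ((Q.commShiftIso n).app L) 0)
  exact isNoetherian_of_linearEquiv (cohShift (Q.obj K) (Q.obj L) n 0 n (by omega))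

lemma finite_single_X (X : ModuleCat.{u} R) [Module.Finite R X] (n : ℤ) :
    Module.Finite R (((CochainComplex.singleFunctor (ModuleCat.{u} R) 0).obj X).X n) := by
  by_cases h : n = 0
  · subst h
    exact Module.Finite.equiv
      (HomologicalComplex.singleObjXSelf (ComplexShape.up ℤ) (0 : ℤ) X).toLinearEquiv.symm
  · have : Subsingleton (((CochainComplex.singleFunctor (ModuleCat.{u} R) 0).obj X).X n) :=
      ModuleCat.subsingleton_of_isZero
        (HomologicalComplex.isZero_single_obj_X (ComplexShape.up ℤ) (0 : ℤ) X n h)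
    exact Module.Finite.of_finite

include k in
lemma noeth_coh_emb {m : ℕ} {K : CochainComplex (ModuleCat.{u} R) ℤ} (hK : IsPerf m K) (n : ℤ)
    (X : ModuleCat.{u} R) [Module.Finite R X] (j : ℤ) :
    IsNoetherian (End (Q.obj K))ᵐᵒᵖ (coh (Q.obj K) ((emb R n).obj X) j) := by
  have h := noeth_coh_perf k hK ((CochainComplex.singleFunctor (ModuleCat.{u} R) 0).obj X)
    (finite_single_X X) (n + j)
  have h' : IsNoetherian (End (Q.obj K))ᵐᵒᵖ
    (coh (Q.obj K) ((singleFunctor (ModuleCat.{u} R) 0).obj X) (n + j)) := h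
  exact isNoetherian_of_linearEquiv
    (cohShift (Q.obj K) ((singleFunctor (ModuleCat.{u} R) 0).obj X) n j (n + j) rfl).symm

end Fin

/-- A fully faithful additive functor and an isomorphism identify endomorphism rings. -/
lemma exists_ringEquiv_end {C : Type*} [Category C] {D : Type*} [Category D] [Preadditive C]
    [Preadditive D] (F : C ⥤ D) [F.Full] [F.Faithful] [F.Additive] {X : C} {Y : D} (e : F.obj X ≅ Y) :
    Nonempty ((End X)ᵐᵒᵖ ≃+* (End Y)ᵐᵒᵖ) := by
  let φ : End X →+* End Y :=
    { toFun := fun f => e.inv ≫ F.map f ≫ e.hom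
      map_one' := by
        change e.inv ≫ F.map (𝟙 X) ≫ e.hom = 𝟙 Y
        simp
      map_mul' := fun f g => by
        change e.inv ≫ F.map (g ≫ f) ≫ e.hom = (e.inv ≫ F.map g ≫ e.hom) ≫ e.inv ≫ F.map f ≫ e.hom
        simp
      map_zero' := by
        change e.inv ≫ F.map (0 : X ⟶ X) ≫ e.hom = 0
        rw [F.map_zero, zero_comp, comp_zero]
      map_add' := fun f g => by
        refine (congrArg (fun t => e.inv ≫ t ≫ e.hom) (F.map_add (f := f) (g := g))).trans ?_
        exact (congrArg (e.inv ≫ ·) (Preadditive.add_comp _ _ _ _ _ _)).trans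
          (Preadditive.comp_add _ _ _ _ _ _) }
  refine ⟨(RingEquiv.ofBijective φ ⟨fun f g h => ?_, fun g => ?_⟩).op⟩
  · have h' : e.inv ≫ F.map f ≫ e.hom = e.inv ≫ F.map g ≫ e.hom := h
    rw [cancel_epi, cancel_mono] at h'
    exact F.map_injective h'
  · obtain ⟨f, hf⟩ := F.map_surjective (e.hom ≫ g ≫ e.inv)
    refine ⟨f, ?_⟩
    change e.inv ≫ F.map f ≫ e.hom = g
    rw [hf]
    simp

end DerEq

namespace DerEq

open CategoryTheory Limits Pretriangulated Triangulated DerivedCategory HomologicalComplex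

open scoped ModuleCat

variable (k : Type u) [Field k] {A B : Type u} [Ring A] [Ring B] [Algebra k A] [Algebra k B]
  [Module.Finite k A] [Module.Finite k B]
  [HasDerivedCategory.{u} (ModuleCat.{u} A)] [HasDerivedCategory.{u} (ModuleCat.{u} B)]

/-- One half of the invariance of the extension dimension of trivial extensions. -/
theorem extDim_trivExt_le (F : DerivedCategory (ModuleCat.{u} A) ≌ DerivedCategory (ModuleCat.{u} B))
    [F.functor.CommShift ℤ] [F.functor.IsTriangulated] :
    Paper.extDim (Paper.TrivExt k B) ≤ Paper.extDim (Paper.TrivExt k A) := by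
  have : F.functor.Additive := inferInstance
  obtain ⟨w, K, hK, ⟨e⟩, ht⟩ := exists_tilting k F
  have hv : ∀ j : ℤ, j ≠ 0 → Van (Q.obj K) (Q.obj K) j := fun j hj =>
    (van_map_iff F.functor _ _ j).1
      (Van.of_iso e.symm ((van_iff_of_iso e.symm _ j).1 (van_reg_self j hj)))
  obtain ⟨e₁⟩ := exists_ringEquiv_end F.functor e
  let e₂ : EndQ K ≃+* B := e₁.trans (RingEquiv.ofBijective regEnd regEnd_bijective).symm
  have := finite_endQ k hK
  obtain ⟨e₃⟩ := trivExt_ringEquiv k k e₂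
  let : HasDerivedCategory.{u + 1} (ModuleCat.{u} (Paper.TrivExt k A)) :=
    HasDerivedCategory.standard _
  obtain ⟨e₄⟩ := exists_ringEquiv_trivExt k hK
  let S : Type (u + 1) := (End (Q.obj ((indC k).obj K)))ᵐᵒᵖ
  let ε : S ≃+* Paper.TrivExt k B := e₄.trans e₃
  have hS : IsNoetherianRing S := isNoetherianRing_of_ringEquiv _ ε.symm
  refine (extDim_le_of_ringEquiv ε).trans ?_
  refine extDim_end_le (Q.obj ((indC k).obj K)) (reg (Paper.TrivExt k A)) w (van_ind k hK hv)
    van_reg_self (fun Y hY => exists_embedding_of_ringEquiv k B ε Y) (fun X i h => (hK.ind k).van X i h)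
    (van_reg_of_ind k hK ht) (noeth_coh_of_finite _ fun n => ((hK.ind k).fp n).2)
    exists_truncation (emb _ w) (emb_triangle _) (van_emb _)
    (fun X hX j => noeth_coh_emb k (hK.ind k) w X j) (fun E h1 h2 => exists_heart _ E h1 h2)

end DerEq

open Paper CategoryTheory in
/-- If `A` and `B` are derived equivalent finite dimensional
algebras over a field `k`, then the trivial extensions `A ⋉ D(A)` and
`B ⋉ D(B)` have the same extension dimension. -/
theorem stmt11 (k : Type u) [Field k]
    (A : Type u) [Ring A] [Algebra k A] [FiniteDimensional k A]
    (B : Type u) [Ring B] [Algebra k B] [FiniteDimensional k B]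
    [HasDerivedCategory.{u} (ModuleCat.{u} A)]
    [HasDerivedCategory.{u} (ModuleCat.{u} B)]
    (F : DerivedCategory (ModuleCat.{u} A) ≌ DerivedCategory (ModuleCat.{u} B))
    [F.functor.CommShift ℤ] [F.functor.IsTriangulated] :
    extDim (TrivExt k A) = extDim (TrivExt k B) := by
  let : F.inverse.CommShift ℤ := F.toAdjunction.rightAdjointCommShift ℤ
  have : F.CommShift ℤ := F.toAdjunction.commShift_of_leftAdjoint ℤ
  have : F.inverse.IsTriangulated := F.toAdjunction.isTriangulated_rightAdjoint
  exact le_antisymm (DerEq.extDim_trivExt_le k F.symm) (DerEq.extDim_trivExt_le k F)
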